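/- Let D ⊂ ℂⁿ be a bounded α-regular domain and K ⊂ D a compact set. The function z ↦ ω_α(z,K,D) is continuous on D if and only if K is an α-regular compact set, i.e., ω*_α(z₀,K,D) = −1 for every z₀ ∈ K. -/

import Mathlib

open MeasureTheory Filter Topology Complex Metric

noncomputable section

/-- Complex `n`-space. -/
abbrev Cn (n : ℕ) := Fin n → ℂ

/-- The Wirtinger derivative `∂f/∂z_j` of a (real-differentiable) function `f : ℂⁿ → ℂ`. -/
noncomputable def wdz {n : ℕ} (j : Fin n) (f : Cn n → ℂ) (z : Cn n) : ℂ :=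
  (fderiv ℝ f z (Pi.single j 1) - Complex.I * fderiv ℝ f z (Pi.single j Complex.I)) / 2

/-- The Wirtinger derivative `∂f/∂z̄_j` of a (real-differentiable) function `f : ℂⁿ → ℂ`. -/
noncomputable def wdzbar {n : ℕ} (j : Fin n) (f : Cn n → ℂ) (z : Cn n) : ℂ :=
  (fderiv ℝ f z (Pi.single j 1) + Complex.I * fderiv ℝ f z (Pi.single j Complex.I)) / 2

/-- The square of the Euclidean norm `|z|² = ∑ |z_i|²` on `ℂⁿ`. -/
noncomputable def sqNorm {n : ℕ} (z : Cn n) : ℝ := ∑ i, Complex.normSq (z i)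

/-- A closed, strictly positive differential form `α` of bidegree `(n-1, n-1)` with `C¹`
coefficients on `ℂⁿ`, recorded through its normalized coefficient matrix:  `coeff j k` is
the Hermitian positive-definite matrix `A_{jk}` such that
`dd^c u ∧ α = (∑_{j,k} A_{jk} ∂²u/∂z_j∂z̄_k) dV`.  In these terms closedness of `α`
reads `∑_j ∂A_{jk}/∂z_j = 0` for every `k` (the conjugate identity follows by
Hermitian symmetry). -/
structure AlphaForm (n : ℕ) where
  coeff : Fin n → Fin n → Cn n → ℂ
  contDiff : ∀ j k, ContDiff ℝ 1 (coeff j k)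
  hermitian : ∀ j k z, coeff k j z = starRingEnd ℂ (coeff j k z)
  strictlyPositive : ∀ z : Cn n, ∀ ξ : Fin n → ℂ, ξ ≠ 0 →
    0 < (∑ j, ∑ k, coeff j k z * ξ j * starRingEnd ℂ (ξ k)).re
  closed : ∀ k, ∀ z : Cn n, (∑ j, wdz j (coeff j k) z) = 0

/-- The second order operator `f ↦ ∑_{j,k} A_{jk} ∂²f/∂z_j∂z̄_k` representing the
top-degree form `dd^c f ∧ α` (with respect to Lebesgue measure). -/
noncomputable def alphaOp {n : ℕ} (A : AlphaForm n) (f : Cn n → ℂ) (z : Cn n) : ℂ :=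
  ∑ j, ∑ k, A.coeff j k z * wdzbar k (wdz j f) z

/-- The operator `alphaOp` applied to a real-valued function, returning the real part. -/
noncomputable def alphaOpR {n : ℕ} (A : AlphaForm n) (ω : Cn n → ℝ) (z : Cn n) : ℝ :=
  (alphaOp A (fun w => (ω w : ℂ)) z).re

/-- `u : ℂⁿ → EReal` is `α`-subharmonic on `D`: it is finite-or-`-∞`, strongly upper
semicontinuous on `D`, locally integrable on `D`, and the current `dd^c u ∧ α` is
positive, i.e. `∫_D u · (α ∧ dd^c ω) ≥ 0` for every nonnegative test function `ω` on `D`. -/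
def IsAlphaSubharmonicE {n : ℕ} (A : AlphaForm n) (D : Set (Cn n)) (u : Cn n → EReal) : Prop :=
  (∀ z ∈ D, u z ≠ ⊤) ∧
  UpperSemicontinuousOn u D ∧
  (∀ z₀ ∈ D, ∀ S : Set (Cn n),
      (∃ N ∈ 𝓝 z₀, volume (N \ S) = 0) → Filter.limsup u (𝓝[S] z₀) = u z₀) ∧
  LocallyIntegrableOn (fun z => (u z).toReal) D volume ∧
  ∀ ω : Cn n → ℝ, ContDiff ℝ (⊤ : ℕ∞) ω → HasCompactSupport ω → tsupport ω ⊆ D →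
    (∀ z, 0 ≤ ω z) → 0 ≤ ∫ z in D, (u z).toReal * alphaOpR A ω z

/-- A real-valued function is `α`-subharmonic on `D` if it is so as an `EReal`-valued
function. -/
def IsAlphaSubharmonic {n : ℕ} (A : AlphaForm n) (D : Set (Cn n)) (u : Cn n → ℝ) : Prop :=
  IsAlphaSubharmonicE A D (fun z => (u z : EReal))

/-- `h` is `α`-harmonic on the open set `U`: `dd^c h ∧ α = 0` there, in the sense of
currents. -/
def IsAlphaHarmonicOn {n : ℕ} (A : AlphaForm n) (U : Set (Cn n)) (h : Cn n → ℝ) : Prop :=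
  LocallyIntegrableOn h U volume ∧
  ∀ ω : Cn n → ℝ, ContDiff ℝ (⊤ : ℕ∞) ω → HasCompactSupport ω → tsupport ω ⊆ U →
    (∫ z in U, h z * alphaOpR A ω z) = 0

/-- `u` is strictly `α`-subharmonic on `G`: for every compact subdomain `G' ⋐ G` there is
`ε > 0` with `u - ε|z|²` `α`-subharmonic on `G'`. -/
def IsStrictlyAlphaSubharmonic {n : ℕ} (A : AlphaForm n) (G : Set (Cn n)) (u : Cn n → ℝ) :
    Prop :=
  ∀ G' : Set (Cn n), IsOpen G' → IsCompact (closure G') → closure G' ⊆ G →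
    ∃ ε > (0 : ℝ), IsAlphaSubharmonic A G' (fun z => u z - ε * sqNorm z)

/-- `D` is a bounded `α`-regular domain: a bounded domain carrying a negative
`α`-subharmonic exhaustion `ρ` with boundary limit `0`. -/
def IsAlphaRegularDomain {n : ℕ} (A : AlphaForm n) (D : Set (Cn n)) : Prop :=
  IsOpen D ∧ IsConnected D ∧ Bornology.IsBounded D ∧
  ∃ ρ : Cn n → ℝ, IsAlphaSubharmonic A D ρ ∧ (∀ z ∈ D, ρ z < 0) ∧
    ∀ ζ ∈ frontier D, Filter.Tendsto ρ (𝓝[D] ζ) (𝓝 0)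

/-- `D` is a strongly `α`-regular domain: `D = {ρ < 0}` for some `ρ` which is `C²` and
strictly `α`-subharmonic on a neighborhood `D⁺` of `closure D`. -/
def IsStronglyAlphaRegularDomain {n : ℕ} (A : AlphaForm n) (D : Set (Cn n)) : Prop :=
  IsOpen D ∧ IsConnected D ∧ Bornology.IsBounded D ∧
  ∃ Dp : Set (Cn n), IsOpen Dp ∧ closure D ⊆ Dp ∧
    ∃ ρ : Cn n → ℝ, ContDiffOn ℝ 2 ρ Dp ∧ IsStrictlyAlphaSubharmonic A Dp ρ ∧
      D = {z ∈ Dp | ρ z < 0}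

/-- The class `U(E, D, ψ)` of `α`-subharmonic functions `u` on `D` with `u ≤ ψ` on `E`
and `u < 0` on `D`. -/
def Uclass {n : ℕ} (A : AlphaForm n) (E D : Set (Cn n)) (ψ : Cn n → ℝ) :
    Set (Cn n → ℝ) :=
  {u | IsAlphaSubharmonic A D u ∧ (∀ z ∈ E, u z ≤ ψ z) ∧ ∀ z ∈ D, u z < 0}

/-- The weighted extremal function `ω_α(z, E, D, ψ)`. -/
noncomputable def omegaW {n : ℕ} (A : AlphaForm n) (E D : Set (Cn n)) (ψ : Cn n → ℝ)
    (z : Cn n) : ℝ :=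
  sSup ((fun u : Cn n → ℝ => u z) '' Uclass A E D ψ)

/-- The weighted `α`-subharmonic measure `ω*_α(z, E, D, ψ)`: the upper semicontinuous
regularization of `ω_α(·, E, D, ψ)`. -/
noncomputable def omegaWStar {n : ℕ} (A : AlphaForm n) (E D : Set (Cn n)) (ψ : Cn n → ℝ)
    (z : Cn n) : ℝ :=
  Filter.limsup (omegaW A E D ψ) (𝓝 z)

/-- The (unweighted) extremal function `ω_α(z, E, D)`. -/
noncomputable def omega0 {n : ℕ} (A : AlphaForm n) (E D : Set (Cn n)) : Cn n → ℝ :=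
  omegaW A E D (fun _ => (-1 : ℝ))

/-- The (unweighted) `α`-subharmonic measure `ω*_α(z, E, D)`. -/
noncomputable def omega0Star {n : ℕ} (A : AlphaForm n) (E D : Set (Cn n)) : Cn n → ℝ :=
  omegaWStar A E D (fun _ => (-1 : ℝ))

/-- `S` is `α`-polar in `D`: there is an `α`-subharmonic `ρ` on `D`, not identically
`-∞`, with `ρ = -∞` on `S`. -/
def IsAlphaPolar {n : ℕ} (A : AlphaForm n) (D S : Set (Cn n)) : Prop :=
  ∃ ρ : Cn n → EReal, IsAlphaSubharmonicE A D ρ ∧ (∃ z ∈ D, ρ z ≠ ⊥) ∧ ∀ z ∈ S, ρ z = ⊥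

/-- `u` is plurisubharmonic on `D`: upper semicontinuous, locally integrable, and with
positive semidefinite complex Hessian in the sense of distributions. -/
def IsPlurisubharmonic {n : ℕ} (D : Set (Cn n)) (u : Cn n → ℝ) : Prop :=
  UpperSemicontinuousOn u D ∧ LocallyIntegrableOn u D volume ∧
  ∀ ξ : Fin n → ℂ, ∀ ω : Cn n → ℝ, ContDiff ℝ (⊤ : ℕ∞) ω → HasCompactSupport ω →
    tsupport ω ⊆ D → (∀ z, 0 ≤ ω z) →
    0 ≤ ∫ z in D, u z *
      (∑ j, ∑ k, ξ j * starRingEnd ℂ (ξ k) * wdzbar k (wdz j (fun w => (ω w : ℂ))) z).re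

/-- The class `U(E,D)` for the plurisubharmonic measure. -/
def UclassPsh {n : ℕ} (E D : Set (Cn n)) : Set (Cn n → ℝ) :=
  {u | IsPlurisubharmonic D u ∧ (∀ z ∈ E, u z ≤ -1) ∧ ∀ z ∈ D, u z < 0}

/-- The plurisubharmonic extremal function `ω(z, E, D)`. -/
noncomputable def omegaPsh {n : ℕ} (E D : Set (Cn n)) (z : Cn n) : ℝ :=
  sSup ((fun u : Cn n → ℝ => u z) '' UclassPsh E D)

/-- The plurisubharmonic measure `ω*(z, E, D)`. -/
noncomputable def omegaPshStar {n : ℕ} (E D : Set (Cn n)) (z : Cn n) : ℝ :=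
  Filter.limsup (omegaPsh E D) (𝓝 z)

end

open MeasureTheory Filter Topology Complex Metric
namespace AlphaAux

/-- Unified Wirtinger derivative. -/
noncomputable def wd {n : ℕ} (c : ℂ) (j : Fin n) (f : Cn n → ℂ) (z : Cn n) : ℂ :=
  (fderiv ℝ f z (Pi.single j 1) + c * fderiv ℝ f z (Pi.single j Complex.I)) / 2

variable {n : ℕ}

theorem wdz_eq (j : Fin n) (f : Cn n → ℂ) : wdz j f = wd (-Complex.I) j f := by
  funext z; simp [wdz, wd, sub_eq_add_neg]

theorem wdzbar_eq (j : Fin n) (f : Cn n → ℂ) : wdzbar j f = wd (Complex.I) j f := by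
  funext z; simp [wdzbar, wd]

theorem contDiff_fderiv_apply' {m : WithTop ℕ∞} {f : Cn n → ℂ} (hf : ContDiff ℝ (m + 1) f)
    (v : Cn n) : ContDiff ℝ m (fun z => fderiv ℝ f z v) :=
  (hf.fderiv_right le_rfl).clm_apply contDiff_const

theorem contDiff_wd {m : WithTop ℕ∞} (c : ℂ) (j : Fin n) {f : Cn n → ℂ}
    (hf : ContDiff ℝ (m + 1) f) : ContDiff ℝ m (wd c j f) := by
  have h1 := contDiff_fderiv_apply' hf (Pi.single j 1)
  have h2 := contDiff_fderiv_apply' hf (Pi.single j Complex.I)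
  have : ContDiff ℝ m (fun z => (fderiv ℝ f z (Pi.single j 1)
      + c * fderiv ℝ f z (Pi.single j Complex.I)) * (2:ℂ)⁻¹) := by fun_prop
  exact this

theorem wd_mul (c : ℂ) (j : Fin n) {f g : Cn n → ℂ} {z : Cn n}
    (hf : DifferentiableAt ℝ f z) (hg : DifferentiableAt ℝ g z) :
    wd c j (fun w => f w * g w) z = wd c j f z * g z + f z * wd c j g z := by
  unfold wd
  rw [fderiv_fun_mul hf hg]
  simp
  ring

theorem wd_sub (c : ℂ) (j : Fin n) {f g : Cn n → ℂ} {z : Cn n}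
    (hf : DifferentiableAt ℝ f z) (hg : DifferentiableAt ℝ g z) :
    wd c j (fun w => f w - g w) z = wd c j f z - wd c j g z := by
  unfold wd
  rw [fderiv_fun_sub hf hg]
  simp
  ring

theorem wd_add (c : ℂ) (j : Fin n) {f g : Cn n → ℂ} {z : Cn n}
    (hf : DifferentiableAt ℝ f z) (hg : DifferentiableAt ℝ g z) :
    wd c j (fun w => f w + g w) z = wd c j f z + wd c j g z := by
  unfold wd
  rw [fderiv_fun_add hf hg]
  simp
  ring

theorem wd_const_mul (c : ℂ) (j : Fin n) {f : Cn n → ℂ} {z : Cn n} (a : ℂ)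
    (hf : DifferentiableAt ℝ f z) :
    wd c j (fun w => a * f w) z = a * wd c j f z := by
  unfold wd
  rw [fderiv_const_mul hf a]
  simp
  ring

theorem hasCompactSupport_wd (c : ℂ) (j : Fin n) {f : Cn n → ℂ} (hf : HasCompactSupport f) :
    HasCompactSupport (wd c j f) := by
  have h : HasCompactSupport (fderiv ℝ f) := hf.fderiv ℝ
  refine h.mono ?_
  intro z hz
  contrapose! hz
  simp only [Function.mem_support, not_not] at hz ⊢
  simp [wd, hz]

theorem tsupport_wd (c : ℂ) (j : Fin n) (f : Cn n → ℂ) :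
    tsupport (wd c j f) ⊆ tsupport f := by
  refine (closure_mono ?_).trans (tsupport_fderiv_subset ℝ (f := f))
  intro z hz
  contrapose! hz
  simp only [Function.mem_support, not_not] at hz ⊢
  simp [wd, hz]

theorem wd_comm (c d : ℂ) (j k : Fin n) {f : Cn n → ℂ} (hf : ContDiff ℝ 2 f) (z : Cn n) :
    wd c j (wd d k f) z = wd d k (wd c j f) z := by
  have hsym : IsSymmSndFDerivAt ℝ f z := hf.contDiffAt.isSymmSndFDerivAt (by simp)
  have hd : DifferentiableAt ℝ (fderiv ℝ f) z :=
    (hf.fderiv_right (m := 1) (by norm_num)).differentiable (by norm_num) z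
  have key : ∀ v w : Cn n, fderiv ℝ (fun x => fderiv ℝ f x v) z w = fderiv ℝ (fderiv ℝ f) z w v := by
    intro v w
    rw [fderiv_clm_apply hd (by fun_prop)]
    simp
  have hd' : ∀ v, DifferentiableAt ℝ (fun x => fderiv ℝ f x v) z := fun v => by fun_prop
  have key2 : ∀ (c : ℂ) (j : Fin n) (w : Cn n), fderiv ℝ (wd c j f) z w =
      (fderiv ℝ (fderiv ℝ f) z w (Pi.single j 1) +
        c * fderiv ℝ (fderiv ℝ f) z w (Pi.single j Complex.I)) / 2 := by
    intro c j w
    have : wd c j f = fun x => (2:ℂ)⁻¹ * (fderiv ℝ f x (Pi.single j 1)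
      + c * fderiv ℝ f x (Pi.single j Complex.I)) := by
      funext x; unfold wd; ring
    rw [this, fderiv_const_mul (by fun_prop), fderiv_fun_add (by fun_prop) (by fun_prop),
      fderiv_const_mul (by fun_prop)]
    simp only [smul_apply, add_apply, key, smul_eq_mul]
    ring
  conv_lhs => unfold wd
  conv_rhs => unfold wd
  change (fderiv ℝ (wd d k f) z _ + c * fderiv ℝ (wd d k f) z _) / 2 =
    (fderiv ℝ (wd c j f) z _ + d * fderiv ℝ (wd c j f) z _) / 2
  rw [key2, key2, key2, key2]
  rw [hsym.eq (Pi.single j 1) (Pi.single k 1), hsym.eq (Pi.single j 1) (Pi.single k I),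
    hsym.eq (Pi.single j I) (Pi.single k 1), hsym.eq (Pi.single j I) (Pi.single k I)]
  ring

theorem conj_wd (c : ℂ) (j : Fin n) {f : Cn n → ℂ} {z : Cn n} (hf : DifferentiableAt ℝ f z) :
    wd (starRingEnd ℂ c) j (fun w => starRingEnd ℂ (f w)) z = starRingEnd ℂ (wd c j f z) := by
  have h : HasFDerivAt (fun w => starRingEnd ℂ (f w))
      ((Complex.conjCLE : ℂ →L[ℝ] ℂ).comp (fderiv ℝ f z)) z :=
    (Complex.conjCLE : ℂ →L[ℝ] ℂ).hasFDerivAt.comp z hf.hasFDerivAt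
  unfold wd
  rw [h.fderiv]
  have h2 : (starRingEnd ℂ) (2:ℂ) = 2 := Complex.conj_ofNat 2
  simp [h2]

theorem integrable_mul_of_hcs {f g : Cn n → ℂ} (hf : Continuous f) (hg : Continuous g)
    (hc : HasCompactSupport g) : Integrable (fun x => f x * g x) volume :=
  (hf.mul hg).integrable_of_hasCompactSupport hc.mul_left

theorem ibp (c : ℂ) (j : Fin n) {f g : Cn n → ℂ} (hf : ContDiff ℝ 1 f) (hg : ContDiff ℝ 1 g)
    (hc : HasCompactSupport g) :
    ∫ x, f x * wd c j g x = - ∫ x, wd c j f x * g x := by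
  have hfd : ∀ v, Continuous fun x => fderiv ℝ f x v := fun v =>
    (contDiff_fderiv_apply' (m := 0) (by simpa using hf) v).continuous
  have hgd : ∀ v, Continuous fun x => fderiv ℝ g x v := fun v =>
    (contDiff_fderiv_apply' (m := 0) (by simpa using hg) v).continuous
  have hgc : ∀ v, HasCompactSupport fun x => fderiv ℝ g x v := fun v =>
    hc.fderiv_apply ℝ v
  have i1 : ∀ v, Integrable (fun x => fderiv ℝ f x v * g x) volume := fun v =>
    integrable_mul_of_hcs (hfd v) hg.continuous hc
  have i2 : ∀ v, Integrable (fun x => f x * fderiv ℝ g x v) volume := fun v =>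
    integrable_mul_of_hcs hf.continuous (hgd v) (hgc v)
  have key : ∀ v, ∫ x, f x * fderiv ℝ g x v = - ∫ x, fderiv ℝ f x v * g x := fun v =>
    integral_mul_fderiv_eq_neg_fderiv_mul_of_integrable (i1 v) (i2 v)
      (integrable_mul_of_hcs hf.continuous hg.continuous hc)
      (fun x _ => hf.differentiable (by norm_num) x) (fun x _ => hg.differentiable (by norm_num) x)
  have e1 : (fun x => f x * wd c j g x) = fun x => (2:ℂ)⁻¹ * (f x * fderiv ℝ g x (Pi.single j 1))
      + (2:ℂ)⁻¹ * c * (f x * fderiv ℝ g x (Pi.single j I)) := by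
    funext x; unfold wd; ring
  have e2 : (fun x => wd c j f x * g x) = fun x => (2:ℂ)⁻¹ * (fderiv ℝ f x (Pi.single j 1) * g x)
      + (2:ℂ)⁻¹ * c * (fderiv ℝ f x (Pi.single j I) * g x) := by
    funext x; unfold wd; ring
  rw [e1, e2, integral_add ((i2 _).const_mul _) ((i2 _).const_mul _),
    integral_add ((i1 _).const_mul _) ((i1 _).const_mul _)]
  simp only [integral_const_mul, key]
  ring

theorem closed_bar (A : AlphaForm n) (j : Fin n) (z : Cn n) :
    ∑ k, wd I k (A.coeff j k) z = 0 := by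
  have h := A.closed j z
  have h2 : starRingEnd ℂ (∑ k, wdz k (A.coeff k j) z) = 0 := by rw [h]; simp
  rw [map_sum] at h2
  rw [← h2]
  refine Finset.sum_congr rfl fun k _ => ?_
  rw [wdz_eq, ← conj_wd _ _ ((A.contDiff k j).differentiable (by norm_num) z)]
  have : (fun w => starRingEnd ℂ (A.coeff k j w)) = A.coeff j k := by
    funext w; rw [A.hermitian k j w]
  rw [this]; simp

theorem closed' (A : AlphaForm n) (k : Fin n) (z : Cn n) :
    ∑ j, wd (-I) j (A.coeff j k) z = 0 := by
  have h := A.closed k z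
  simpa [wdz_eq] using h

theorem selfadjoint_c (A : AlphaForm n) {ψ φ : Cn n → ℂ} (hψ : ContDiff ℝ 2 ψ)
    (hφ : ContDiff ℝ 2 φ) (hc : HasCompactSupport φ) :
    ∫ z, ψ z * alphaOp A φ z = ∫ z, φ z * alphaOp A ψ z := by
  have hA := A.contDiff
  have hAc := fun j k => (hA j k).continuous
  have hψ1 : ContDiff ℝ 1 ψ := hψ.of_le (by norm_num)
  have hφ1 : ContDiff ℝ 1 φ := hφ.of_le (by norm_num)
  have dψ : ∀ c j, ContDiff ℝ 1 (wd c j ψ) := fun c j => contDiff_wd c j (by rw [one_add_one_eq_two]; exact hψ)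
  have dφ : ∀ c j, ContDiff ℝ 1 (wd c j φ) := fun c j => contDiff_wd c j (by rw [one_add_one_eq_two]; exact hφ)
  have dA : ∀ c l j k, Continuous (wd c l (A.coeff j k)) := fun c l j k =>
    (contDiff_wd (m := 0) c l (by simpa using hA j k)).continuous
  have ddψ : ∀ c j d k, Continuous (wd c j (wd d k ψ)) := fun c j d k =>
    (contDiff_wd (m := 0) c j (by simpa using dψ d k)).continuous
  have ddφ : ∀ c j d k, Continuous (wd c j (wd d k φ)) := fun c j d k =>
    (contDiff_wd (m := 0) c j (by simpa using dφ d k)).continuous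
  have cdφ : ∀ c j, HasCompactSupport (wd c j φ) := fun c j => hasCompactSupport_wd c j hc
  have e1 : (fun z => ψ z * alphaOp A φ z) = fun z => ∑ j, ∑ k,
      (ψ z * A.coeff j k z) * wd I k (wd (-I) j φ) z := by
    funext z; simp only [alphaOp, wdz_eq, wdzbar_eq, Finset.mul_sum]
    refine Finset.sum_congr rfl fun j _ => Finset.sum_congr rfl fun k _ => by ring
  have e2 : (fun z => φ z * alphaOp A ψ z) = fun z => ∑ k, ∑ j,
      (A.coeff j k z * wd (-I) j (wd I k ψ) z) * φ z := by
    funext z; simp only [alphaOp, wdz_eq, wdzbar_eq, Finset.mul_sum]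
    rw [Finset.sum_comm]
    refine Finset.sum_congr rfl fun j _ => Finset.sum_congr rfl fun k _ => ?_
    rw [wd_comm _ _ _ _ hψ]; ring
  -- first integration by parts
  have s1 : ∀ j k, ∫ z, (ψ z * A.coeff j k z) * wd I k (wd (-I) j φ) z =
      - ∫ z, (wd I k ψ z * A.coeff j k z + ψ z * wd I k (A.coeff j k) z) * wd (-I) j φ z := by
    intro j k
    rw [ibp I k (hψ1.mul (hA j k)) (dφ _ j) (cdφ _ j)]
    congr 2; funext z
    rw [wd_mul _ _ (hψ1.differentiable (by norm_num) z) ((hA j k).differentiable (by norm_num) z)]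
  have s2 : ∀ j k, ∫ z, (wd I k ψ z * A.coeff j k z) * wd (-I) j φ z =
      - ∫ z, (wd (-I) j (wd I k ψ) z * A.coeff j k z + wd I k ψ z * wd (-I) j (A.coeff j k) z)
        * φ z := by
    intro j k
    rw [ibp (-I) j ((dψ I k).mul (hA j k)) hφ1 hc]
    congr 2; funext z
    rw [wd_mul _ _ ((dψ I k).differentiable (by norm_num) z)
      ((hA j k).differentiable (by norm_num) z)]
  have i1 : ∀ j k, Integrable (fun z => (ψ z * A.coeff j k z) * wd I k (wd (-I) j φ) z) volume :=
    fun j k => integrable_mul_of_hcs (hψ.continuous.mul (hAc j k)) (ddφ _ _ _ _)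
      (hasCompactSupport_wd _ _ (cdφ _ _))
  have i2 : ∀ j k, Integrable (fun z => (wd I k ψ z * A.coeff j k z) * wd (-I) j φ z) volume :=
    fun j k => integrable_mul_of_hcs ((dψ _ _).continuous.mul (hAc j k)) (dφ _ _).continuous
      (cdφ _ _)
  have i3 : ∀ j k, Integrable (fun z => (ψ z * wd I k (A.coeff j k) z) * wd (-I) j φ z) volume :=
    fun j k => integrable_mul_of_hcs (hψ.continuous.mul (dA _ _ _ _)) (dφ _ _).continuous
      (cdφ _ _)
  have i4 : ∀ j k, Integrable (fun z => (A.coeff j k z * wd (-I) j (wd I k ψ) z) * φ z) volume :=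
    fun j k => integrable_mul_of_hcs ((hAc j k).mul (ddψ _ _ _ _)) hφ.continuous hc
  have i5 : ∀ j k, Integrable (fun z => (wd I k ψ z * wd (-I) j (A.coeff j k) z) * φ z) volume :=
    fun j k => integrable_mul_of_hcs ((dψ _ _).continuous.mul (dA _ _ _ _)) hφ.continuous hc
  have z1 : ∀ j, ∑ k, ∫ z, (ψ z * wd I k (A.coeff j k) z) * wd (-I) j φ z = 0 := by
    intro j
    rw [← integral_finsetSum _ fun k _ => i3 j k]
    have : (fun z => ∑ k, (ψ z * wd I k (A.coeff j k) z) * wd (-I) j φ z) = fun z => 0 := by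
      funext z
      rw [← Finset.sum_mul, ← Finset.mul_sum, closed_bar]; simp
    rw [this]; simp
  have z2 : ∀ k, ∑ j, ∫ z, (wd I k ψ z * wd (-I) j (A.coeff j k) z) * φ z = 0 := by
    intro k
    rw [← integral_finsetSum _ fun j _ => i5 j k]
    have : (fun z => ∑ j, (wd I k ψ z * wd (-I) j (A.coeff j k) z) * φ z) = fun z => 0 := by
      funext z
      rw [← Finset.sum_mul, ← Finset.mul_sum, closed']; simp
    rw [this]; simp
  rw [e1, e2, integral_finsetSum _ fun j _ => integrable_finsetSum _ fun k _ => i1 j k,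
    integral_finsetSum _ fun k _ => integrable_finsetSum _ fun j _ => i4 j k]
  have L1 : ∀ j, ∫ z, ∑ k, (ψ z * A.coeff j k z) * wd I k (wd (-I) j φ) z =
      - ∑ k, ∫ z, (wd I k ψ z * A.coeff j k z) * wd (-I) j φ z := by
    intro j
    rw [integral_finsetSum _ fun k _ => i1 j k, ← Finset.sum_neg_distrib]
    have : ∀ k, ∫ z, (ψ z * A.coeff j k z) * wd I k (wd (-I) j φ) z =
      - (∫ z, (wd I k ψ z * A.coeff j k z) * wd (-I) j φ z)
      - ∫ z, (ψ z * wd I k (A.coeff j k) z) * wd (-I) j φ z := by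
      intro k
      rw [s1]; simp only [add_mul]; rw [integral_add (i2 j k) (i3 j k)]; ring
    rw [Finset.sum_congr rfl fun k _ => this k, Finset.sum_sub_distrib, z1, sub_zero]
  have L2 : ∀ k, ∑ j, ∫ z, (wd I k ψ z * A.coeff j k z) * wd (-I) j φ z =
      - ∫ z, ∑ j, (A.coeff j k z * wd (-I) j (wd I k ψ) z) * φ z := by
    intro k
    rw [integral_finsetSum _ fun j _ => i4 j k, ← Finset.sum_neg_distrib]
    have : ∀ j, ∫ z, (wd I k ψ z * A.coeff j k z) * wd (-I) j φ z =
      - (∫ z, (A.coeff j k z * wd (-I) j (wd I k ψ) z) * φ z)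
      - ∫ z, (wd I k ψ z * wd (-I) j (A.coeff j k) z) * φ z := by
      intro j
      have e : (fun z => (wd (-I) j (wd I k ψ) z * A.coeff j k z +
          wd I k ψ z * wd (-I) j (A.coeff j k) z) * φ z) = fun z =>
          (A.coeff j k z * wd (-I) j (wd I k ψ) z) * φ z +
          (wd I k ψ z * wd (-I) j (A.coeff j k) z) * φ z := by
        funext z; ring
      rw [s2, e, integral_add (i4 j k) (i5 j k)]; ring
    rw [Finset.sum_congr rfl fun k _ => this k, Finset.sum_sub_distrib, z2, sub_zero]
  rw [Finset.sum_congr rfl fun j _ => L1 j, Finset.sum_neg_distrib, Finset.sum_comm,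
    Finset.sum_congr rfl fun k _ => L2 k, Finset.sum_neg_distrib, neg_neg]

end AlphaAux

open MeasureTheory Filter Topology Complex Metric
namespace AlphaAux
variable {n : ℕ}

theorem contDiff_ofReal' {m : WithTop ℕ∞} {f : Cn n → ℝ} (hf : ContDiff ℝ m f) :
    ContDiff ℝ m (fun z => (f z : ℂ)) :=
  Complex.ofRealCLM.contDiff.comp hf

theorem wdd_contDiff {f : Cn n → ℂ} (hf : ContDiff ℝ 2 f) (c : ℂ) (j : Fin n) :
    ContDiff ℝ 1 (wd c j f) := contDiff_wd c j (by rw [one_add_one_eq_two]; exact hf)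

theorem wdd_continuous {f : Cn n → ℂ} (hf : ContDiff ℝ 2 f) (c d : ℂ) (j k : Fin n) :
    Continuous (wd d k (wd c j f)) :=
  (contDiff_wd (m := 0) d k (by simpa using wdd_contDiff hf c j)).continuous

theorem opC_eq (A : AlphaForm n) (f : Cn n → ℂ) (z : Cn n) :
    alphaOp A f z = ∑ j, ∑ k, A.coeff j k z * wd I k (wd (-I) j f) z := by
  simp only [alphaOp, wdz_eq, wdzbar_eq]

theorem continuous_opC (A : AlphaForm n) {f : Cn n → ℂ} (hf : ContDiff ℝ 2 f) :
    Continuous (alphaOp A f) := by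
  have : alphaOp A f = fun z => ∑ j, ∑ k, A.coeff j k z * wd I k (wd (-I) j f) z := by
    funext z; exact opC_eq A f z
  rw [this]
  exact continuous_finsetSum _ fun j _ => continuous_finsetSum _ fun k _ =>
    (A.contDiff j k).continuous.mul (wdd_continuous hf _ _ _ _)

theorem continuous_opR (A : AlphaForm n) {f : Cn n → ℝ} (hf : ContDiff ℝ 2 f) :
    Continuous (alphaOpR A f) :=
  Complex.continuous_re.comp (continuous_opC A (contDiff_ofReal' hf))

theorem support_opC (A : AlphaForm n) (f : Cn n → ℂ) :
    Function.support (alphaOp A f) ⊆ tsupport f := by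
  intro z hz
  by_contra h
  apply hz
  rw [opC_eq]
  refine Finset.sum_eq_zero fun j _ => Finset.sum_eq_zero fun k _ => ?_
  have : z ∉ tsupport (wd I k (wd (-I) j f)) := fun h' =>
    h (tsupport_wd _ _ _ (tsupport_wd _ _ _ h'))
  rw [image_eq_zero_of_notMem_tsupport this, mul_zero]

theorem tsupport_ofReal (f : Cn n → ℝ) : tsupport (fun z => (f z : ℂ)) = tsupport f := by
  unfold tsupport
  congr 1
  ext z; simp

theorem support_opR (A : AlphaForm n) (f : Cn n → ℝ) :
    Function.support (alphaOpR A f) ⊆ tsupport f := by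
  intro z hz
  rw [← tsupport_ofReal]
  apply support_opC A
  intro h
  apply hz
  simp [alphaOpR, h]

theorem opR_eq_zero (A : AlphaForm n) (f : Cn n → ℝ) {z : Cn n} (hz : z ∉ tsupport f) :
    alphaOpR A f z = 0 := by
  by_contra h
  exact hz (support_opR A f h)

theorem hcs_opR (A : AlphaForm n) {f : Cn n → ℝ} (hf : HasCompactSupport f) :
    HasCompactSupport (alphaOpR A f) :=
  hf.mono' (support_opR A f)

theorem opC_add (A : AlphaForm n) {f g : Cn n → ℂ} (hf : ContDiff ℝ 2 f) (hg : ContDiff ℝ 2 g)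
    (z : Cn n) : alphaOp A (fun w => f w + g w) z = alphaOp A f z + alphaOp A g z := by
  simp only [opC_eq, ← Finset.sum_add_distrib]
  refine Finset.sum_congr rfl fun j _ => Finset.sum_congr rfl fun k _ => ?_
  have : wd (-I) j (fun w => f w + g w) = fun w => wd (-I) j f w + wd (-I) j g w := by
    funext w
    exact wd_add _ _ (hf.differentiable (by norm_num) w) (hg.differentiable (by norm_num) w)
  rw [this, wd_add _ _ ((wdd_contDiff hf _ _).differentiable (by norm_num) z)
    ((wdd_contDiff hg _ _).differentiable (by norm_num) z)]
  ring

theorem opC_const_mul (A : AlphaForm n) {f : Cn n → ℂ} (hf : ContDiff ℝ 2 f) (a : ℂ)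
    (z : Cn n) : alphaOp A (fun w => a * f w) z = a * alphaOp A f z := by
  simp only [opC_eq, Finset.mul_sum]
  refine Finset.sum_congr rfl fun j _ => Finset.sum_congr rfl fun k _ => ?_
  have : wd (-I) j (fun w => a * f w) = fun w => a * wd (-I) j f w := by
    funext w
    exact wd_const_mul _ _ _ (hf.differentiable (by norm_num) w)
  rw [this, wd_const_mul _ _ _ ((wdd_contDiff hf _ _).differentiable (by norm_num) z)]
  ring

theorem opR_add (A : AlphaForm n) {f g : Cn n → ℝ} (hf : ContDiff ℝ 2 f) (hg : ContDiff ℝ 2 g)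
    (z : Cn n) : alphaOpR A (fun w => f w + g w) z = alphaOpR A f z + alphaOpR A g z := by
  simp only [alphaOpR, Complex.ofReal_add]
  rw [opC_add A (contDiff_ofReal' hf) (contDiff_ofReal' hg)]
  simp

theorem opR_const_mul (A : AlphaForm n) {f : Cn n → ℝ} (hf : ContDiff ℝ 2 f) (a : ℝ)
    (z : Cn n) : alphaOpR A (fun w => a * f w) z = a * alphaOpR A f z := by
  simp only [alphaOpR, Complex.ofReal_mul]
  rw [opC_const_mul A (contDiff_ofReal' hf)]
  simp

theorem opR_sub (A : AlphaForm n) {f g : Cn n → ℝ} (hf : ContDiff ℝ 2 f) (hg : ContDiff ℝ 2 g)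
    (z : Cn n) : alphaOpR A (fun w => f w - g w) z = alphaOpR A f z - alphaOpR A g z := by
  have : (fun w => f w - g w) = fun w => f w + (-1) * g w := by funext w; ring
  rw [this, opR_add A hf (contDiff_const.mul hg), opR_const_mul A hg]; ring

theorem selfadjoint (A : AlphaForm n) {ψ φ : Cn n → ℝ} (hψ : ContDiff ℝ 2 ψ)
    (hφ : ContDiff ℝ 2 φ) (hc : HasCompactSupport φ) :
    ∫ z, ψ z * alphaOpR A φ z = ∫ z, φ z * alphaOpR A ψ z := by
  have hψ' := contDiff_ofReal' hψ
  have hφ' := contDiff_ofReal' hφ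
  have hcφ : HasCompactSupport (fun z => (φ z : ℂ)) := by
    unfold HasCompactSupport; rw [tsupport_ofReal]; exact hc
  have h := selfadjoint_c A hψ' hφ' hcφ
  have i1 : Integrable (fun z => (ψ z : ℂ) * alphaOp A (fun z => (φ z : ℂ)) z) volume :=
    integrable_mul_of_hcs hψ'.continuous (continuous_opC A hφ')
      (hcφ.mono' (support_opC A _))
  have i2 : Integrable (fun z => (φ z : ℂ) * alphaOp A (fun z => (ψ z : ℂ)) z) volume := by
    have := integrable_mul_of_hcs (continuous_opC A hψ') hφ'.continuous hcφ
    simpa only [mul_comm] using this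
  have r1 := Complex.reCLM.integral_comp_comm i1
  have r2 := Complex.reCLM.integral_comp_comm i2
  rw [h, ← r2] at r1
  simpa [alphaOpR, Complex.reCLM_apply] using r1

theorem opR_const (A : AlphaForm n) (a : ℝ) (z : Cn n) : alphaOpR A (fun _ => a) z = 0 := by
  have : ∀ (c : ℂ) (j : Fin n) (b : ℂ), wd c j (fun _ : Cn n => b) = fun _ => 0 := by
    intro c j b; funext z; simp [wd]
  simp [alphaOpR, opC_eq, this]

theorem integral_opR (A : AlphaForm n) {φ : Cn n → ℝ}
    (hφ : ContDiff ℝ 2 φ) (hc : HasCompactSupport φ) : ∫ z, alphaOpR A φ z = 0 := by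
  have := selfadjoint A (ψ := fun _ => 1) contDiff_const hφ hc
  simpa [opR_const] using this

/-! ### Quadratic forms -/

/-- quadratic form -/
noncomputable def qf (c : Fin n → Fin n → ℂ) (h : Cn n) : ℝ :=
  (∑ j, ∑ k, c k j * h j * starRingEnd ℂ (h k)).re

/-- first derivative of the quadratic form -/
noncomputable def Pf (c : Fin n → Fin n → ℂ) (h : Cn n) (j : Fin n) : ℂ :=
  ∑ k, c k j * starRingEnd ℂ (h k)

theorem qf_coe {c : Fin n → Fin n → ℂ} (hc : ∀ j k, starRingEnd ℂ (c j k) = c k j) (h : Cn n) :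
    (qf c h : ℂ) = ∑ j, ∑ k, c k j * h j * starRingEnd ℂ (h k) := by
  unfold qf
  rw [← Complex.conj_eq_iff_re]
  simp only [map_sum, map_mul, hc, Complex.conj_conj]
  rw [Finset.sum_comm]
  refine Finset.sum_congr rfl fun j _ => Finset.sum_congr rfl fun k _ => by ring

theorem wd_coord (a : ℂ) (x : Cn n) (l j : Fin n) (y : Cn n) :
    wd a l (fun y => (y - x) j) y = if l = j then (1 + a * I) / 2 else 0 := by
  have h : HasFDerivAt (fun y : Cn n => (y - x) j)
      (ContinuousLinearMap.proj (R := ℝ) j : Cn n →L[ℝ] ℂ) y := by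
    have := (ContinuousLinearMap.proj (R := ℝ) j : Cn n →L[ℝ] ℂ).hasFDerivAt (x := y)
    exact this.sub_const (x j)
  unfold wd
  rw [h.fderiv]
  by_cases hl : l = j
  · subst hl; simp
  · simp [hl]

theorem wd_coord_conj (a : ℂ) (x : Cn n) (l j : Fin n) (y : Cn n) :
    wd a l (fun y => starRingEnd ℂ ((y - x) j)) y = if l = j then (1 - a * I) / 2 else 0 := by
  have h : HasFDerivAt (fun y : Cn n => (y - x) j)
      (ContinuousLinearMap.proj (R := ℝ) j : Cn n →L[ℝ] ℂ) y := by
    have := (ContinuousLinearMap.proj (R := ℝ) j : Cn n →L[ℝ] ℂ).hasFDerivAt (x := y)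
    exact this.sub_const (x j)
  have := conj_wd (starRingEnd ℂ a) l h.differentiableAt
  rw [Complex.conj_conj] at this
  rw [this, wd_coord]
  split_ifs
  · have h2 : (starRingEnd ℂ) (2:ℂ) = 2 := Complex.conj_ofNat 2
    simp [h2]; ring
  · simp

theorem contDiff_coord {m : WithTop ℕ∞} (x : Cn n) (j : Fin n) :
    ContDiff ℝ m (fun y : Cn n => (y - x) j) := by
  have := (ContinuousLinearMap.proj (R := ℝ) j : Cn n →L[ℝ] ℂ).contDiff (n := m)
  exact this.sub contDiff_const

theorem contDiff_coord_conj {m : WithTop ℕ∞} (x : Cn n) (j : Fin n) :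
    ContDiff ℝ m (fun y : Cn n => starRingEnd ℂ ((y - x) j)) :=
  (Complex.conjCLE : ℂ →L[ℝ] ℂ).contDiff.comp (contDiff_coord x j)

theorem contDiff_qf {m : WithTop ℕ∞} (c : Fin n → Fin n → ℂ) (x : Cn n) :
    ContDiff ℝ m (fun y => qf c (y - x)) := by
  unfold qf
  refine Complex.reCLM.contDiff.comp ?_
  refine ContDiff.sum fun j _ => ContDiff.sum fun k _ => ?_
  exact (contDiff_const.mul (contDiff_coord x j)).mul (contDiff_coord_conj x k)

theorem contDiff_Pf {m : WithTop ℕ∞} (c : Fin n → Fin n → ℂ) (x : Cn n) (j : Fin n) :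
    ContDiff ℝ m (fun y => Pf c (y - x) j) := by
  unfold Pf
  refine ContDiff.sum fun k _ => ?_
  exact contDiff_const.mul (contDiff_coord_conj x k)

theorem wd_sum {ι : Type*} (s : Finset ι) (a : ℂ) (l : Fin n) (f : ι → Cn n → ℂ) (y : Cn n)
    (hf : ∀ i, DifferentiableAt ℝ (f i) y) :
    wd a l (fun y => ∑ i ∈ s, f i y) y = ∑ i ∈ s, wd a l (f i) y := by
  unfold wd
  rw [fderiv_fun_sum (fun i _ => hf i)]
  rw [← Finset.sum_div, Finset.sum_add_distrib]
  simp [Finset.mul_sum]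

theorem wd_Pf (c : Fin n → Fin n → ℂ) (x : Cn n) (j k : Fin n) (y : Cn n) :
    wd I k (fun y => Pf c (y - x) j) y = c k j := by
  unfold Pf
  have hd : ∀ l, DifferentiableAt ℝ (fun y : Cn n => starRingEnd ℂ ((y - x) l)) y := fun l =>
    (contDiff_coord_conj (m := 1) x l).differentiable (by norm_num) y
  rw [wd_sum _ _ _ _ _ (fun l => (hd l).const_mul _)]
  have : ∀ l, wd I k (fun y => c l j * starRingEnd ℂ ((y - x) l)) y =
      if k = l then c l j else 0 := by
    intro l
    rw [wd_const_mul _ _ _ (hd l), wd_coord_conj]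
    split_ifs <;> simp
  simp only [this]
  simp

theorem wd_qf {c : Fin n → Fin n → ℂ} (hc : ∀ j k, starRingEnd ℂ (c j k) = c k j)
    (x : Cn n) (l : Fin n) (y : Cn n) :
    wd (-I) l (fun y => (qf c (y - x) : ℂ)) y = Pf c (y - x) l ∧
    wd I l (fun y => (qf c (y - x) : ℂ)) y = starRingEnd ℂ (Pf c (y - x) l) := by
  have e : (fun y => (qf c (y - x) : ℂ)) = fun y => ∑ j, ∑ k, c k j * (y - x) j
      * starRingEnd ℂ ((y - x) k) := by
    funext y; exact qf_coe hc _
  have hd : ∀ l, DifferentiableAt ℝ (fun y : Cn n => starRingEnd ℂ ((y - x) l)) y := fun l =>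
    (contDiff_coord_conj (m := 1) x l).differentiable (by norm_num) y
  have hd' : ∀ l, DifferentiableAt ℝ (fun y : Cn n => ((y - x) l)) y := fun l =>
    (contDiff_coord (m := 1) x l).differentiable (by norm_num) y
  have main : wd (-I) l (fun y => (qf c (y - x) : ℂ)) y = Pf c (y - x) l := by
    rw [e, wd_sum _ _ _ (fun j (y : Cn n) => ∑ k, c k j * (y - x) j * starRingEnd ℂ ((y - x) k)) _
      (fun j => DifferentiableAt.fun_sum fun k _ => ((hd' j).const_mul _).mul (hd k))]
    have : ∀ j, wd (-I) l (fun y => ∑ k, c k j * (y - x) j * starRingEnd ℂ ((y - x) k)) y =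
        if l = j then ∑ k, c k j * starRingEnd ℂ ((y - x) k) else 0 := by
      intro j
      rw [wd_sum _ _ _ (fun k (y : Cn n) => c k j * (y - x) j * starRingEnd ℂ ((y - x) k)) _
        (fun k => ((hd' j).const_mul _).mul (hd k))]
      have h1 : ∀ k, wd (-I) l (fun y => c k j * (y - x) j * starRingEnd ℂ ((y - x) k)) y =
          if l = j then c k j * starRingEnd ℂ ((y - x) k) else 0 := by
        intro k
        rw [wd_mul _ _ ((hd' j).const_mul _) (hd k), wd_const_mul _ _ _ (hd' j), wd_coord,
          wd_coord_conj]
        split_ifs <;> simp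
      simp only [h1]
      split_ifs <;> simp
    simp only [this, Pf]
    simp
  refine ⟨main, ?_⟩
  rw [← main, ← conj_wd]
  · simp
  · exact ((contDiff_ofReal' (contDiff_qf (m := 1) c x)).differentiable (by norm_num)) y

theorem wd_comp (a : ℂ) (l : Fin n) {F : ℝ → ℝ} {F' : ℝ} {q : Cn n → ℝ} {y : Cn n}
    (hF : HasDerivAt F F' (q y)) (hq : DifferentiableAt ℝ q y) :
    wd a l (fun y => ((F (q y) : ℝ) : ℂ)) y = (F' : ℂ) * wd a l (fun y => (q y : ℂ)) y := by
  have h1 : HasFDerivAt (fun y => (q y : ℂ)) (Complex.ofRealCLM.comp (fderiv ℝ q y)) y :=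
    Complex.ofRealCLM.hasFDerivAt.comp y hq.hasFDerivAt
  have h2 : HasFDerivAt (fun y => ((F (q y) : ℝ) : ℂ))
      (Complex.ofRealCLM.comp (F' • fderiv ℝ q y)) y :=
    Complex.ofRealCLM.hasFDerivAt.comp y (hF.comp_hasFDerivAt y hq.hasFDerivAt)
  unfold wd
  rw [h1.fderiv, h2.fderiv]
  simp
  ring

theorem opR_comp_qf (A : AlphaForm n) {c : Fin n → Fin n → ℂ}
    (hc : ∀ j k, starRingEnd ℂ (c j k) = c k j) {F F1 F2 : ℝ → ℝ}
    (hF : ∀ t, HasDerivAt F (F1 t) t) (hF1 : ∀ t, HasDerivAt F1 (F2 t) t) (x y : Cn n) :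
    alphaOpR A (fun y => F (qf c (y - x))) y =
      F1 (qf c (y - x)) * (∑ j, ∑ k, A.coeff j k y * c k j).re +
      F2 (qf c (y - x)) * (∑ j, ∑ k, A.coeff j k y * Pf c (y - x) j *
        starRingEnd ℂ (Pf c (y - x) k)).re := by
  have hq : ∀ y, DifferentiableAt ℝ (fun y => qf c (y - x)) y := fun y =>
    (contDiff_qf (m := 1) c x).differentiable (by norm_num) y
  have e1 : ∀ j, wd (-I) j (fun y => ((F (qf c (y - x)) : ℝ) : ℂ)) =
      fun y => ((F1 (qf c (y - x)) : ℝ) : ℂ) * Pf c (y - x) j := by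
    intro j; funext y
    rw [wd_comp _ _ (q := fun y => qf c (y - x)) (hF _) (hq y), (wd_qf hc x j y).1]
  have hdF : DifferentiableAt ℝ (fun y => ((F1 (qf c (y - x)) : ℝ) : ℂ)) y :=
    (Complex.ofRealCLM.hasFDerivAt.comp y
      ((hF1 _).comp_hasFDerivAt y (hq y).hasFDerivAt)).differentiableAt
  have e2 : ∀ j k, wd I k (wd (-I) j (fun y => ((F (qf c (y - x)) : ℝ) : ℂ))) y =
      (F2 (qf c (y - x)) : ℂ) * (Pf c (y - x) j * starRingEnd ℂ (Pf c (y - x) k)) +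
      (F1 (qf c (y - x)) : ℂ) * c k j := by
    intro j k
    rw [e1, wd_mul _ _ hdF ((contDiff_Pf (m := 1) c x j).differentiable (by norm_num) y),
      wd_comp _ _ (q := fun y => qf c (y - x)) (hF1 _) (hq y), (wd_qf hc x k y).2, wd_Pf]
    ring
  have : alphaOp A (fun y => ((F (qf c (y - x)) : ℝ) : ℂ)) y =
      (F1 (qf c (y - x)) : ℂ) * (∑ j, ∑ k, A.coeff j k y * c k j) +
      (F2 (qf c (y - x)) : ℂ) * (∑ j, ∑ k, A.coeff j k y * Pf c (y - x) j *
        starRingEnd ℂ (Pf c (y - x) k)) := by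
    simp only [opC_eq, e2, Finset.mul_sum, ← Finset.sum_add_distrib]
    refine Finset.sum_congr rfl fun j _ => Finset.sum_congr rfl fun k _ => by ring
  unfold alphaOpR
  rw [this, Complex.add_re, Complex.re_ofReal_mul, Complex.re_ofReal_mul]

end AlphaAux

open MeasureTheory Filter Topology Complex Metric
open scoped ComplexOrder
namespace AlphaAux
variable {n : ℕ}

/-- coefficient matrix -/
noncomputable def Mm (A : AlphaForm n) (x : Cn n) : Matrix (Fin n) (Fin n) ℂ :=
  Matrix.of fun j k => A.coeff j k x

/-- inverse coefficient matrix -/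
noncomputable def Cm (A : AlphaForm n) (x : Cn n) : Fin n → Fin n → ℂ :=
  fun k j => (Mm A x)⁻¹ k j

theorem Mm_posDef (A : AlphaForm n) (x : Cn n) : (Mm A x).PosDef := by
  refine Matrix.PosDef.of_dotProduct_mulVec_pos ?_ ?_
  · ext j k
    simp only [Matrix.conjTranspose_apply, Mm, Matrix.of_apply]
    rw [A.hermitian j k x]; simp
  · intro ξ hξ
    have h := A.strictlyPositive x (fun i => starRingEnd ℂ (ξ i)) (by
      intro h; apply hξ; funext i
      have := congrFun h i
      simpa using this)
    have e : star ξ ⬝ᵥ (Mm A x).mulVec ξ = ∑ j, ∑ k, A.coeff j k x * starRingEnd ℂ (ξ j) *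
        starRingEnd ℂ (starRingEnd ℂ (ξ k)) := by
      simp only [dotProduct, Matrix.mulVec, Mm, Matrix.of_apply, Finset.mul_sum, Pi.star_apply,
        Complex.conj_conj]
      refine Finset.sum_congr rfl fun j _ => Finset.sum_congr rfl fun k _ => ?_
      simp only [RCLike.star_def]; ring
    rw [e]
    refine Complex.lt_def.2 ⟨by simpa using h, ?_⟩
    rw [eq_comm, Complex.zero_im, ← Complex.conj_eq_iff_im]
    simp only [map_sum, map_mul, ← A.hermitian, Complex.conj_conj]
    rw [Finset.sum_comm]
    refine Finset.sum_congr rfl fun j _ => Finset.sum_congr rfl fun k _ => by ring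

theorem Mm_det (A : AlphaForm n) (x : Cn n) : (Mm A x).det ≠ 0 := by
  have := (Mm_posDef A x).det_pos
  exact this.ne'

theorem Cm_herm (A : AlphaForm n) (x : Cn n) (j k : Fin n) :
    starRingEnd ℂ (Cm A x j k) = Cm A x k j := by
  have h := (Mm_posDef A x).inv.1
  have := congrFun (congrFun h k) j
  simpa [Cm, Matrix.conjTranspose_apply] using this

theorem Cm_sum (A : AlphaForm n) (x : Cn n) (j k : Fin n) :
    ∑ l, Cm A x j l * A.coeff l k x = if j = k then 1 else 0 := by
  have h := Matrix.nonsing_inv_mul (Mm A x) (isUnit_iff_ne_zero.2 (Mm_det A x))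
  have := congrFun (congrFun h j) k
  simpa [Matrix.mul_apply, Cm, Mm, Matrix.one_apply] using this

theorem continuous_Cm (A : AlphaForm n) (j k : Fin n) : Continuous fun x => Cm A x j k := by
  have hM : Continuous (Mm A) := by
    refine continuous_matrix fun j k => ?_
    exact (A.contDiff j k).continuous
  have : (fun x => Cm A x j k) = fun x => ((Mm A x).det)⁻¹ * (Mm A x).adjugate j k := by
    funext x
    simp [Cm, Matrix.inv_def, Ring.inverse_eq_inv']
  rw [this]
  refine (hM.matrix_det.inv₀ (Mm_det A)).mul ?_
  exact (hM.matrix_adjugate).matrix_elem j k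

/-- the quadratic form centred at `x` -/
noncomputable def qq (A : AlphaForm n) (x y : Cn n) : ℝ := qf (Cm A x) (y - x)

/-- the trace term -/
noncomputable def TT (A : AlphaForm n) (x y : Cn n) : ℝ :=
  (∑ j, ∑ k, A.coeff j k y * Cm A x k j).re

/-- the gradient term -/
noncomputable def EE (A : AlphaForm n) (x y : Cn n) : ℝ :=
  (∑ j, ∑ k, A.coeff j k y * Pf (Cm A x) (y - x) j * starRingEnd ℂ (Pf (Cm A x) (y - x) k)).re

theorem opR_comp_qq (A : AlphaForm n) {F F1 F2 : ℝ → ℝ}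
    (hF : ∀ t, HasDerivAt F (F1 t) t) (hF1 : ∀ t, HasDerivAt F1 (F2 t) t) (x y : Cn n) :
    alphaOpR A (fun y => F (qq A x y)) y = F1 (qq A x y) * TT A x y + F2 (qq A x y) * EE A x y :=
  opR_comp_qf A (Cm_herm A x) hF hF1 x y

theorem qf_pos (A : AlphaForm n) (x h : Cn n) (hh : h ≠ 0) : 0 < qf (Cm A x) h := by
  have h1 := (Mm_posDef A x).inv.dotProduct_mulVec_pos hh
  have e : star h ⬝ᵥ ((Mm A x)⁻¹).mulVec h = ∑ j, ∑ k, Cm A x k j * h j * starRingEnd ℂ (h k) := by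
    simp only [dotProduct, Matrix.mulVec, Finset.mul_sum, Pi.star_apply, Cm]
    rw [Finset.sum_comm]
    refine Finset.sum_congr rfl fun j _ => Finset.sum_congr rfl fun k _ => ?_
    simp only [RCLike.star_def]; ring
  rw [e] at h1
  exact (Complex.lt_def.1 h1).1

theorem qf_zero (c : Fin n → Fin n → ℂ) : qf c 0 = 0 := by simp [qf]

theorem qq_self (A : AlphaForm n) (x : Cn n) : qq A x x = 0 := by simp [qq, qf_zero]

theorem qq_pos (A : AlphaForm n) {x y : Cn n} (h : y ≠ x) : 0 < qq A x y :=
  qf_pos A x _ (sub_ne_zero.2 h)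

theorem qq_nonneg (A : AlphaForm n) (x y : Cn n) : 0 ≤ qq A x y := by
  by_cases h : y = x
  · rw [h, qq_self]
  · exact (qq_pos A h).le

theorem EE_nonneg (A : AlphaForm n) (x y : Cn n) : 0 ≤ EE A x y := by
  unfold EE
  by_cases h : Pf (Cm A x) (y - x) = 0
  · simp [h]
  · exact (A.strictlyPositive y _ h).le

theorem continuous_qf_pair (A : AlphaForm n) :
    Continuous fun p : Cn n × Cn n => qf (Cm A p.1) p.2 := by
  have := fun j k => continuous_Cm A j k
  unfold qf
  refine Complex.continuous_re.comp ?_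
  refine continuous_finsetSum _ fun j _ => continuous_finsetSum _ fun k _ => ?_
  refine (((this k j).comp continuous_fst).mul ?_).mul (Complex.continuous_conj.comp ?_)
  · exact (continuous_apply j).comp continuous_snd
  · exact (continuous_apply k).comp continuous_snd

theorem continuous_qq (A : AlphaForm n) : Continuous fun p : Cn n × Cn n => qq A p.1 p.2 := by
  have h2 : Continuous fun p : Cn n × Cn n => (p.1, p.2 - p.1) :=
    continuous_fst.prodMk (continuous_snd.sub continuous_fst)
  have h3 := (continuous_qf_pair A).comp h2
  unfold qq
  exact h3

theorem continuous_TT (A : AlphaForm n) : Continuous fun p : Cn n × Cn n => TT A p.1 p.2 := by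
  unfold TT
  refine Complex.continuous_re.comp ?_
  refine continuous_finsetSum _ fun j _ => continuous_finsetSum _ fun k _ => ?_
  have h1 : Continuous fun p : Cn n × Cn n => A.coeff j k p.2 :=
    (A.contDiff j k).continuous.comp continuous_snd
  have h2 : Continuous fun p : Cn n × Cn n => Cm A p.1 k j :=
    (continuous_Cm A k j).comp continuous_fst
  exact h1.mul h2

theorem continuous_EE (A : AlphaForm n) : Continuous fun p : Cn n × Cn n => EE A p.1 p.2 := by
  have hP : ∀ j, Continuous fun p : Cn n × Cn n => Pf (Cm A p.1) (p.2 - p.1) j := by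
    intro j
    unfold Pf
    refine continuous_finsetSum _ fun k _ => ?_
    refine ((continuous_Cm A k j).comp continuous_fst).mul (Complex.continuous_conj.comp ?_)
    exact (continuous_apply k).comp (continuous_snd.sub continuous_fst)
  unfold EE
  refine Complex.continuous_re.comp ?_
  refine continuous_finsetSum _ fun j _ => continuous_finsetSum _ fun k _ => ?_
  exact (((A.contDiff j k).continuous.comp continuous_snd).mul (hP j)).mul
    (Complex.continuous_conj.comp (hP k))

theorem contDiff_qq {m : WithTop ℕ∞} (A : AlphaForm n) (x : Cn n) : ContDiff ℝ m (qq A x) :=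
  contDiff_qf _ x

theorem qf_smul (c : Fin n → Fin n → ℂ) (a : ℝ) (h : Cn n) : qf c (a • h) = a ^ 2 * qf c h := by
  unfold qf
  rw [← Complex.re_ofReal_mul]
  congr 1
  simp only [Finset.mul_sum]
  refine Finset.sum_congr rfl fun j _ => Finset.sum_congr rfl fun k _ => ?_
  simp; ring

theorem TT_self (A : AlphaForm n) (x : Cn n) : TT A x x = n := by
  unfold TT
  rw [Finset.sum_comm]
  have : ∀ k, ∑ j, A.coeff j k x * Cm A x k j = 1 := by
    intro k
    have := Cm_sum A x k k
    simpa [mul_comm] using this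
  simp [this]

theorem EE_frozen (A : AlphaForm n) (x h : Cn n) :
    (∑ j, ∑ k, A.coeff j k x * Pf (Cm A x) h j * starRingEnd ℂ (Pf (Cm A x) h k)).re =
      qf (Cm A x) h := by
  have h1 : ∀ k, ∑ j, A.coeff j k x * Pf (Cm A x) h j = starRingEnd ℂ (h k) := by
    intro k
    unfold Pf
    simp only [Finset.mul_sum]
    rw [Finset.sum_comm]
    have : ∀ l, ∑ j, A.coeff j k x * (Cm A x l j * starRingEnd ℂ (h l)) =
        if l = k then starRingEnd ℂ (h l) else 0 := by
      intro l
      have := Cm_sum A x l k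
      have e : ∑ j, A.coeff j k x * (Cm A x l j * starRingEnd ℂ (h l)) =
          (∑ j, Cm A x l j * A.coeff j k x) * starRingEnd ℂ (h l) := by
        rw [Finset.sum_mul]; refine Finset.sum_congr rfl fun j _ => by ring
      rw [e, this]; split_ifs <;> simp
    simp only [this]; simp
  rw [Finset.sum_comm]
  simp only [← Finset.sum_mul, h1]
  unfold Pf qf
  rw [← Complex.conj_re]
  congr 1
  simp only [map_sum, map_mul, Complex.conj_conj, Finset.mul_sum]
  refine Finset.sum_congr rfl fun j _ => Finset.sum_congr rfl fun k _ => ?_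
  ring

/-- uniform geometric bounds on a set of points. -/
structure Geo (A : AlphaForm n) (B : Set (Cn n)) (Γ : ℝ) : Prop where
  one_le : 1 ≤ Γ
  lower : ∀ x ∈ B, ∀ y, ‖y - x‖ ^ 2 ≤ Γ * qq A x y
  upper : ∀ x ∈ B, ∀ y, qq A x y ≤ Γ * ‖y - x‖ ^ 2
  trace : ∀ x ∈ B, ∀ y ∈ B, |TT A x y - n| ≤ Γ * √(qq A x y)
  grad : ∀ x ∈ B, ∀ y ∈ B, |EE A x y - qq A x y| ≤ Γ * qq A x y * √(qq A x y)

theorem norm_sum2_le (f : Fin n → Fin n → ℂ) (b : ℝ) (hf : ∀ j k, ‖f j k‖ ≤ b) :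
    ‖∑ j, ∑ k, f j k‖ ≤ n ^ 2 * b := by
  refine (norm_sum_le _ _).trans ?_
  have : ∀ j ∈ Finset.univ, ‖∑ k, f j k‖ ≤ n * b := by
    intro j _
    refine (norm_sum_le _ _).trans ?_
    refine (Finset.sum_le_sum fun k _ => hf j k).trans ?_
    simp
  refine (Finset.sum_le_sum this).trans ?_
  simp; nlinarith

theorem exists_geo (A : AlphaForm n) (z : Cn n) (r : ℝ) : ∃ Γ, Geo A (closedBall z r) Γ := by
  set B := closedBall z r
  have hBc : IsCompact B := isCompact_closedBall z r
  -- lower bound on sphere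
  obtain ⟨m, hm0, hm⟩ : ∃ m, 0 < m ∧ ∀ p ∈ B ×ˢ sphere (0 : Cn n) 1, m ≤ qf (Cm A p.1) p.2 := by
    refine (hBc.prod (isCompact_sphere (0 : Cn n) 1)).exists_forall_le'
      (continuous_qf_pair A).continuousOn ?_
    rintro ⟨x, h⟩ ⟨_, hh⟩
    refine qf_pos A x h ?_
    rintro rfl
    simp at hh
  have lower : ∀ x ∈ B, ∀ h, m * ‖h‖ ^ 2 ≤ qf (Cm A x) h := by
    intro x hx h
    by_cases h0 : h = 0
    · simp [h0, qf_zero]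
    · have hn : 0 < ‖h‖ := norm_pos_iff.2 h0
      have := hm (x, ‖h‖⁻¹ • h) ⟨hx, by simp [norm_smul, hn.ne']⟩
      simp only [qf_smul] at this
      have h2 : (‖h‖⁻¹) ^ 2 * qf (Cm A x) h * ‖h‖ ^ 2 = qf (Cm A x) h := by
        field_simp
      nlinarith [mul_le_mul_of_nonneg_right this (sq_nonneg ‖h‖)]
  -- bound on C
  obtain ⟨b, hb⟩ : ∃ b, ∀ x ∈ B, ∀ j k, ‖Cm A x j k‖ ≤ b := by
    have h1 : Continuous fun x => (fun p : Fin n × Fin n => Cm A x p.1 p.2) :=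
      continuous_pi fun p => continuous_Cm A p.1 p.2
    obtain ⟨b, hb⟩ := hBc.exists_bound_of_continuousOn h1.continuousOn
    exact ⟨b, fun x hx j k => (norm_le_pi_norm (fun p : Fin n × Fin n => Cm A x p.1 p.2)
      (j, k)).trans (hb x hx)⟩
  -- Lipschitz bound on A
  obtain ⟨L, hL⟩ : ∃ L : ℝ, ∀ x ∈ B, ∀ y ∈ B, ∀ j k, ‖A.coeff j k y - A.coeff j k x‖ ≤
      L * ‖y - x‖ := by
    have h1 : ContDiff ℝ 1 fun x => (fun p : Fin n × Fin n => A.coeff p.1 p.2 x) :=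
      contDiff_pi.2 fun p => A.contDiff p.1 p.2
    obtain ⟨K, hK⟩ := h1.contDiffOn.exists_lipschitzOnWith (by norm_num)
      (convex_closedBall z r) hBc
    refine ⟨K, fun x hx y hy j k => ?_⟩
    have := hK.norm_sub_le hy hx
    exact (norm_le_pi_norm ((fun p : Fin n × Fin n => A.coeff p.1 p.2 y) -
      (fun p : Fin n × Fin n => A.coeff p.1 p.2 x)) (j, k)).trans this
  set b' := max b 0
  set L' := max L 0
  have hb'0 : 0 ≤ b' := le_max_right _ _
  have hL'0 : 0 ≤ L' := le_max_right _ _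
  have hb' : ∀ x ∈ B, ∀ j k, ‖Cm A x j k‖ ≤ b' := fun x hx j k => (hb x hx j k).trans (le_max_left _ _)
  have hL' : ∀ x ∈ B, ∀ y ∈ B, ∀ j k, ‖A.coeff j k y - A.coeff j k x‖ ≤ L' * ‖y - x‖ :=
    fun x hx y hy j k => (hL x hx y hy j k).trans
      (mul_le_mul_of_nonneg_right (le_max_left _ _) (norm_nonneg _))
  have hP : ∀ x ∈ B, ∀ h : Cn n, ∀ j, ‖Pf (Cm A x) h j‖ ≤ n * b' * ‖h‖ := by
    intro x hx h j
    unfold Pf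
    refine (norm_sum_le _ _).trans ?_
    have : ∀ k ∈ Finset.univ, ‖Cm A x k j * starRingEnd ℂ (h k)‖ ≤ b' * ‖h‖ := by
      intro k _
      rw [norm_mul, RCLike.norm_conj]
      exact mul_le_mul (hb' x hx k j) (norm_le_pi_norm h k) (norm_nonneg _) hb'0
    refine (Finset.sum_le_sum this).trans ?_
    simp; nlinarith
  set s := √m⁻¹ with hs
  have hs0 : 0 ≤ s := Real.sqrt_nonneg _
  have hnorm : ∀ x ∈ B, ∀ y, ‖y - x‖ ≤ s * √(qq A x y) := by
    intro x hx y
    rw [hs, ← Real.sqrt_mul (by positivity)]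
    refine Real.le_sqrt_of_sq_le ?_
    have := lower x hx (y - x)
    rw [inv_mul_eq_div, le_div_iff₀ hm0, mul_comm]; exact this
  refine ⟨1 + m⁻¹ + n ^ 2 * b' + n ^ 2 * (L' * b') * s +
    n ^ 2 * (L' * (n * b') ^ 2) * s ^ 3, ?_, ?_, ?_, ?_, ?_⟩
  · have : 0 ≤ m⁻¹ := by positivity
    have : 0 ≤ n ^ 2 * b' + n ^ 2 * (L' * b') * s + n ^ 2 * (L' * (n * b') ^ 2) * s ^ 3 := by
      positivity
    linarith
  · intro x hx y
    have h1 := lower x hx (y - x)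
    have h2 : ‖y - x‖ ^ 2 ≤ m⁻¹ * qq A x y := by
      rw [inv_mul_eq_div, le_div_iff₀ hm0, mul_comm]; exact h1
    refine h2.trans (mul_le_mul_of_nonneg_right ?_ (qq_nonneg A x y))
    have : 0 ≤ n ^ 2 * b' + n ^ 2 * (L' * b') * s + n ^ 2 * (L' * (n * b') ^ 2) * s ^ 3 := by
      positivity
    linarith
  · intro x hx y
    have h2 : qq A x y ≤ n ^ 2 * b' * ‖y - x‖ ^ 2 := by
      unfold qq qf
      refine (Complex.re_le_norm _).trans ?_
      rw [mul_assoc]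
      refine norm_sum2_le _ _ fun j k => ?_
      rw [norm_mul, norm_mul, RCLike.norm_conj, sq, ← mul_assoc]
      exact mul_le_mul (mul_le_mul (hb' x hx k j) (norm_le_pi_norm _ j) (norm_nonneg _) hb'0)
        (norm_le_pi_norm _ k) (norm_nonneg _) (by positivity)
    refine h2.trans (mul_le_mul_of_nonneg_right ?_ (sq_nonneg _))
    have : 0 ≤ m⁻¹ + n ^ 2 * (L' * b') * s + n ^ 2 * (L' * (n * b') ^ 2) * s ^ 3 := by
      positivity
    linarith
  · intro x hx y hy
    have h2 : |TT A x y - TT A x x| ≤ n ^ 2 * (L' * b') * ‖y - x‖ := by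
      unfold TT
      rw [← Complex.sub_re, ← Finset.sum_sub_distrib]
      simp only [← Finset.sum_sub_distrib, ← sub_mul]
      refine (Complex.abs_re_le_norm _).trans ?_
      rw [mul_assoc]
      refine norm_sum2_le _ _ fun j k => ?_
      rw [norm_mul]
      refine (mul_le_mul (hL' x hx y hy j k) (hb' x hx k j) (norm_nonneg _)
        (by positivity)).trans (le_of_eq (by ring))
    rw [TT_self] at h2
    refine h2.trans ?_
    refine (mul_le_mul_of_nonneg_left (hnorm x hx y) (by positivity)).trans ?_
    rw [← mul_assoc]
    refine mul_le_mul_of_nonneg_right ?_ (Real.sqrt_nonneg _)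
    have : 0 ≤ m⁻¹ := by positivity
    have : 0 ≤ n ^ 2 * b' + n ^ 2 * (L' * (n * b') ^ 2) * s ^ 3 := by
      positivity
    linarith
  · intro x hx y hy
    have h2 : |EE A x y - qq A x y| ≤ n ^ 2 * (L' * (n * b') ^ 2) * ‖y - x‖ ^ 3 := by
      have e := EE_frozen A x (y - x)
      unfold EE qq
      rw [← e, ← Complex.sub_re, ← Finset.sum_sub_distrib]
      simp only [← Finset.sum_sub_distrib, ← sub_mul]
      refine (Complex.abs_re_le_norm _).trans ?_
      rw [mul_assoc]
      refine norm_sum2_le _ _ fun j k => ?_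
      rw [norm_mul, norm_mul, RCLike.norm_conj]
      refine (mul_le_mul (mul_le_mul (hL' x hx y hy j k) (hP x hx _ j) (norm_nonneg _)
        (by positivity)) (hP x hx _ k) (norm_nonneg _)
        (by positivity)).trans (le_of_eq (by ring))
    refine h2.trans ?_
    have h3 : ‖y - x‖ ^ 3 ≤ s ^ 3 * (qq A x y * √(qq A x y)) := by
      have := pow_le_pow_left₀ (norm_nonneg _) (hnorm x hx y) 3
      refine this.trans (le_of_eq ?_)
      have h4 := Real.sq_sqrt (qq_nonneg A x y)
      calc (s * √(qq A x y)) ^ 3 = s ^ 3 * ((√(qq A x y)) ^ 2 * √(qq A x y)) := by ring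
        _ = _ := by rw [h4]
    refine (mul_le_mul_of_nonneg_left h3 (by positivity)).trans ?_
    rw [← mul_assoc, mul_assoc _ (qq A x y)]
    refine mul_le_mul_of_nonneg_right ?_ (mul_nonneg (qq_nonneg _ _ _) (Real.sqrt_nonneg _))
    have : 0 ≤ m⁻¹ := by positivity
    have : 0 ≤ n ^ 2 * b' + n ^ 2 * (L' * b') * s := by
      positivity
    linarith

attribute [irreducible] qq TT EE Cm

end AlphaAux

open scoped ComplexOrder
namespace AlphaAux

/-! ### One-dimensional profiles -/

/-- decreasing cutoff: 1 for `t ≤ T/2`, 0 for `t ≥ T`. -/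
noncomputable def chi (T t : ℝ) : ℝ := Real.smoothTransition (2 - 2 * t / T)

/-- increasing cutoff: 0 for `s ≤ 1`, 1 for `s ≥ 2`. -/
noncomputable def eta (s : ℝ) : ℝ := Real.smoothTransition (s - 1)

theorem eta_contDiff {m : ℕ∞} : ContDiff ℝ m eta :=
  Real.smoothTransition.contDiff.comp (contDiff_id.sub contDiff_const)
theorem eta_nonneg (s : ℝ) : 0 ≤ eta s := Real.smoothTransition.nonneg _
theorem eta_le_one (s : ℝ) : eta s ≤ 1 := Real.smoothTransition.le_one _
theorem eta_zero {s : ℝ} (h : s ≤ 1) : eta s = 0 :=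
  Real.smoothTransition.zero_of_nonpos (by linarith)
theorem eta_one {s : ℝ} (h : 2 ≤ s) : eta s = 1 :=
  Real.smoothTransition.one_of_one_le (by linarith)
theorem eta_mono : Monotone eta := fun a b h => Real.smoothTransition.monotone (by linarith)
theorem eta_diff (s : ℝ) : HasDerivAt eta (deriv eta s) s :=
  ((eta_contDiff (m := 1)).differentiable (by norm_num) s).hasDerivAt
theorem eta_deriv_nonneg (s : ℝ) : 0 ≤ deriv eta s := eta_mono.deriv_nonneg
theorem eta_deriv_cont : Continuous (deriv eta) :=
  (eta_contDiff (m := 1)).continuous_deriv (by norm_num)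
theorem eta_deriv_zero {s : ℝ} (h : s ≤ 1 ∨ 2 ≤ s) : deriv eta s = 0 := by
  rcases h with h | h
  · refine IsLocalMin.deriv_eq_zero ?_
    exact Filter.Eventually.of_forall fun t => by rw [eta_zero h]; exact eta_nonneg t
  · refine IsLocalMax.deriv_eq_zero ?_
    exact Filter.Eventually.of_forall fun t => by rw [eta_one h]; exact eta_le_one t
theorem eta_deriv_bdd : ∃ C, 0 < C ∧ ∀ s, deriv eta s ≤ C := by
  obtain ⟨C, hC⟩ := (isCompact_Icc (a := (1:ℝ)) (b := 2)).exists_bound_of_continuousOn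
    eta_deriv_cont.continuousOn
  refine ⟨max C 1, by positivity, fun s => ?_⟩
  by_cases h : s ∈ Set.Icc (1:ℝ) 2
  · exact (le_abs_self _).trans ((hC s h).trans (le_max_left _ _))
  · rw [eta_deriv_zero]
    · positivity
    · simp only [Set.mem_Icc, not_and_or, not_le] at h
      rcases h with h | h
      · exact Or.inl h.le
      · exact Or.inr h.le

section
variable {T : ℝ}

theorem chi_contDiff {m : ℕ∞} : ContDiff ℝ m (chi T) := by
  unfold chi
  refine Real.smoothTransition.contDiff.comp ?_
  exact contDiff_const.sub ((contDiff_const.mul contDiff_id).div_const _)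
theorem chi_nonneg (t : ℝ) : 0 ≤ chi T t := Real.smoothTransition.nonneg _
theorem chi_le_one (t : ℝ) : chi T t ≤ 1 := Real.smoothTransition.le_one _
theorem chi_one (hT : 0 < T) {t : ℝ} (h : t ≤ T / 2) : chi T t = 1 := by
  refine Real.smoothTransition.one_of_one_le ?_
  have : 2 * t / T ≤ 1 := by rw [div_le_one hT]; linarith
  linarith
theorem chi_zero (hT : 0 < T) {t : ℝ} (h : T ≤ t) : chi T t = 0 := by
  refine Real.smoothTransition.zero_of_nonpos ?_
  have : 2 ≤ 2 * t / T := by rw [le_div_iff₀ hT]; linarith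
  linarith
theorem chi_anti (hT : 0 < T) : Antitone (chi T) := fun a b h => by
  refine Real.smoothTransition.monotone ?_
  have : 2 * a / T ≤ 2 * b / T := by gcongr
  linarith
theorem chi_diff (t : ℝ) : HasDerivAt (chi T) (deriv (chi T) t) t :=
  ((chi_contDiff (m := 1)).differentiable (by norm_num) t).hasDerivAt
theorem chi_deriv_nonpos (hT : 0 < T) (t : ℝ) : deriv (chi T) t ≤ 0 := (chi_anti hT).deriv_nonpos
theorem chi_deriv_cont : Continuous (deriv (chi T)) :=
  (chi_contDiff (m := 1)).continuous_deriv (by norm_num)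
theorem chi_deriv_zero (hT : 0 < T) {t : ℝ} (h : t ≤ T / 2 ∨ T ≤ t) : deriv (chi T) t = 0 := by
  rcases h with h | h
  · refine IsLocalMax.deriv_eq_zero ?_
    exact Filter.Eventually.of_forall fun t => by rw [chi_one hT h]; exact chi_le_one t
  · refine IsLocalMin.deriv_eq_zero ?_
    exact Filter.Eventually.of_forall fun t => by rw [chi_zero hT h]; exact chi_nonneg t
theorem chi_deriv_bdd (hT : 0 < T) : ∃ C, 0 < C ∧ ∀ s, |deriv (chi T) s| ≤ C := by
  obtain ⟨C, hC⟩ := (isCompact_Icc (a := T/2) (b := T)).exists_bound_of_continuousOn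
    (chi_deriv_cont (T := T)).continuousOn
  refine ⟨max C 1, by positivity, fun s => ?_⟩
  by_cases h : s ∈ Set.Icc (T/2) T
  · exact (hC s h).trans (le_max_left _ _)
  · rw [chi_deriv_zero hT]
    · simp
    · simp only [Set.mem_Icc, not_and_or, not_le] at h
      rcases h with h | h
      · exact Or.inl h.le
      · exact Or.inr h.le
end

/-- the profile -/
noncomputable def phi (n : ℕ) (lam T t : ℝ) : ℝ := Real.exp (-lam * √t) * chi T t / t ^ n

/-- numerator of the derivative of the profile: `t Q'(t)` -/
noncomputable def dq (lam T t : ℝ) : ℝ :=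
  Real.exp (-lam * √t) * (t * deriv (chi T) t - lam * √t * chi T t / 2)

/-- derivative of the profile -/
noncomputable def phid (n : ℕ) (lam T t : ℝ) : ℝ :=
  (dq lam T t - n * (Real.exp (-lam * √t) * chi T t)) / (t ^ n * t)

theorem phi_nonneg (n : ℕ) (lam T : ℝ) {t : ℝ} (ht : 0 ≤ t) : 0 ≤ phi n lam T t := by
  unfold phi; have := chi_nonneg (T := T) t; positivity

theorem phi_zero (n : ℕ) (lam : ℝ) {T t : ℝ} (hT : 0 < T) (h : T ≤ t) : phi n lam T t = 0 := by
  unfold phi; rw [chi_zero hT h]; simp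

theorem phid_zero (n : ℕ) (lam : ℝ) {T t : ℝ} (hT : 0 < T) (h : T ≤ t) : phid n lam T t = 0 := by
  unfold phid dq; rw [chi_zero hT h, chi_deriv_zero hT (Or.inr h)]; simp

theorem phi_hasDerivAt (n : ℕ) (lam T : ℝ) {t : ℝ} (ht : 0 < t) :
    HasDerivAt (phi n lam T) (phid n lam T t) t := by
  have h1 : HasDerivAt (fun t => Real.exp (-lam * √t))
      (Real.exp (-lam * √t) * (-lam * (1 / (2 * √t)))) t :=
    ((Real.hasDerivAt_sqrt ht.ne').const_mul (-lam)).exp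
  have h2 := (h1.mul (chi_diff (T := T) t)).div (hasDerivAt_pow n t) (pow_ne_zero n ht.ne')
  refine h2.congr_deriv ?_
  have hs : 0 < √t := Real.sqrt_pos.2 ht
  have e : √t * √t = t := Real.mul_self_sqrt ht.le
  simp only [phid, dq, Pi.mul_apply]
  have e2 : (1 : ℝ) / (2 * √t) = √t / (2 * t) := by
    rw [div_eq_div_iff (by positivity) (by positivity)]; nlinarith
  rw [e2]
  rcases n with _ | n
  · field_simp
    simp; ring
  · field_simp
    push_cast
    ring_nf

theorem phi_contDiffAt (n : ℕ) (lam T : ℝ) {t : ℝ} (ht : 0 < t) {m : ℕ∞} :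
    ContDiffAt ℝ m (phi n lam T) t := by
  unfold phi
  refine ContDiffAt.div ?_ (contDiffAt_id.pow n) (pow_ne_zero n ht.ne')
  refine ContDiffAt.mul ?_ chi_contDiff.contDiffAt
  exact (contDiffAt_const.mul (Real.contDiffAt_sqrt ht.ne')).exp

theorem phid_continuousOn (n : ℕ) (lam T : ℝ) : ContinuousOn (phid n lam T) (Set.Ioi 0) := by
  unfold phid dq
  have h1 : Continuous (chi T) := (chi_contDiff (m := 1)).continuous
  have h2 := chi_deriv_cont (T := T)
  refine ContinuousOn.div (by fun_prop) (by fun_prop) ?_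
  intro t ht
  have : (0:ℝ) < t := ht
  positivity

theorem phi_continuousOn (n : ℕ) (lam T : ℝ) : ContinuousOn (phi n lam T) (Set.Ioi 0) :=
  fun _ ht => (phi_hasDerivAt n lam T ht).continuousAt.continuousWithinAt

/-- the truncated profile -/
noncomputable def phe (n : ℕ) (lam T ε t : ℝ) : ℝ := eta (t / ε) * phi n lam T t

section
variable (n : ℕ) (lam : ℝ) {T ε : ℝ}

theorem phe_eventually_zero (hε : 0 < ε) {t : ℝ} (ht : t < ε) :
    phe n lam T ε =ᶠ[𝓝 t] fun _ => 0 := by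
  filter_upwards [Iio_mem_nhds ht] with s hs
  have : s / ε ≤ 1 := by rw [div_le_one hε]; exact le_of_lt hs
  simp [phe, eta_zero this]

theorem phe_contDiff (hε : 0 < ε) {m : ℕ∞} : ContDiff ℝ m (phe n lam T ε) := by
  rw [contDiff_iff_contDiffAt]
  intro t
  by_cases ht : 0 < t
  · exact (eta_contDiff.contDiffAt.comp t (contDiffAt_id.div_const ε)).mul
      (phi_contDiffAt n lam T ht)
  · exact contDiffAt_const.congr_of_eventuallyEq (phe_eventually_zero n lam hε (by linarith))

theorem phe_hasDerivAt (hε : 0 < ε) (t : ℝ) : HasDerivAt (phe n lam T ε)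
    (eta (t / ε) * phid n lam T t + 1 / ε * deriv eta (t / ε) * phi n lam T t) t := by
  by_cases ht : 0 < t
  · have h1 : HasDerivAt (fun t => eta (t / ε)) (deriv eta (t / ε) * (1 / ε)) t :=
      HasDerivAt.comp (h₂ := eta) t (eta_diff (t / ε)) ((hasDerivAt_id t).div_const ε)
    refine (h1.mul (phi_hasDerivAt n lam T ht)).congr_deriv ?_
    ring
  · have hle : t / ε ≤ 1 := by rw [div_le_one hε]; linarith
    rw [eta_zero hle, eta_deriv_zero (Or.inl hle)]
    simp only [zero_mul, mul_zero, add_zero]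
    exact (hasDerivAt_const t (0:ℝ)).congr_of_eventuallyEq
      (phe_eventually_zero n lam hε (by linarith))

theorem phe_continuous (hε : 0 < ε) : Continuous (phe n lam T ε) :=
  (phe_contDiff n lam hε (m := 1)).continuous

theorem phe_nonneg (hε : 0 < ε) (t : ℝ) : 0 ≤ phe n lam T ε t := by
  by_cases ht : 0 ≤ t
  · exact mul_nonneg (eta_nonneg _) (phi_nonneg n lam T ht)
  · have hle : t / ε ≤ 1 := by rw [div_le_one hε]; linarith
    simp [phe, eta_zero hle]

theorem phe_zero (hT : 0 < T) {t : ℝ} (h : T ≤ t) : phe n lam T ε t = 0 := by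
  simp [phe, phi_zero n lam hT h]

theorem phe_anti {ε' : ℝ} (hε' : 0 < ε') (h : ε' ≤ ε) (t : ℝ) :
    phe n lam T ε t ≤ phe n lam T ε' t := by
  by_cases ht : 0 ≤ t
  · refine mul_le_mul_of_nonneg_right (eta_mono ?_) (phi_nonneg n lam T ht)
    gcongr
  · have hle : t / ε ≤ 1 := by rw [div_le_one (by linarith)]; linarith
    have hle' : t / ε' ≤ 1 := by rw [div_le_one (by linarith)]; linarith
    simp [phe, eta_zero hle, eta_zero hle']

/-- antiderivative of the truncated profile -/
noncomputable def Fe (n : ℕ) (lam T ε t : ℝ) : ℝ := ∫ s in t..T, phe n lam T ε s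

theorem Fe_hasDerivAt (hε : 0 < ε) (t : ℝ) :
    HasDerivAt (Fe n lam T ε) (-phe n lam T ε t) t := by
  have hc := phe_continuous n lam (T := T) hε
  exact intervalIntegral.integral_hasDerivAt_left (hc.intervalIntegrable _ _)
    (hc.stronglyMeasurableAtFilter _ _) hc.continuousAt

theorem Fe_contDiff (hε : 0 < ε) : ContDiff ℝ (⊤ : ℕ∞) (Fe n lam T ε) := by
  rw [contDiff_infty_iff_deriv]
  refine ⟨fun t => (Fe_hasDerivAt n lam hε t).differentiableAt, ?_⟩
  have : deriv (Fe n lam T ε) = fun t => -phe n lam T ε t := by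
    funext t; exact (Fe_hasDerivAt n lam hε t).deriv
  rw [this]
  exact (phe_contDiff n lam hε).neg

theorem Fe_zero (hT : 0 < T) {t : ℝ} (h : T ≤ t) : Fe n lam T ε t = 0 := by
  unfold Fe
  rw [intervalIntegral.integral_symm, neg_eq_zero]
  rw [intervalIntegral.integral_congr (g := fun _ => 0)]
  · simp
  · intro s hs
    rw [Set.uIcc_of_le h] at hs
    exact phe_zero n lam hT hs.1

theorem Fe_nonneg (hT : 0 < T) (hε : 0 < ε) (t : ℝ) : 0 ≤ Fe n lam T ε t := by
  by_cases h : T ≤ t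
  · rw [Fe_zero n lam hT h]
  · exact intervalIntegral.integral_nonneg (by linarith) fun s _ => phe_nonneg n lam hε s

theorem Fe_anti (hT : 0 < T) {ε' : ℝ} (hε' : 0 < ε') (h : ε' ≤ ε) (t : ℝ) :
    Fe n lam T ε t ≤ Fe n lam T ε' t := by
  by_cases ht : T ≤ t
  · rw [Fe_zero n lam hT ht, Fe_zero n lam hT ht]
  · exact intervalIntegral.integral_mono_on (by linarith)
      ((phe_continuous n lam (by linarith)).intervalIntegrable _ _)
      ((phe_continuous n lam hε').intervalIntegrable _ _) fun s _ => phe_anti n lam hε' h s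

/-- singular antiderivative -/
noncomputable def F0 (n : ℕ) (lam T t : ℝ) : ℝ :=
  if 0 < t then Fe n lam T (t / 2) t else 0

theorem Fe_eq_of_le (hT : 0 < T) {ε' t : ℝ} (hε : 0 < ε) (hε' : 0 < ε') (h : 2 * ε ≤ t)
    (h' : 2 * ε' ≤ t) : Fe n lam T ε t = Fe n lam T ε' t := by
  by_cases ht : T ≤ t
  · rw [Fe_zero n lam hT ht, Fe_zero n lam hT ht]
  · refine intervalIntegral.integral_congr ?_
    intro s hs
    rw [Set.uIcc_of_le (by linarith)] at hs
    have h1 : 2 ≤ s / ε := by rw [le_div_iff₀ hε]; linarith [hs.1]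
    have h2 : 2 ≤ s / ε' := by rw [le_div_iff₀ hε']; linarith [hs.1]
    simp [phe, eta_one h1, eta_one h2]

theorem F0_eq (hT : 0 < T) {t : ℝ} (hε : 0 < ε) (h : 2 * ε ≤ t) :
    F0 n lam T t = Fe n lam T ε t := by
  have ht : 0 < t := by linarith
  rw [F0, if_pos ht]
  exact Fe_eq_of_le n lam hT (by linarith) hε (by linarith) h

theorem Fe_le_F0 (hT : 0 < T) {t : ℝ} (hε : 0 < ε) (ht : 0 < t) :
    Fe n lam T ε t ≤ F0 n lam T t := by
  rw [F0_eq n lam hT (ε := min ε (t/2)) (by positivity) (by linarith [min_le_right ε (t/2)])]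
  exact Fe_anti n lam hT (by positivity) (min_le_left _ _) t

theorem F0_nonneg (hT : 0 < T) (t : ℝ) : 0 ≤ F0 n lam T t := by
  unfold F0; split_ifs with h
  · exact Fe_nonneg n lam hT (by linarith) t
  · exact le_rfl

theorem F0_zero (hT : 0 < T) {t : ℝ} (h : T ≤ t) : F0 n lam T t = 0 := by
  unfold F0; split_ifs
  · exact Fe_zero n lam hT h
  · rfl

theorem F0_continuousAt (hT : 0 < T) {t : ℝ} (ht : 0 < t) : ContinuousAt (F0 n lam T) t := by
  have : F0 n lam T =ᶠ[𝓝 t] Fe n lam T (t / 4) := by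
    filter_upwards [Ioi_mem_nhds (show t / 2 < t by linarith)] with s hs
    exact F0_eq n lam hT (by linarith) (by have : t/2 < s := hs; linarith)
  exact (Fe_hasDerivAt n lam (by linarith) t).continuousAt.congr this.symm

end

end AlphaAux

open scoped ComplexOrder
namespace AlphaAux
variable {n : ℕ}

/-- kernel -/
noncomputable def kk (A : AlphaForm n) (lam T : ℝ) (x y : Cn n) : ℝ :=
  -(phi n lam T (qq A x y) * TT A x y + phid n lam T (qq A x y) * EE A x y)
/-- mollifier -/
noncomputable def ME (A : AlphaForm n) (lam T ε : ℝ) (x y : Cn n) : ℝ :=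
  (1 / ε * deriv eta (qq A x y / ε) * phi n lam T (qq A x y)) * EE A x y
/-- regularized Green function -/
noncomputable def gg (A : AlphaForm n) (lam T ε : ℝ) (x y : Cn n) : ℝ :=
  Fe n lam T ε (qq A x y)
/-- cutoff near the diagonal -/
noncomputable def HH (A : AlphaForm n) (ε : ℝ) (x y : Cn n) : ℝ := eta (qq A x y / ε)
/-- singular Green function -/
noncomputable def GG (A : AlphaForm n) (lam T : ℝ) (x y : Cn n) : ℝ := F0 n lam T (qq A x y)

theorem opR_gg (A : AlphaForm n) (lam : ℝ) {T ε : ℝ} (hε : 0 < ε) (x y : Cn n) :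
    alphaOpR A (gg A lam T ε x) y = HH A ε x y * kk A lam T x y - ME A lam T ε x y := by
  have h := opR_comp_qq A (F := Fe n lam T ε) (F1 := fun t => -phe n lam T ε t)
    (F2 := fun t => -(eta (t / ε) * phid n lam T t + 1 / ε * deriv eta (t / ε) * phi n lam T t))
    (Fe_hasDerivAt n lam hε) (fun t => (phe_hasDerivAt n lam hε t).neg) x y
  have : gg A lam T ε x = fun y => Fe n lam T ε (qq A x y) := rfl
  rw [this, h]
  simp only [HH, kk, ME, phe]
  ring

theorem gg_contDiff (A : AlphaForm n) (lam : ℝ) {T ε : ℝ} (hε : 0 < ε) (x : Cn n) :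
    ContDiff ℝ (⊤ : ℕ∞) (gg A lam T ε x) :=
  (Fe_contDiff n lam hε).comp (contDiff_qq A x)

theorem gg_nonneg (A : AlphaForm n) (lam : ℝ) {T ε : ℝ} (hT : 0 < T) (hε : 0 < ε) (x y : Cn n) :
    0 ≤ gg A lam T ε x y := Fe_nonneg n lam hT hε _

theorem gg_anti (A : AlphaForm n) (lam : ℝ) {T ε ε' : ℝ} (hT : 0 < T) (hε : 0 < ε')
    (h : ε' ≤ ε) (x y : Cn n) :
    gg A lam T ε x y ≤ gg A lam T ε' x y := Fe_anti n lam hT hε h _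

theorem HH_nonneg (A : AlphaForm n) (ε : ℝ) (x y : Cn n) : 0 ≤ HH A ε x y := eta_nonneg _
theorem HH_le_one (A : AlphaForm n) (ε : ℝ) (x y : Cn n) : HH A ε x y ≤ 1 := eta_le_one _
theorem HH_anti (A : AlphaForm n) {ε ε' : ℝ} (hε : 0 < ε') (h : ε' ≤ ε) (x y : Cn n) :
    HH A ε x y ≤ HH A ε' x y := by
  refine eta_mono ?_
  have := qq_nonneg A x y
  gcongr

theorem ME_nonneg (A : AlphaForm n) (lam T : ℝ) {ε : ℝ} (hε : 0 < ε) (x y : Cn n) :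
    0 ≤ ME A lam T ε x y := by
  have := eta_deriv_nonneg (qq A x y / ε)
  have := phi_nonneg n lam T (qq_nonneg A x y)
  have := EE_nonneg A x y
  unfold ME; positivity

theorem kk_mul_pow (A : AlphaForm n) (lam T : ℝ) {x y : Cn n} (h : 0 < qq A x y) :
    kk A lam T x y = (-(dq lam T (qq A x y) +
      Real.exp (-lam * √(qq A x y)) * chi T (qq A x y) * (TT A x y - n) +
      (dq lam T (qq A x y) - n * (Real.exp (-lam * √(qq A x y)) * chi T (qq A x y))) *
        ((EE A x y - qq A x y) / qq A x y))) / qq A x y ^ n := by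
  unfold kk phi phid
  generalize qq A x y = t at *
  field_simp
  ring

theorem alg_pos {a p s X τ σ Γ : ℝ} {m : ℝ} (hm : 0 ≤ m) (ha : 0 ≤ a) (hp : 0 ≤ p) (hs : 0 ≤ s)
    (hX : 0 ≤ X)
    (hτ : |τ| ≤ Γ * s) (hσ : |σ| ≤ Γ * s) (hΓ : Γ * s ≤ 1 / 2) :
    a * (s * X) ≤ -(a * (-p - 4 * ((m + 1) * Γ + 1) * s * X / 2) + a * X * τ +
      (a * (-p - 4 * ((m + 1) * Γ + 1) * s * X / 2) - m * (a * X)) * σ) := by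
  have h1 := abs_le.1 hτ
  have h2 := abs_le.1 hσ
  have hΓs : 0 ≤ Γ * s := (abs_nonneg _).trans hτ
  have e : -(a * (-p - 4 * ((m + 1) * Γ + 1) * s * X / 2) + a * X * τ +
      (a * (-p - 4 * ((m + 1) * Γ + 1) * s * X / 2) - m * (a * X)) * σ)
      = a * ((p + 2 * ((m + 1) * (Γ * s) + s) * X) * (1 + σ) - X * τ + m * X * σ) := by ring
  rw [e]
  refine mul_le_mul_of_nonneg_left ?_ ha
  have h3 : (p + 2 * ((m + 1) * (Γ * s) + s) * X) * (1 / 2) ≤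
      (p + 2 * ((m + 1) * (Γ * s) + s) * X) * (1 + σ) :=
    mul_le_mul_of_nonneg_left (by linarith) (by positivity)
  have h4 : X * τ ≤ X * (Γ * s) := mul_le_mul_of_nonneg_left h1.2 hX
  have h5 : m * X * (-(Γ * s)) ≤ m * X * σ := mul_le_mul_of_nonneg_left h2.1 (by positivity)
  nlinarith

theorem alg_neg {a s τ σ Γ : ℝ} {m : ℝ} (hm : 0 ≤ m) (ha : 0 ≤ a) (hs : 0 ≤ s)
    (hτ : |τ| ≤ Γ * s) (hσ : |σ| ≤ Γ * s) (hΓ : Γ * s ≤ 1 / 2) :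
    -(a * (-(-(4 * ((m + 1) * Γ + 1))) * s * 1 / 2) + a * 1 * τ +
      (a * (-(-(4 * ((m + 1) * Γ + 1))) * s * 1 / 2) - m * (a * 1)) * σ) ≤ 0 := by
  have h1 := abs_le.1 hτ
  have h2 := abs_le.1 hσ
  have hΓs : 0 ≤ Γ * s := (abs_nonneg _).trans hτ
  have e : -(a * (-(-(4 * ((m + 1) * Γ + 1))) * s * 1 / 2) + a * 1 * τ +
      (a * (-(-(4 * ((m + 1) * Γ + 1))) * s * 1 / 2) - m * (a * 1)) * σ)
      = - (a * ((2 * ((m + 1) * (Γ * s) + s)) * (1 + σ) + τ - m * σ)) := by ring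
  rw [e, neg_nonpos]
  refine mul_nonneg ha ?_
  have h3 : (2 * ((m + 1) * (Γ * s) + s)) * (1 / 2) ≤
      (2 * ((m + 1) * (Γ * s) + s)) * (1 + σ) :=
    mul_le_mul_of_nonneg_left (by linarith) (by positivity)
  have h5 : m * σ ≤ m * (Γ * s) := mul_le_mul_of_nonneg_left h2.2 (by positivity)
  nlinarith

theorem alg_abs {a b D τ σ Γ s X C : ℝ} {m : ℝ} (hm : 0 ≤ m) (ha : 0 ≤ a) (hab : a ≤ b)
    (hX : 0 ≤ X) (hX1 : X ≤ 1) (hD : |D| ≤ C * s) (hs : 0 ≤ s) (hC : 0 ≤ C)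
    (hτ : |τ| ≤ Γ * s) (hσ : |σ| ≤ Γ * s) (hΓ : Γ * s ≤ 1 / 2) :
    |-(D + a * X * τ + (D - m * (a * X)) * σ)| ≤ (2 * C + b * Γ * (m + 1)) * s := by
  have hΓs : 0 ≤ Γ * s := (abs_nonneg _).trans hτ
  rw [abs_neg]
  have haX : a * X ≤ b := by nlinarith
  have haX0 : 0 ≤ a * X := by positivity
  have h1 : |a * X * τ| ≤ b * (Γ * s) := by
    rw [abs_mul, abs_of_nonneg haX0]
    exact mul_le_mul haX hτ (abs_nonneg _) (by linarith)
  have h2 : |(D - m * (a * X)) * σ| ≤ C * s + m * b * (Γ * s) := by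
    rw [sub_mul]
    refine (abs_sub _ _).trans ?_
    refine add_le_add ?_ ?_
    · rw [abs_mul]
      nlinarith [abs_nonneg D, abs_nonneg σ]
    · rw [abs_mul, abs_of_nonneg (by positivity)]
      exact mul_le_mul (by gcongr) hσ (abs_nonneg _) (by nlinarith)
  calc |D + a * X * τ + (D - m * (a * X)) * σ| ≤ |D| + |a * X * τ| + |(D - m * (a * X)) * σ| :=
        abs_add_three _ _ _
    _ ≤ _ := by nlinarith

/-- admissible parameters. -/
structure KP (A : AlphaForm n) (B : Set (Cn n)) (Γ T : ℝ) : Prop where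
  hn : 1 ≤ n
  geo : Geo A B Γ
  hT : 0 < T
  hT1 : T ≤ 1
  small : Γ * √T ≤ 1 / 2

namespace KP
variable {A : AlphaForm n} {B : Set (Cn n)} {Γ T : ℝ} (P : KP A B Γ T)
include P

theorem Γpos : 0 < Γ := lt_of_lt_of_le one_pos P.geo.one_le

theorem small' {t : ℝ} (h : t ≤ T) : Γ * √t ≤ 1 / 2 :=
  (mul_le_mul_of_nonneg_left (Real.sqrt_le_sqrt h) P.Γpos.le).trans P.small

theorem sqrt_le_one {t : ℝ} (h : t ≤ T) : √t ≤ 1 :=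
  Real.sqrt_le_one.2 (h.trans P.hT1)

theorem sigma {x y : Cn n} (hx : x ∈ B) (hy : y ∈ B) (hq : 0 < qq A x y) :
    |(EE A x y - qq A x y) / qq A x y| ≤ Γ * √(qq A x y) := by
  rw [abs_div, abs_of_pos hq, div_le_iff₀ hq]
  have := P.geo.grad x hx y hy
  linarith

theorem EE_le {x y : Cn n} (hx : x ∈ B) (hy : y ∈ B) (hq : qq A x y ≤ T) :
    EE A x y ≤ 2 * qq A x y := by
  have h1 := (abs_le.1 (P.geo.grad x hx y hy)).2
  have h2 := P.small' hq
  have h3 := qq_nonneg A x y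
  nlinarith

theorem kk_zero_of_le (lam : ℝ) {x y : Cn n} (h : T ≤ qq A x y) : kk A lam T x y = 0 := by
  simp [kk, phi_zero n lam P.hT h, phid_zero n lam P.hT h]

theorem kk_diag (lam : ℝ) (x : Cn n) : kk A lam T x x = 0 := by
  have hn := P.hn
  have : n ≠ 0 := by omega
  simp [kk, qq_self, phi, phid, this]

/-- strict lower bound for the `+` kernel -/
theorem kk_lower {x y : Cn n} (hx : x ∈ B) (hy : y ∈ B) (hq : 0 < qq A x y) (hqT : qq A x y ≤ T) :
    phi n (4 * ((n + 1) * Γ + 1)) T (qq A x y) * √(qq A x y) ≤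
      kk A (4 * ((n + 1) * Γ + 1)) T x y := by
  rw [kk_mul_pow A _ _ hq]
  have hp : 0 ≤ -(qq A x y * deriv (chi T) (qq A x y)) := by
    have := chi_deriv_nonpos P.hT (qq A x y); nlinarith
  have := alg_pos (m := n) (Γ := Γ) (Nat.cast_nonneg n)
    (Real.exp_pos (-(4 * ((n + 1) * Γ + 1)) * √(qq A x y))).le hp
    (Real.sqrt_nonneg (qq A x y)) (chi_nonneg (T := T) (qq A x y))
    (P.geo.trace x hx y hy) (P.sigma hx hy hq) (P.small' hqT)
  unfold phi
  rw [div_mul_eq_mul_div]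
  refine div_le_div_of_nonneg_right ?_ (by positivity)
  simp only [neg_neg] at this
  unfold dq
  linarith

theorem kk_nonneg {x y : Cn n} (hx : x ∈ B) (hy : y ∈ B) :
    0 ≤ kk A (4 * ((n + 1) * Γ + 1)) T x y := by
  by_cases h : T ≤ qq A x y
  · rw [P.kk_zero_of_le _ h]
  by_cases hxy : y = x
  · rw [hxy, P.kk_diag]
  · have hq := qq_pos A hxy
    exact le_trans (mul_nonneg (phi_nonneg n _ T hq.le) (Real.sqrt_nonneg _))
      (P.kk_lower hx hy hq (not_le.1 h).le)

theorem kk_nonpos {x y : Cn n} (hx : x ∈ B) (hy : y ∈ B) (h : qq A x y ≤ T / 2) :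
    kk A (-(4 * ((n + 1) * Γ + 1))) T x y ≤ 0 := by
  by_cases hxy : y = x
  · rw [hxy, P.kk_diag]
  have hq := qq_pos A hxy
  have hT := P.hT
  rw [kk_mul_pow A _ _ hq]
  have := alg_neg (m := n) (Γ := Γ) (Nat.cast_nonneg n)
    (Real.exp_pos (-(-(4 * ((n + 1) * Γ + 1))) * √(qq A x y))).le
    (Real.sqrt_nonneg (qq A x y))
    (P.geo.trace x hx y hy) (P.sigma hx hy hq) (P.small' (by linarith))
  refine div_nonpos_of_nonpos_of_nonneg ?_ (by positivity)
  unfold dq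
  rw [chi_one hT h, chi_deriv_zero hT (Or.inl h)]
  simp only [mul_zero, zero_sub] at this ⊢
  simp only [neg_mul, neg_neg, neg_div] at this ⊢
  exact this

/-- absolute bound in terms of `q` -/
theorem kk_abs_q (lam : ℝ) : ∃ C, 0 < C ∧ ∀ x ∈ B, ∀ y ∈ B, 
    |kk A lam T x y| ≤ C * (√(qq A x y) / qq A x y ^ n) := by
  obtain ⟨S, hS0, hS⟩ := chi_deriv_bdd P.hT
  set b := Real.exp |lam|
  have hb : 0 < b := Real.exp_pos _
  have hΓ := P.Γpos
  refine ⟨2 * (b * (S + |lam|)) + b * Γ * (n + 1), by positivity, fun x hx y hy => ?_⟩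
  by_cases h : T ≤ qq A x y
  · rw [P.kk_zero_of_le _ h, abs_zero]
    have := qq_nonneg A x y
    positivity
  by_cases hxy : y = x
  · rw [hxy, P.kk_diag, qq_self]; simp
  have hq := qq_pos A hxy
  push Not at h
  have hs1 := P.sqrt_le_one h.le
  have hs0 := Real.sqrt_nonneg (qq A x y)
  have ha : Real.exp (-lam * √(qq A x y)) ≤ b := by
    refine Real.exp_le_exp.2 ?_
    have : -lam ≤ |lam| := neg_le_abs lam
    have := abs_nonneg lam
    nlinarith
  have hts : qq A x y ≤ √(qq A x y) := by
    have := Real.mul_self_sqrt hq.le; nlinarith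
  have hD : |dq lam T (qq A x y)| ≤ b * (S + |lam|) * √(qq A x y) := by
    unfold dq
    rw [abs_mul, abs_of_pos (Real.exp_pos _), mul_assoc b]
    refine mul_le_mul ha ?_ (abs_nonneg _) hb.le
    refine (abs_sub _ _).trans ?_
    rw [add_mul]
    refine add_le_add ?_ ?_
    · rw [abs_mul, abs_of_pos hq, mul_comm]
      exact mul_le_mul (hS _) hts hq.le hS0.le
    · rw [abs_div, abs_mul, abs_mul, abs_of_nonneg hs0, abs_of_nonneg (chi_nonneg _), abs_two]
      have := chi_le_one (T := T) (qq A x y)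
      have := chi_nonneg (T := T) (qq A x y)
      have : 0 ≤ |lam| * √(qq A x y) := by positivity
      nlinarith
  rw [kk_mul_pow A _ _ hq, abs_div, abs_of_pos (pow_pos hq n), ← mul_div_assoc (2 * (b * (S + |lam|)) + b * Γ * (n + 1))]
  refine div_le_div_of_nonneg_right ?_ (pow_pos hq n).le
  exact alg_abs (m := n) (C := b * (S + |lam|)) (Nat.cast_nonneg n) (Real.exp_pos _).le ha 
    (chi_nonneg _) (chi_le_one _)
    hD hs0 (by positivity) (P.geo.trace x hx y hy) (P.sigma hx hy hq) (P.small' h.le)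

theorem phi_le (lam : ℝ) {t : ℝ} (h0 : 0 < t) : phi n lam T t ≤ Real.exp |lam| / t ^ n := by
  by_cases ht : T ≤ t
  · rw [phi_zero n lam P.hT ht]; positivity
  unfold phi
  refine div_le_div_of_nonneg_right ?_ (by positivity)
  have hs1 := P.sqrt_le_one (not_le.1 ht).le
  have hs0 := Real.sqrt_nonneg t
  have ha : Real.exp (-lam * √t) ≤ Real.exp |lam| := by
    refine Real.exp_le_exp.2 ?_
    have : -lam ≤ |lam| := neg_le_abs lam
    have := abs_nonneg lam
    nlinarith
  have := chi_le_one (T := T) t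
  have := chi_nonneg (T := T) t
  have := Real.exp_pos |lam|
  have := Real.exp_pos (-lam * √t)
  nlinarith

theorem le_phi (lam : ℝ) {t : ℝ} (h0 : 0 < t) (h : t ≤ T / 2) :
    Real.exp (-|lam|) / t ^ n ≤ phi n lam T t := by
  unfold phi
  have hT := P.hT
  rw [chi_one P.hT h, mul_one]
  refine div_le_div_of_nonneg_right ?_ (by positivity)
  refine Real.exp_le_exp.2 ?_
  have hs1 := P.sqrt_le_one (t := t) (by linarith)
  have hs0 := Real.sqrt_nonneg t
  have : lam ≤ |lam| := le_abs_self lam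
  have := abs_nonneg lam
  nlinarith

theorem qq_lt_of_ME_ne {lam ε : ℝ} (hε : 0 < ε) {x y : Cn n} (h : ME A lam T ε x y ≠ 0) :
    ε < qq A x y ∧ qq A x y < 2 * ε ∧ qq A x y < T := by
  refine ⟨?_, ?_, ?_⟩
  · by_contra h'
    apply h
    have : qq A x y / ε ≤ 1 := by rw [div_le_one hε]; linarith
    simp [ME, eta_deriv_zero (Or.inl this)]
  · by_contra h'
    apply h
    have : 2 ≤ qq A x y / ε := by rw [le_div_iff₀ hε]; linarith
    simp [ME, eta_deriv_zero (Or.inr this)]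
  · by_contra h'
    apply h
    simp [ME, phi_zero n lam P.hT (not_lt.1 h')]

theorem ME_bound (lam : ℝ) : ∃ C, 0 < C ∧ ∀ ε, 0 < ε → ∀ x ∈ B, ∀ y ∈ B,
    ME A lam T ε x y ≤ C / ε ^ n := by
  obtain ⟨S, hS0, hS⟩ := eta_deriv_bdd
  refine ⟨4 * S * Real.exp |lam|, by positivity, fun ε hε x hx y hy => ?_⟩
  by_cases h : ME A lam T ε x y = 0
  · rw [h]; positivity
  obtain ⟨h1, h2, h3⟩ := P.qq_lt_of_ME_ne hε h
  have hE := P.EE_le hx hy h3.le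
  have hE0 := EE_nonneg A x y
  have hq : 0 < qq A x y := hε.trans h1
  have hp := P.phi_le lam hq
  have hp0 := phi_nonneg n lam T hq.le
  have hp' : phi n lam T (qq A x y) ≤ Real.exp |lam| / ε ^ n := by
    refine hp.trans ?_
    have : ε ^ n ≤ qq A x y ^ n := pow_le_pow_left₀ hε.le h1.le n
    gcongr
  have hS' := hS (qq A x y / ε)
  have hS0' := eta_deriv_nonneg (qq A x y / ε)
  unfold ME
  calc 1 / ε * deriv eta (qq A x y / ε) * phi n lam T (qq A x y) * EE A x y
      ≤ 1 / ε * S * (Real.exp |lam| / ε ^ n) * (4 * ε) := by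
        gcongr; linarith
    _ = _ := by field_simp

/-- support radius -/
theorem norm_le_of_qq {x y : Cn n} (hx : x ∈ B) {t : ℝ} (h : qq A x y ≤ t) :
    ‖y - x‖ ≤ √(Γ * t) := by
  refine Real.le_sqrt_of_sq_le ?_
  exact (P.geo.lower x hx y).trans (mul_le_mul_of_nonneg_left h P.Γpos.le)

theorem q_to_norm {x : Cn n} (hx : x ∈ B) (y : Cn n) :
    √(qq A x y) / qq A x y ^ n ≤ (√Γ * Γ ^ n) * (‖y - x‖ ^ (2 * n - 1))⁻¹ := by
  have hn := P.hn
  by_cases hxy : y = x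
  · rw [hxy, qq_self]
    have := P.Γpos
    simp only [Real.sqrt_zero, zero_div]
    positivity
  have hq := qq_pos A hxy
  have hN : 0 < ‖y - x‖ := norm_pos_iff.2 (sub_ne_zero.2 hxy)
  have hΓ := P.Γpos
  have h1 : √(qq A x y) ≤ √Γ * ‖y - x‖ := by
    rw [Real.sqrt_le_left (by positivity), mul_pow, Real.sq_sqrt hΓ.le]
    exact P.geo.upper x hx y
  have h2 : ‖y - x‖ ^ (2 * n) ≤ Γ ^ n * qq A x y ^ n := by
    rw [pow_mul, ← mul_pow]
    exact pow_le_pow_left₀ (by positivity) (P.geo.lower x hx y) n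
  have e : ‖y - x‖ ^ (2 * n) = ‖y - x‖ ^ (2 * n - 1) * ‖y - x‖ := by
    rw [← pow_succ]; congr 1; omega
  rw [div_le_iff₀ (by positivity)]
  calc √(qq A x y) ≤ √Γ * ‖y - x‖ := h1
    _ = √Γ * (‖y - x‖ ^ (2 * n - 1))⁻¹ * ‖y - x‖ ^ (2 * n) := by rw [e]; field_simp
    _ ≤ √Γ * (‖y - x‖ ^ (2 * n - 1))⁻¹ * (Γ ^ n * qq A x y ^ n) := by gcongr
    _ = _ := by ring

theorem kk_abs (lam : ℝ) : ∃ C, 0 < C ∧ ∀ x ∈ B, ∀ y ∈ B, 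
    |kk A lam T x y| ≤ C * (‖y - x‖ ^ (2 * n - 1))⁻¹ := by
  obtain ⟨C, hC, h⟩ := P.kk_abs_q lam
  have hΓ := P.Γpos
  refine ⟨C * (√Γ * Γ ^ n), by positivity, fun x hx y hy => (h x hx y hy).trans ?_⟩
  rw [mul_assoc]
  exact mul_le_mul_of_nonneg_left (P.q_to_norm hx y) hC.le

/-- bound on the singular antiderivative -/
theorem F0_le (lam : ℝ) {t : ℝ} (ht : 0 < t) :
    F0 n lam T t ≤ 2 * Real.exp |lam| * (√t / t ^ n) := by
  have hn := P.hn
  by_cases h : T ≤ t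
  · rw [F0_zero n lam P.hT h]; positivity
  push Not at h
  rw [F0, if_pos ht]
  unfold Fe
  have hb : ∀ s ∈ Set.Icc t T, phe n lam T (t / 2) s ≤
      Real.exp |lam| * (√t / t ^ n) * (1 / √s) := by
    intro s hs
    have hs0 : 0 < s := ht.trans_le hs.1
    have h1 : phe n lam T (t / 2) s ≤ phi n lam T s := by
      have := phi_nonneg n lam T hs0.le
      have := eta_le_one (s / (t / 2))
      unfold phe; nlinarith
    refine h1.trans ((P.phi_le lam hs0).trans ?_)
    rw [mul_assoc, div_eq_mul_inv]
    refine mul_le_mul_of_nonneg_left ?_ (Real.exp_pos _).le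
    rw [div_mul_div_comm, mul_one, inv_eq_one_div, div_le_div_iff₀ (by positivity)
      (mul_pos (by positivity) (Real.sqrt_pos.2 hs0)), one_mul]
    -- t^n √s ≤ √t s^n
    obtain ⟨m, rfl⟩ : ∃ m, n = m + 1 := ⟨n - 1, by omega⟩
    have e1 : t ^ (m + 1) = t ^ m * (√t * √t) := by rw [Real.mul_self_sqrt ht.le, pow_succ]
    have e2 : s ^ (m + 1) = s ^ m * (√s * √s) := by rw [Real.mul_self_sqrt hs0.le, pow_succ]
    rw [e1, e2]
    have h3 : √t ≤ √s := Real.sqrt_le_sqrt hs.1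
    have h4 : t ^ m ≤ s ^ m := pow_le_pow_left₀ ht.le hs.1 m
    have h5 := Real.sqrt_nonneg t
    calc t ^ m * (√t * √t) * √s = (t ^ m * √t) * (√t * √s) := by ring
      _ ≤ (s ^ m * √s) * (√t * √s) := by gcongr
      _ = _ := by ring
  have hc : ContinuousOn (fun s => Real.exp |lam| * (√t / t ^ n) * (1 / √s)) (Set.uIcc t T) := by
    rw [Set.uIcc_of_le h.le]
    refine continuousOn_const.mul (continuousOn_const.div Real.continuous_sqrt.continuousOn ?_)
    intro s hs
    exact (Real.sqrt_pos.2 (ht.trans_le hs.1)).ne'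
  have hI := intervalIntegral.integral_mono_on (μ := volume) h.le
    ((phe_continuous n lam (by linarith)).intervalIntegrable _ _) hc.intervalIntegrable hb
  refine hI.trans ?_
  have hd : ∀ s ∈ Set.uIcc t T, HasDerivAt (fun s => 2 * √s) (1 / √s) s := by
    intro s hs
    rw [Set.uIcc_of_le h.le] at hs
    have hs0 : 0 < s := ht.trans_le hs.1
    refine ((Real.hasDerivAt_sqrt hs0.ne').const_mul 2).congr_deriv ?_
    have := Real.sqrt_pos.2 hs0
    field_simp
  have hc2 : ContinuousOn (fun s => (1 / √s)) (Set.uIcc t T) := by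
    rw [Set.uIcc_of_le h.le]
    refine (continuousOn_const.div Real.continuous_sqrt.continuousOn ?_)
    intro s hs
    exact (Real.sqrt_pos.2 (ht.trans_le hs.1)).ne'
  rw [intervalIntegral.integral_const_mul, intervalIntegral.integral_eq_sub_of_hasDerivAt hd
    hc2.intervalIntegrable]
  have h6 := P.sqrt_le_one (le_refl T)
  have h7 := Real.sqrt_nonneg t
  have : 0 ≤ Real.exp |lam| * (√t / t ^ n) := by positivity
  nlinarith

end KP

end AlphaAux

open scoped ComplexOrder
namespace AlphaAux
variable {n : ℕ}

/-- radial majorant -/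
noncomputable def NN (n : ℕ) (r : ℝ) (h : Cn n) : ℝ :=
  (closedBall (0 : Cn n) r).indicator (fun h => (‖h‖ ^ (2 * n - 1))⁻¹) h

theorem NN_nonneg (r : ℝ) (h : Cn n) : 0 ≤ NN n r h :=
  Set.indicator_nonneg (fun _ _ => by positivity) _

theorem NN_measurable (r : ℝ) : Measurable (NN n r) := by
  unfold NN
  exact Measurable.indicator (by fun_prop) measurableSet_closedBall

theorem NN_of_le {r : ℝ} {h : Cn n} (hr : ‖h‖ ≤ r) : NN n r h = (‖h‖ ^ (2 * n - 1))⁻¹ := by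
  unfold NN; rw [Set.indicator_of_mem]; simpa using hr

theorem finrank_Cn : Module.finrank ℝ (Cn n) = 2 * n := by
  rw [Module.finrank_pi_fintype]; simp [Complex.finrank_real_complex]; ring

theorem NN_integrable (hn : 1 ≤ n) (r : ℝ) : Integrable (NN n r) := by
  have : Nonempty (Fin n) := ⟨⟨0, hn⟩⟩
  unfold NN
  rw [integrable_indicator_iff measurableSet_closedBall]
  refine IntegrableOn.mono_set (t := ball 0 (r + 1)) ?_ (closedBall_subset_ball (by linarith))
  rw [integrableOn_fun_norm_addHaar volume (f := fun t : ℝ => (t ^ (2 * n - 1))⁻¹)]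
  have : IntegrableOn (fun _ : ℝ => (1 : ℝ)) (Set.Ioo 0 (r + 1)) := by
    rw [integrableOn_const_iff]; right; simp
  refine this.congr_fun ?_ measurableSet_Ioo
  intro t ht
  have : 0 < t := ht.1
  simp only [finrank_Cn, smul_eq_mul]
  rw [mul_inv_cancel₀ (by positivity)]

theorem NN_tendsto (hn : 1 ≤ n) : Tendsto (fun r => ∫ h, NN n r h) (𝓝[>] 0) (𝓝 0) := by
  have hz : Tendsto (fun r => ∫ h, NN n r h) (𝓝[>] 0) (𝓝 (∫ h : Cn n, (0 : ℝ))) := by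
    refine tendsto_integral_filter_of_dominated_convergence (NN n 1) ?_ ?_ (NN_integrable hn 1) ?_
    · exact Eventually.of_forall fun r => (NN_measurable r).aestronglyMeasurable
    · have : Set.Iio (1 : ℝ) ∈ 𝓝[>] (0 : ℝ) := mem_nhdsWithin_of_mem_nhds (Iio_mem_nhds one_pos)
      filter_upwards [this] with r hr
      refine Eventually.of_forall fun h => ?_
      rw [Real.norm_of_nonneg (NN_nonneg r h)]
      exact Set.indicator_le_indicator_of_subset (closedBall_subset_closedBall hr.le)
        (fun _ => by positivity) h
    · refine Eventually.of_forall fun h => ?_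
      by_cases h0 : h = 0
      · refine Tendsto.congr (f₁ := fun _ => (0 : ℝ)) ?_ tendsto_const_nhds
        intro r
        have : 2 * n - 1 ≠ 0 := by omega
        unfold NN
        simp [Set.indicator, h0, this]
      · have hp : 0 < ‖h‖ := norm_pos_iff.2 h0
        have : Set.Iio ‖h‖ ∈ 𝓝[>] (0 : ℝ) := mem_nhdsWithin_of_mem_nhds (Iio_mem_nhds hp)
        refine Tendsto.congr' (f₁ := fun _ => (0 : ℝ)) ?_ tendsto_const_nhds
        filter_upwards [this] with r hr
        unfold NN
        rw [Set.indicator_of_notMem]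
        simpa using hr
  simpa using hz

theorem integral_NN_sub (r : ℝ) (x : Cn n) : ∫ y, NN n r (y - x) = ∫ h, NN n r h :=
  integral_sub_right_eq_self (NN n r) x

theorem phi_measurable (n : ℕ) (lam T : ℝ) : Measurable (phi n lam T) := by
  have h1 : Continuous (chi T) := (chi_contDiff (m := 1)).continuous
  unfold phi; fun_prop

theorem phid_measurable (n : ℕ) (lam T : ℝ) : Measurable (phid n lam T) := by
  have h1 : Continuous (chi T) := (chi_contDiff (m := 1)).continuous
  have h2 := chi_deriv_cont (T := T)
  unfold phid dq; fun_prop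

theorem F0_measurable (n : ℕ) (lam : ℝ) {T : ℝ} (hT : 0 < T) : Measurable (F0 n lam T) := by
  have hc : ContinuousOn (F0 n lam T) (Set.Ioi 0) :=
    fun t ht => (F0_continuousAt n lam hT ht).continuousWithinAt
  have h0 : ∀ t, t ∉ Set.Ioi (0 : ℝ) → F0 n lam T t = 0 := by
    intro t ht; unfold F0; exact if_neg ht
  have : F0 n lam T = (Set.Ioi (0 : ℝ)).piecewise (F0 n lam T) (fun _ => 0) := by
    funext t
    by_cases ht : t ∈ Set.Ioi (0 : ℝ)
    · simp [Set.piecewise, ht]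
    · rw [Set.piecewise_eq_of_notMem _ _ _ ht, h0 t ht]
  rw [this]
  exact hc.measurable_piecewise continuousOn_const measurableSet_Ioi

theorem kk_measurable (A : AlphaForm n) (lam T : ℝ) :
    Measurable (fun p : Cn n × Cn n => kk A lam T p.1 p.2) := by
  have h1 := (continuous_qq A).measurable
  have h2 := (continuous_TT A).measurable
  have h3 := (continuous_EE A).measurable
  unfold kk
  exact ((((phi_measurable n lam T).comp h1).mul h2).add
    (((phid_measurable n lam T).comp h1).mul h3)).neg

theorem GG_measurable (A : AlphaForm n) (lam : ℝ) {T : ℝ} (hT : 0 < T) :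
    Measurable (fun p : Cn n × Cn n => GG A lam T p.1 p.2) := by
  unfold GG
  exact (F0_measurable n lam hT).comp (continuous_qq A).measurable

theorem cont_cut {f g : ℝ → ℝ} {ε : ℝ} (hε : 0 < ε) (hf : ContinuousOn f (Set.Ioi 0))
    (hg : Continuous g) (h0 : ∀ t ≤ ε, g t = 0) : Continuous fun t => g t * f t := by
  rw [continuous_iff_continuousAt]
  intro t
  by_cases ht : 0 < t
  · exact hg.continuousAt.mul (hf.continuousAt (Ioi_mem_nhds ht))
  · have : (fun t => g t * f t) =ᶠ[𝓝 t] fun _ => 0 := by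
      filter_upwards [Iio_mem_nhds (show t < ε by linarith)] with s hs
      rw [h0 s (le_of_lt hs), zero_mul]
    exact continuousAt_const.congr this.symm

theorem ME_continuous (A : AlphaForm n) (lam T : ℝ) {ε : ℝ} (hε : 0 < ε) :
    Continuous (fun p : Cn n × Cn n => ME A lam T ε p.1 p.2) := by
  have hm : Continuous fun t => (1 / ε * deriv eta (t / ε)) * phi n lam T t := by
    refine cont_cut hε (phi_continuousOn n lam T) ?_ ?_
    · have := eta_deriv_cont; fun_prop
    · intro t ht
      rw [eta_deriv_zero (Or.inl ((div_le_one hε).2 ht)), mul_zero]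
  unfold ME
  exact (hm.comp (continuous_qq A)).mul (continuous_EE A)

theorem HH_continuous (A : AlphaForm n) (ε : ℝ) :
    Continuous (fun p : Cn n × Cn n => HH A ε p.1 p.2) := by
  have : Continuous eta := (eta_contDiff (m := 1)).continuous
  unfold HH
  exact this.comp ((continuous_qq A).div_const ε)

theorem HHkk_continuous (A : AlphaForm n) (lam T : ℝ) {ε : ℝ} (hε : 0 < ε) :
    Continuous (fun p : Cn n × Cn n => HH A ε p.1 p.2 * kk A lam T p.1 p.2) := by
  have he : Continuous fun t : ℝ => eta (t / ε) := by
    have : Continuous eta := (eta_contDiff (m := 1)).continuous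
    fun_prop
  have h0 : ∀ t ≤ ε, eta (t / ε) = 0 := fun t ht => eta_zero ((div_le_one hε).2 ht)
  have h1 := cont_cut hε (phi_continuousOn n lam T) he h0
  have h2 := cont_cut hε (phid_continuousOn n lam T) he h0
  have e : (fun p : Cn n × Cn n => HH A ε p.1 p.2 * kk A lam T p.1 p.2) = fun p : Cn n × Cn n =>
      -((eta (qq A p.1 p.2 / ε) * phi n lam T (qq A p.1 p.2)) * TT A p.1 p.2 +
        (eta (qq A p.1 p.2 / ε) * phid n lam T (qq A p.1 p.2)) * EE A p.1 p.2) := by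
    funext p; unfold HH kk; ring
  rw [e]
  exact (((h1.comp (continuous_qq A)).mul (continuous_TT A)).add
    ((h2.comp (continuous_qq A)).mul (continuous_EE A))).neg

theorem gg_continuous (A : AlphaForm n) (lam : ℝ) {T ε : ℝ} (hε : 0 < ε) :
    Continuous (fun p : Cn n × Cn n => gg A lam T ε p.1 p.2) := by
  unfold gg
  exact (Fe_contDiff n lam hε).continuous.comp (continuous_qq A)

/-- the constant `λ` -/
noncomputable def Lam (n : ℕ) (Γ : ℝ) : ℝ := 4 * ((n + 1) * Γ + 1)

/-- kernels with centres in a ball -/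
structure KC (A : AlphaForm n) (z0 : Cn n) (ρ ρ' Γ T : ℝ) : Prop extends
    KP A (closedBall z0 ρ) Γ T where
  hr : ρ' + √(Γ * T) ≤ ρ

namespace KC
variable {A : AlphaForm n} {z0 : Cn n} {ρ ρ' Γ T : ℝ} (P : KC A z0 ρ ρ' Γ T)
include P

theorem mem_of_center {x : Cn n} (hx : x ∈ closedBall z0 ρ') : x ∈ closedBall z0 ρ := by
  have := P.hr
  have := Real.sqrt_nonneg (Γ * T)
  exact closedBall_subset_closedBall (by linarith) hx

theorem norm_le {x y : Cn n} (hx : x ∈ closedBall z0 ρ') (h : qq A x y ≤ T) :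
    ‖y - x‖ ≤ √(Γ * T) := P.toKP.norm_le_of_qq (P.mem_of_center hx) h

theorem mem_of_qq {x y : Cn n} (hx : x ∈ closedBall z0 ρ') (h : qq A x y ≤ T) :
    y ∈ closedBall z0 ρ := by
  have h1 := P.norm_le hx h
  have h2 := P.hr
  rw [mem_closedBall, dist_eq_norm] at hx ⊢
  have : y - z0 = (y - x) + (x - z0) := by abel
  rw [this]
  exact (norm_add_le _ _).trans (by linarith)

theorem kk_le (lam : ℝ) : ∃ C, 0 < C ∧ ∀ x ∈ closedBall z0 ρ', ∀ y,
    |kk A lam T x y| ≤ C * NN n (√(Γ * T)) (y - x) := by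
  obtain ⟨C, hC, h⟩ := P.toKP.kk_abs lam
  refine ⟨C, hC, fun x hx y => ?_⟩
  by_cases hq : T ≤ qq A x y
  · rw [P.kk_zero_of_le _ hq, abs_zero]
    exact mul_nonneg hC.le (NN_nonneg _ _)
  · push Not at hq
    rw [NN_of_le (P.norm_le hx hq.le)]
    exact h x (P.mem_of_center hx) y (P.mem_of_qq hx hq.le)

theorem GG_le (lam : ℝ) : ∃ C, 0 < C ∧ ∀ x ∈ closedBall z0 ρ', ∀ y,
    GG A lam T x y ≤ C * NN n (√(Γ * T)) (y - x) := by
  have hΓ := P.Γpos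
  refine ⟨2 * Real.exp |lam| * (√Γ * Γ ^ n), by positivity, fun x hx y => ?_⟩
  have hN := NN_nonneg (√(Γ * T)) (y - x)
  by_cases hq : T ≤ qq A x y
  · unfold GG
    rw [F0_zero n lam P.hT hq]
    positivity
  · push Not at hq
    by_cases hq0 : 0 < qq A x y
    · rw [NN_of_le (P.norm_le hx hq.le)]
      refine (P.F0_le lam hq0).trans ?_
      rw [mul_assoc _ (√Γ * Γ ^ n)]
      exact mul_le_mul_of_nonneg_left (P.q_to_norm (P.mem_of_center hx) y) (by positivity)
    · unfold GG F0
      rw [if_neg hq0]; positivity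

theorem kk_integrable (lam : ℝ) {x : Cn n} (hx : x ∈ closedBall z0 ρ') :
    Integrable (kk A lam T x) := by
  obtain ⟨C, hC, h⟩ := P.kk_le lam
  refine Integrable.mono' (((NN_integrable P.hn (√(Γ * T))).comp_sub_right x).const_mul C) ?_ ?_
  · exact ((kk_measurable A lam T).comp measurable_prodMk_left).aestronglyMeasurable
  · exact Eventually.of_forall fun y => h x hx y

theorem GG_integrable (lam : ℝ) {x : Cn n} (hx : x ∈ closedBall z0 ρ') :
    Integrable (GG A lam T x) := by
  obtain ⟨C, hC, h⟩ := P.GG_le lam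
  refine Integrable.mono' (((NN_integrable P.hn (√(Γ * T))).comp_sub_right x).const_mul C) ?_ ?_
  · exact ((GG_measurable A lam P.hT).comp measurable_prodMk_left).aestronglyMeasurable
  · refine Eventually.of_forall fun y => ?_
    have h0 : 0 ≤ GG A lam T x y := F0_nonneg n lam P.hT _
    rw [Real.norm_of_nonneg h0]
    exact h x hx y

theorem gg_zero {x y : Cn n} (lam ε : ℝ) (h : T ≤ qq A x y) : gg A lam T ε x y = 0 :=
  Fe_zero n lam P.hT h

theorem gg_tsupport (lam ε : ℝ) {x : Cn n} (hx : x ∈ closedBall z0 ρ') :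
    tsupport (gg A lam T ε x) ⊆ closedBall x (√(Γ * T)) := by
  refine closure_minimal ?_ isClosed_closedBall
  intro y hy
  by_contra h
  apply hy
  refine P.gg_zero _ _ ?_
  by_contra h'
  apply h
  rw [mem_closedBall, dist_eq_norm]
  exact P.norm_le hx (not_le.1 h').le

theorem ball_sub {x : Cn n} (hx : x ∈ closedBall z0 ρ') :
    closedBall x (√(Γ * T)) ⊆ closedBall z0 ρ := by
  refine closedBall_subset_closedBall' ?_
  have := P.hr
  rw [mem_closedBall] at hx
  linarith

theorem gg_hcs (lam ε : ℝ) {x : Cn n} (hx : x ∈ closedBall z0 ρ') :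
    HasCompactSupport (gg A lam T ε x) :=
  (isCompact_closedBall x _).of_isClosed_subset (isClosed_tsupport _) (P.gg_tsupport lam ε hx)

theorem ME_zero_out (lam : ℝ) {ε : ℝ} (hε : 0 < ε) {x y : Cn n} (hx : x ∈ closedBall z0 ρ')
    (hy : y ∉ closedBall z0 ρ) : ME A lam T ε x y = 0 := by
  by_contra h
  exact hy (P.mem_of_qq hx (P.qq_lt_of_ME_ne hε h).2.2.le)

theorem kk_zero_out (lam : ℝ) {x y : Cn n} (hx : x ∈ closedBall z0 ρ')
    (hy : y ∉ closedBall z0 ρ) : kk A lam T x y = 0 := by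
  refine P.kk_zero_of_le lam ?_
  by_contra h
  exact hy (P.mem_of_qq hx (not_le.1 h).le)

theorem kk_pos {x : Cn n} (hx : x ∈ closedBall z0 ρ') (y : Cn n) :
    0 ≤ kk A (Lam n Γ) T x y := by
  by_cases hy : y ∈ closedBall z0 ρ
  · exact P.toKP.kk_nonneg (P.mem_of_center hx) hy
  · rw [P.kk_zero_out _ hx hy]

theorem ME_integrable (lam : ℝ) {ε : ℝ} (hε : 0 < ε) {x : Cn n} (hx : x ∈ closedBall z0 ρ') :
    Integrable (ME A lam T ε x) := by
  have hc : Continuous (ME A lam T ε x) :=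
    (ME_continuous A lam T hε).comp (Continuous.prodMk_right x)
  refine hc.integrable_of_hasCompactSupport ?_
  refine HasCompactSupport.intro (isCompact_closedBall z0 ρ) ?_
  exact fun y hy => P.ME_zero_out lam hε hx hy

theorem HHkk_integrable (lam ε : ℝ) {x : Cn n} (hx : x ∈ closedBall z0 ρ') :
    Integrable (fun y => HH A ε x y * kk A lam T x y) := by
  refine (P.kk_integrable lam hx).bdd_mul (c := 1) ?_ ?_
  · exact ((HH_continuous A ε).comp (Continuous.prodMk_right x)).aestronglyMeasurable
  · refine Eventually.of_forall fun y => ?_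
    rw [Real.norm_of_nonneg (HH_nonneg A ε x y)]; exact HH_le_one A ε x y

theorem integral_ME (lam : ℝ) {ε : ℝ} (hε : 0 < ε) {x : Cn n} (hx : x ∈ closedBall z0 ρ') :
    ∫ y, ME A lam T ε x y = ∫ y, HH A ε x y * kk A lam T x y := by
  have h := integral_opR A ((gg_contDiff A lam (T := T) hε x).of_le (by norm_cast))
    (P.gg_hcs lam ε hx)
  simp only [opR_gg A lam hε] at h
  rw [integral_sub (P.HHkk_integrable lam ε hx) (P.ME_integrable lam hε hx)] at h
  linarith

end KC

end AlphaAux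

open scoped ComplexOrder
namespace AlphaAux
variable {n : ℕ}

/-- total mass of the kernel -/
noncomputable def cc (A : AlphaForm n) (lam T : ℝ) (x : Cn n) : ℝ := ∫ y, kk A lam T x y

theorem Lam_nonneg {Γ : ℝ} (h : 0 ≤ Γ) : 0 ≤ Lam n Γ := by unfold Lam; positivity

theorem HH_eventually_one (A : AlphaForm n) {x y : Cn n} (h : y ≠ x) :
    ∀ᶠ ε in 𝓝[>] (0 : ℝ), HH A ε x y = 1 := by
  have hq := qq_pos A h
  have : Set.Iio (qq A x y / 2) ∈ 𝓝[>] (0 : ℝ) :=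
    mem_nhdsWithin_of_mem_nhds (Iio_mem_nhds (by linarith))
  filter_upwards [this, self_mem_nhdsWithin] with ε h1 h2
  refine eta_one ?_
  rw [le_div_iff₀ h2]
  have : ε < qq A x y / 2 := h1
  linarith

namespace KC
variable {A : AlphaForm n} {z0 : Cn n} {ρ ρ' Γ T : ℝ} (P : KC A z0 ρ ρ' Γ T)
include P

theorem tendsto_HHkk (lam : ℝ) {x : Cn n} {w : Cn n → ℝ}
    (hw : Integrable (fun y => w y * kk A lam T x y)) :
    Tendsto (fun ε => ∫ y, w y * (HH A ε x y * kk A lam T x y)) (𝓝[>] 0)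
      (𝓝 (∫ y, w y * kk A lam T x y)) := by
  refine tendsto_integral_filter_of_dominated_convergence (fun y => ‖w y * kk A lam T x y‖)
    ?_ ?_ hw.norm ?_
  · refine Eventually.of_forall fun ε => ?_
    have h1 : Continuous (HH A ε x) := (HH_continuous A ε).comp (Continuous.prodMk_right x)
    have := h1.aestronglyMeasurable (μ := volume) |>.mul hw.aestronglyMeasurable
    refine this.congr (Eventually.of_forall fun y => ?_)
    simp only [Pi.mul_apply]; ring
  · refine Eventually.of_forall fun ε => Eventually.of_forall fun y => ?_
    have e : w y * (HH A ε x y * kk A lam T x y) = HH A ε x y * (w y * kk A lam T x y) := by ring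
    rw [e, norm_mul, Real.norm_of_nonneg (HH_nonneg A ε x y)]
    exact mul_le_of_le_one_left (norm_nonneg _) (HH_le_one A ε x y)
  · refine Eventually.of_forall fun y => ?_
    by_cases hy : y = x
    · subst hy
      simp [P.kk_diag]
    · refine Tendsto.congr' (f₁ := fun _ => w y * kk A lam T x y) ?_ tendsto_const_nhds
      filter_upwards [HH_eventually_one A hy] with ε hε
      rw [hε, one_mul]

theorem tendsto_ME (lam : ℝ) {x : Cn n} (hx : x ∈ closedBall z0 ρ') :
    Tendsto (fun ε => ∫ y, ME A lam T ε x y) (𝓝[>] 0) (𝓝 (cc A lam T x)) := by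
  have h := P.tendsto_HHkk lam (x := x) (w := fun _ => 1) (by simpa using P.kk_integrable lam hx)
  simp only [one_mul] at h
  refine h.congr' ?_
  filter_upwards [self_mem_nhdsWithin] with ε hε
  rw [P.integral_ME lam hε hx]

theorem kk_ge {x y : Cn n} (hx : x ∈ closedBall z0 ρ') (hyx : y ≠ x)
    (h : ‖y - x‖ ≤ √(T / (2 * Γ))) : Real.exp (-Lam n Γ) ≤ kk A (Lam n Γ) T x y := by
  have hΓ := P.Γpos
  have hT := P.hT
  have hq := qq_pos A hyx
  have hq2 : qq A x y ≤ T / 2 := by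
    refine (P.geo.upper x (P.mem_of_center hx) y).trans ?_
    have h1 : ‖y - x‖ ^ 2 ≤ T / (2 * Γ) := by
      rw [← Real.sq_sqrt (show 0 ≤ T / (2 * Γ) by positivity)]
      gcongr
    calc Γ * ‖y - x‖ ^ 2 ≤ Γ * (T / (2 * Γ)) := by gcongr
      _ = T / 2 := by field_simp
  have h1 := P.toKP.kk_lower (P.mem_of_center hx) (P.mem_of_qq hx (by linarith)) hq (by linarith)
  refine le_trans ?_ h1
  have h2 := P.le_phi (Lam n Γ) hq hq2
  rw [abs_of_nonneg (Lam_nonneg hΓ.le)] at h2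
  have h3 : qq A x y ^ n ≤ √(qq A x y) := by
    have h4 : qq A x y ≤ 1 := by linarith [P.hT1]
    have h5 := P.sqrt_le_one (t := qq A x y) (by linarith)
    have h6 := Real.mul_self_sqrt hq.le
    have h7 := Real.sqrt_nonneg (qq A x y)
    calc qq A x y ^ n ≤ qq A x y ^ 1 := pow_le_pow_of_le_one hq.le h4 P.hn
      _ ≤ _ := by rw [pow_one]; nlinarith
  calc Real.exp (-Lam n Γ) ≤ Real.exp (-Lam n Γ) / qq A x y ^ n * √(qq A x y) := by
        rw [div_mul_eq_mul_div, le_div_iff₀ (by positivity)]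
        gcongr
    _ ≤ _ := mul_le_mul_of_nonneg_right h2 (Real.sqrt_nonneg _)

theorem s0pos : 0 < √(T / (2 * Γ)) := by
  have hΓ := P.Γpos
  have hT := P.hT
  positivity

theorem cc_lower : ∃ c, 0 < c ∧ ∀ x ∈ closedBall z0 ρ', c ≤ cc A (Lam n Γ) T x := by
  set s := √(T / (2 * Γ)) with hs
  have hs0 : 0 < s := P.s0pos
  refine ⟨Real.exp (-Lam n Γ) * (volume (closedBall (0 : Cn n) s)).toReal, ?_, fun x hx => ?_⟩
  · refine mul_pos (Real.exp_pos _) (ENNReal.toReal_pos ?_ measure_closedBall_lt_top.ne)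
    exact (measure_closedBall_pos volume _ hs0).ne'
  · have hk := P.kk_integrable (Lam n Γ) hx
    have h1 : ∫ y in closedBall x s, kk A (Lam n Γ) T x y ≤ cc A (Lam n Γ) T x :=
      setIntegral_le_integral hk (Eventually.of_forall fun y => P.kk_pos hx y)
    refine le_trans ?_ h1
    have e : volume (closedBall (0 : Cn n) s) = volume (closedBall x s) := by
      exact (Measure.addHaar_closedBall_center volume x s).symm
    have hI : ∫ y in closedBall x s, Real.exp (-Lam n Γ) =
        Real.exp (-Lam n Γ) * (volume (closedBall (0 : Cn n) s)).toReal := by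
      rw [setIntegral_const, e, smul_eq_mul, mul_comm]; rfl
    rw [← hI]
    have : Nonempty (Fin n) := ⟨⟨0, P.hn⟩⟩
    refine setIntegral_mono_on_ae (integrableOn_const (measure_closedBall_lt_top.ne))
      hk.integrableOn measurableSet_closedBall ?_
    have : ∀ᵐ y : Cn n, y ≠ x := by
      rw [ae_iff]; simp
    filter_upwards [this] with y hy hys
    refine P.kk_ge hx hy ?_
    rwa [mem_closedBall, dist_eq_norm] at hys

theorem cc_upper (lam : ℝ) : ∃ C, 0 < C ∧ ∀ x ∈ closedBall z0 ρ', cc A lam T x ≤ C := by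
  obtain ⟨C, hC, h⟩ := P.kk_le lam
  have hN : 0 ≤ ∫ h, NN n (√(Γ * T)) h := integral_nonneg fun h => NN_nonneg _ h
  refine ⟨C * (∫ h, NN n (√(Γ * T)) h) + 1, by positivity, fun x hx => ?_⟩
  have h1 : cc A lam T x ≤ ∫ y, C * NN n (√(Γ * T)) (y - x) := by
    refine integral_mono (P.kk_integrable lam hx)
      (((NN_integrable P.hn (√(Γ * T))).comp_sub_right x).const_mul C) fun y => ?_
    exact (le_abs_self _).trans (h x hx y)
  rw [integral_const_mul, integral_NN_sub] at h1
  linarith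

theorem cc_minus {x : Cn n} (hx : x ∈ closedBall z0 ρ') :
    cc A (Lam n Γ) T x ≤ cc A (-Lam n Γ) T x := by
  refine le_of_tendsto_of_tendsto (P.tendsto_ME _ hx) (P.tendsto_ME _ hx) ?_
  filter_upwards [self_mem_nhdsWithin] with ε hε
  refine integral_mono (P.ME_integrable _ hε hx) (P.ME_integrable _ hε hx) fun y => ?_
  have h1 := eta_deriv_nonneg (qq A x y / ε)
  have h2 := EE_nonneg A x y
  have h3 : phi n (Lam n Γ) T (qq A x y) ≤ phi n (-Lam n Γ) T (qq A x y) := by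
    unfold phi
    have hq := qq_nonneg A x y
    have hL := Lam_nonneg (n := n) P.Γpos.le
    have h4 : Real.exp (-Lam n Γ * √(qq A x y)) ≤ Real.exp (- -Lam n Γ * √(qq A x y)) := by
      refine Real.exp_le_exp.2 ?_
      have := Real.sqrt_nonneg (qq A x y)
      nlinarith
    have h5 := chi_nonneg (T := T) (qq A x y)
    gcongr
  have hε' : 0 < ε := hε
  unfold ME
  gcongr

theorem kk_L1 (lam : ℝ) {x : Cn n} (hx : x ∈ closedBall z0 ρ') :
    Tendsto (fun x' => ∫ y, |kk A lam T x' y - kk A lam T x y|) (𝓝[closedBall z0 ρ'] x)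
      (𝓝 0) := by
  obtain ⟨C, hC, hk⟩ := P.toKP.kk_abs lam
  have hΓ := P.Γpos
  rw [Metric.tendsto_nhds]
  intro e he
  -- small radius
  have h1 : ∀ᶠ r in 𝓝[>] (0 : ℝ), ∫ h, NN n r h < e / (4 * C) :=
    (NN_tendsto P.hn).eventually (gt_mem_nhds (by positivity))
  obtain ⟨r, hr, hr0⟩ := (h1.and self_mem_nhdsWithin).exists
  have hr0 : 0 < r := hr0
  set ε := r ^ 2 / (2 * Γ) with hε
  have hε0 : 0 < ε := by positivity
  have hεr : √(Γ * (2 * ε)) = r := by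
    rw [hε, show Γ * (2 * (r ^ 2 / (2 * Γ))) = r ^ 2 by field_simp, Real.sqrt_sq hr0.le]
  have htail : ∀ x ∈ closedBall z0 ρ', ∀ y,
      |kk A lam T x y - HH A ε x y * kk A lam T x y| ≤ C * NN n r (y - x) := by
    intro x hx y
    have hNN := NN_nonneg r (y - x)
    by_cases hq : 2 * ε ≤ qq A x y
    · have : HH A ε x y = 1 := eta_one (by rwa [le_div_iff₀ hε0])
      rw [this, one_mul, sub_self, abs_zero]; positivity
    by_cases hqT : T ≤ qq A x y
    · rw [P.kk_zero_of_le lam hqT]; simp; positivity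
    push Not at hq hqT
    have e1 : kk A lam T x y - HH A ε x y * kk A lam T x y = (1 - HH A ε x y) * kk A lam T x y := by
      ring
    have h2 := HH_nonneg A ε x y
    have h3 := HH_le_one A ε x y
    have h4 := P.toKP.norm_le_of_qq (P.mem_of_center hx) hq.le
    rw [hεr] at h4
    rw [e1, abs_mul, abs_of_nonneg (by linarith), NN_of_le h4]
    refine le_trans ?_ (hk x (P.mem_of_center hx) y (P.mem_of_qq hx hqT.le))
    exact mul_le_of_le_one_left (abs_nonneg _) (by linarith)
  -- continuous part
  have hcont : Continuous fun x' => ∫ y in closedBall z0 ρ,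
      |HH A ε x' y * kk A lam T x' y - HH A ε x y * kk A lam T x y| := by
    refine continuous_parametric_integral_of_continuous
      (f := fun x' y => |HH A ε x' y * kk A lam T x' y - HH A ε x y * kk A lam T x y|) ?_
      (isCompact_closedBall z0 ρ)
    have h := HHkk_continuous A lam T hε0
    have h' : Continuous fun p : Cn n × Cn n => HH A ε x p.2 * kk A lam T x p.2 :=
      h.comp (continuous_const.prodMk continuous_snd)
    exact (h.sub h').abs
  have h2 := (hcont.tendsto x).mono_left (nhdsWithin_le_nhds (s := closedBall z0 ρ'))
  simp only [sub_self, abs_zero, integral_zero] at h2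
  filter_upwards [h2.eventually (gt_mem_nhds (half_pos he)), self_mem_nhdsWithin] with x' hx1 hx'
  have hN : ∀ x : Cn n, Integrable fun y => C * NN n r (y - x) :=
    fun x => ((NN_integrable P.hn r).comp_sub_right x).const_mul C
  have hI : Integrable fun y => |HH A ε x' y * kk A lam T x' y - HH A ε x y * kk A lam T x y| :=
    ((P.HHkk_integrable lam ε hx').sub (P.HHkk_integrable lam ε hx)).abs
  have hrestr : ∫ y in closedBall z0 ρ,
      |HH A ε x' y * kk A lam T x' y - HH A ε x y * kk A lam T x y| =
      ∫ y, |HH A ε x' y * kk A lam T x' y - HH A ε x y * kk A lam T x y| := by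
    refine setIntegral_eq_integral_of_forall_compl_eq_zero fun y hy => ?_
    rw [P.kk_zero_out lam hx hy, P.kk_zero_out lam hx' hy]; simp
  rw [hrestr] at hx1
  have h3 : ∫ y, |kk A lam T x' y - kk A lam T x y| ≤
      ∫ y, (|HH A ε x' y * kk A lam T x' y - HH A ε x y * kk A lam T x y| +
        (C * NN n r (y - x') + C * NN n r (y - x))) := by
    refine integral_mono ((P.kk_integrable lam hx').sub (P.kk_integrable lam hx)).abs
      (hI.add ((hN x').add (hN x))) fun y => ?_
    have t1 := abs_le.1 (htail x hx y)
    have t2 := abs_le.1 (htail x' hx' y)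
    have t3 := abs_le.1 (le_refl |HH A ε x' y * kk A lam T x' y - HH A ε x y * kk A lam T x y|)
    dsimp only
    rw [abs_le]
    constructor <;> linarith [t1.1, t1.2, t2.1, t2.2, t3.1, t3.2]
  have hNN2 : Integrable fun y => C * NN n r (y - x') + C * NN n r (y - x) := (hN x').add (hN x)
  rw [integral_add hI hNN2, integral_add (hN x') (hN x), integral_const_mul,
    integral_const_mul, integral_NN_sub, integral_NN_sub] at h3
  have h4 : C * (∫ h, NN n r h) < e / 4 := by
    have := mul_lt_mul_of_pos_left hr hC
    rwa [show C * (e / (4 * C)) = e / 4 by field_simp] at this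
  rw [Real.dist_0_eq_abs, abs_of_nonneg (integral_nonneg fun y => abs_nonneg _)]
  linarith

theorem cc_sub_le (lam : ℝ) {x x' : Cn n} (hx : x ∈ closedBall z0 ρ')
    (hx' : x' ∈ closedBall z0 ρ') :
    |cc A lam T x' - cc A lam T x| ≤ ∫ y, |kk A lam T x' y - kk A lam T x y| := by
  unfold cc
  rw [← integral_sub (P.kk_integrable lam hx') (P.kk_integrable lam hx)]
  exact abs_integral_le_integral_abs

theorem cc_continuousOn (lam : ℝ) : ContinuousOn (cc A lam T) (closedBall z0 ρ') := by
  intro x hx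
  rw [ContinuousWithinAt, tendsto_iff_dist_tendsto_zero]
  refine squeeze_zero' (Eventually.of_forall fun _ => dist_nonneg) ?_ (P.kk_L1 lam hx)
  filter_upwards [self_mem_nhdsWithin] with x' hx'
  exact P.cc_sub_le lam hx hx'

theorem repr_int (lam : ℝ) {w : Cn n → ℝ} (hw : Integrable w) :
    ∀ᵐ x : Cn n, x ∈ closedBall z0 ρ' → Integrable (fun y => w y * kk A lam T x y) := by
  obtain ⟨C, hC, h⟩ := P.kk_le lam
  have := Integrable.ae_convolution_exists (L := ContinuousLinearMap.mul ℝ ℝ) hw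
    (NN_integrable P.hn (√(Γ * T)))
  filter_upwards [this] with x hx hxB
  have hx2 : Integrable fun y => w y * NN n (√(Γ * T)) (x - y) := hx
  refine Integrable.mono' (hx2.norm.const_mul C) ?_ ?_
  · exact hw.aestronglyMeasurable.mul
      ((kk_measurable A lam T).comp measurable_prodMk_left).aestronglyMeasurable
  · refine Eventually.of_forall fun y => ?_
    have e : NN n (√(Γ * T)) (x - y) = NN n (√(Γ * T)) (y - x) := by
      unfold NN; simp only [Set.indicator, mem_closedBall, dist_zero_right, norm_sub_rev]
    rw [norm_mul, norm_mul, e, Real.norm_of_nonneg (NN_nonneg _ _)]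
    have := h x hxB y
    rw [← Real.norm_eq_abs] at this
    calc _ ≤ ‖w y‖ * (C * NN n (√(Γ * T)) (y - x)) := by gcongr
      _ = _ := by ring

theorem repr_leb (lam : ℝ) {w : Cn n → ℝ} (hw : Integrable w) :
    ∀ᵐ x : Cn n, x ∈ closedBall z0 ρ' →
      Tendsto (fun ε => ∫ y, w y * ME A lam T ε x y) (𝓝[>] 0) (𝓝 (cc A lam T x * w x)) := by
  obtain ⟨C, hC, hM⟩ := P.toKP.ME_bound lam
  have hΓ := P.Γpos
  filter_upwards [IsUnifLocDoublingMeasure.ae_tendsto_average_norm_sub volume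
    hw.locallyIntegrable 1] with x hL hx
  have hs : Tendsto (fun ε : ℝ => √(Γ * (2 * ε))) (𝓝[>] 0) (𝓝[>] 0) := by
    refine tendsto_nhdsWithin_iff.2 ⟨?_, ?_⟩
    · have : Continuous fun ε : ℝ => √(Γ * (2 * ε)) := by fun_prop
      have := this.tendsto 0
      simp only [mul_zero, Real.sqrt_zero] at this
      exact this.mono_left nhdsWithin_le_nhds
    · filter_upwards [self_mem_nhdsWithin] with ε hε
      have : 0 < ε := hε
      exact Real.sqrt_pos.2 (by positivity)
  have hL' := hL (fun _ : ℝ => x) (fun ε : ℝ => √(Γ * (2 * ε))) hs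
    (by
      filter_upwards with ε
      simp [Real.sqrt_nonneg])
  set v1 := volume.real (ball (0 : Cn n) 1) with hv1
  have h1 : Tendsto (fun ε => ∫ y, (w y - w x) * ME A lam T ε x y) (𝓝[>] 0) (𝓝 0) := by
    have h2 := hL'.const_mul (C * ((2 * Γ) ^ n * v1))
    rw [mul_zero] at h2
    refine squeeze_zero_norm' ?_ h2
    filter_upwards [self_mem_nhdsWithin] with ε hε
    have hε : 0 < ε := hε
    set s := √(Γ * (2 * ε)) with hs
    have hMz : ∀ y, y ∉ closedBall x s → ME A lam T ε x y = 0 := by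
      intro y hy
      by_contra h
      apply hy
      rw [mem_closedBall, dist_eq_norm]
      exact P.toKP.norm_le_of_qq (P.mem_of_center hx) (P.qq_lt_of_ME_ne hε h).2.1.le
    have hMb : ∀ y, ME A lam T ε x y ≤ C / ε ^ n := by
      intro y
      by_cases hy : y ∈ closedBall z0 ρ
      · exact hM ε hε x (P.mem_of_center hx) y hy
      · rw [P.ME_zero_out lam hε hx hy]; positivity
    have e1 : ∫ y, (w y - w x) * ME A lam T ε x y =
        ∫ y in closedBall x s, (w y - w x) * ME A lam T ε x y :=
      (setIntegral_eq_integral_of_forall_compl_eq_zero fun y hy => by rw [hMz y hy, mul_zero]).symm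
    rw [e1]
    have hI : IntegrableOn (fun y => ‖w y - w x‖) (closedBall x s) :=
      (hw.integrableOn.sub (integrableOn_const measure_closedBall_lt_top.ne)).norm
    have h3 : ‖∫ y in closedBall x s, (w y - w x) * ME A lam T ε x y‖ ≤
        ∫ y in closedBall x s, C / ε ^ n * ‖w y - w x‖ := by
      refine norm_integral_le_of_norm_le (hI.const_mul _) (Eventually.of_forall fun y => ?_)
      rw [norm_mul, Real.norm_of_nonneg (ME_nonneg A lam T hε x y), mul_comm]
      exact mul_le_mul_of_nonneg_right (hMb y) (norm_nonneg _)
    refine h3.trans (le_of_eq ?_)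
    rw [integral_const_mul, setAverage_eq, smul_eq_mul]
    have hvol : volume.real (closedBall x s) = (2 * Γ * ε) ^ n * v1 := by
      rw [Measure.addHaar_real_closedBall _ _ (Real.sqrt_nonneg _), finrank_Cn, pow_mul,
        Real.sq_sqrt (by positivity)]
      congr 2; ring
    have hv1p : 0 < v1 := by
      rw [hv1]
      exact ENNReal.toReal_pos (measure_ball_pos volume _ one_pos).ne' measure_ball_lt_top.ne
    rw [hvol, mul_pow (2 * Γ) ε]
    field_simp
  have h2 := h1.add ((P.tendsto_ME lam hx).const_mul (w x))
  rw [zero_add, mul_comm] at h2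
  refine h2.congr' ?_
  filter_upwards [self_mem_nhdsWithin] with ε hε
  have hMi := P.ME_integrable lam hε hx
  have hwM : Integrable fun y => w y * ME A lam T ε x y := by
    have hb := hM ε hε
    refine hw.mul_bdd (c := C / ε ^ n) ?_ ?_
    · exact hMi.aestronglyMeasurable
    · have hε : 0 < ε := hε
      refine Eventually.of_forall fun y => ?_
      rw [Real.norm_of_nonneg (ME_nonneg A lam T hε x y)]
      by_cases hy : y ∈ closedBall z0 ρ
      · exact hM ε hε x (P.mem_of_center hx) y hy
      · rw [P.ME_zero_out lam hε hx hy]; positivity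
  simp only [sub_mul]
  rw [integral_sub hwM (hMi.const_mul _), integral_const_mul]
  ring

end KC

end AlphaAux

open scoped ComplexOrder
namespace AlphaAux
variable {n : ℕ}

/-- test functions -/
structure TF (D : Set (Cn n)) (φ : Cn n → ℝ) : Prop where
  smooth : ContDiff ℝ (⊤ : ℕ∞) φ
  hcs : HasCompactSupport φ
  sub : tsupport φ ⊆ D

theorem TF.c2 {D : Set (Cn n)} {φ : Cn n → ℝ} (h : TF D φ) : ContDiff ℝ 2 φ :=
  h.smooth.of_le (by norm_cast)

/-- distributional subsolutions -/
def Sub (A : AlphaForm n) (D : Set (Cn n)) (w : Cn n → ℝ) : Prop :=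
  LocallyIntegrableOn w D ∧ ∀ φ, TF D φ → (∀ z, 0 ≤ φ z) → 0 ≤ ∫ z, w z * alphaOpR A φ z

/-- distributional solutions -/
def Har (A : AlphaForm n) (D : Set (Cn n)) (w : Cn n → ℝ) : Prop :=
  ∀ φ, TF D φ → ∫ z, w z * alphaOpR A φ z = 0

theorem integral_D (A : AlphaForm n) {D : Set (Cn n)} {φ : Cn n → ℝ} (h : TF D φ)
    (w : Cn n → ℝ) : ∫ z in D, w z * alphaOpR A φ z = ∫ z, w z * alphaOpR A φ z := by
  refine setIntegral_eq_integral_of_forall_compl_eq_zero fun z hz => ?_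
  rw [opR_eq_zero A φ fun h' => hz (h.sub h'), mul_zero]

theorem integrable_mul_supp {w f : Cn n → ℝ} {K : Set (Cn n)} (hK : IsCompact K)
    (hw : IntegrableOn w K) (hf : Continuous f) (h0 : ∀ z ∉ K, f z = 0) :
    Integrable (fun z => w z * f z) := by
  have h1 : IntegrableOn (fun z => w z * f z) K := hw.mul_continuousOn hf.continuousOn hK
  rwa [integrableOn_iff_integrable_of_support_subset] at h1
  intro z hz
  by_contra h
  exact hz (by simp [h0 z h])

theorem TF.integrable (A : AlphaForm n) {D : Set (Cn n)} {φ w : Cn n → ℝ} (h : TF D φ)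
    (hw : LocallyIntegrableOn w D) : Integrable (fun z => w z * alphaOpR A φ z) :=
  integrable_mul_supp h.hcs (hw.integrableOn_compact_subset h.sub h.hcs)
    (continuous_opR A h.c2) fun z hz => opR_eq_zero A φ hz

namespace KC
variable {A : AlphaForm n} {z0 : Cn n} {ρ ρ' Γ T : ℝ} (P : KC A z0 ρ ρ' Γ T)
include P

theorem gg_TF {D : Set (Cn n)} (hD : closedBall z0 ρ ⊆ D) (lam : ℝ) {ε : ℝ} (hε : 0 < ε)
    {x : Cn n} (hx : x ∈ closedBall z0 ρ') : TF D (gg A lam T ε x) :=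
  ⟨gg_contDiff A lam hε x, P.gg_hcs lam ε hx,
    (P.gg_tsupport lam ε hx).trans ((P.ball_sub hx).trans hD)⟩

theorem wME_integrable {w : Cn n → ℝ} (hw : IntegrableOn w (closedBall z0 ρ)) (lam : ℝ) {ε : ℝ}
    (hε : 0 < ε) {x : Cn n} (hx : x ∈ closedBall z0 ρ') :
    Integrable fun y => w y * ME A lam T ε x y :=
  integrable_mul_supp (isCompact_closedBall z0 ρ) hw
    ((ME_continuous A lam T hε).comp (Continuous.prodMk_right x))
    fun _ hy => P.ME_zero_out lam hε hx hy

theorem wHHkk_integrable {w : Cn n → ℝ} (hw : IntegrableOn w (closedBall z0 ρ)) (lam : ℝ) {ε : ℝ}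
    (hε : 0 < ε) {x : Cn n} (hx : x ∈ closedBall z0 ρ') :
    Integrable fun y => w y * (HH A ε x y * kk A lam T x y) :=
  integrable_mul_supp (isCompact_closedBall z0 ρ) hw
    ((HHkk_continuous A lam T hε).comp (Continuous.prodMk_right x))
    fun _ hy => by rw [P.kk_zero_out lam hx hy, mul_zero]

theorem int_opgg {w : Cn n → ℝ} (hw : IntegrableOn w (closedBall z0 ρ)) (lam : ℝ) {ε : ℝ}
    (hε : 0 < ε) {x : Cn n} (hx : x ∈ closedBall z0 ρ') :
    ∫ y, w y * alphaOpR A (gg A lam T ε x) y =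
      (∫ y, w y * (HH A ε x y * kk A lam T x y)) - ∫ y, w y * ME A lam T ε x y := by
  rw [← integral_sub (P.wHHkk_integrable hw lam hε hx) (P.wME_integrable hw lam hε hx)]
  refine integral_congr_ae (Eventually.of_forall fun y => ?_)
  simp only [opR_gg A lam hε]
  ring

theorem indic (lam ε : ℝ) (w : Cn n → ℝ) {x : Cn n} (hx : x ∈ closedBall z0 ρ') (hε : 0 < ε) :
    (fun y => (closedBall z0 ρ).indicator w y * ME A lam T ε x y) =
      (fun y => w y * ME A lam T ε x y) := by
  funext y
  by_cases hy : y ∈ closedBall z0 ρ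
  · rw [Set.indicator_of_mem hy]
  · rw [P.ME_zero_out lam hε hx hy]; simp

theorem indic2 (lam : ℝ) (w : Cn n → ℝ) {x : Cn n} (hx : x ∈ closedBall z0 ρ') :
    (fun y => (closedBall z0 ρ).indicator w y * kk A lam T x y) =
      (fun y => w y * kk A lam T x y) := by
  funext y
  by_cases hy : y ∈ closedBall z0 ρ
  · rw [Set.indicator_of_mem hy]
  · rw [P.kk_zero_out lam hx hy]; simp

theorem rep_all (lam : ℝ) {w : Cn n → ℝ} (hw : IntegrableOn w (closedBall z0 ρ)) :
    ∀ᵐ x : Cn n, x ∈ closedBall z0 ρ' → Integrable (fun y => w y * kk A lam T x y) ∧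
      Tendsto (fun ε => ∫ y, w y * (HH A ε x y * kk A lam T x y)) (𝓝[>] 0)
        (𝓝 (∫ y, w y * kk A lam T x y)) ∧
      Tendsto (fun ε => ∫ y, w y * ME A lam T ε x y) (𝓝[>] 0) (𝓝 (cc A lam T x * w x)) := by
  have hw1 : Integrable ((closedBall z0 ρ).indicator w) :=
    hw.integrable_indicator measurableSet_closedBall
  filter_upwards [P.repr_int lam hw1, P.repr_leb lam hw1] with x h1 h2 hx
  have h1' := h1 hx
  rw [P.indic2 lam w hx] at h1'
  refine ⟨h1', P.tendsto_HHkk lam h1', ?_⟩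
  have h2' := h2 hx
  rw [Set.indicator_of_mem (P.mem_of_center hx)] at h2'
  refine h2'.congr' ?_
  filter_upwards [self_mem_nhdsWithin] with ε hε
  rw [P.indic lam ε w hx hε]

theorem sub_ineq {D : Set (Cn n)} (hD : closedBall z0 ρ ⊆ D) {w : Cn n → ℝ} (hw : Sub A D w)
    (lam : ℝ) {ε : ℝ} (hε : 0 < ε) {x : Cn n} (hx : x ∈ closedBall z0 ρ') :
    ∫ y, w y * ME A lam T ε x y ≤ ∫ y, w y * (HH A ε x y * kk A lam T x y) := by
  have h1 := hw.2 _ (P.gg_TF hD lam hε hx) (gg_nonneg A lam P.hT hε x)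
  rw [P.int_opgg (hw.1.integrableOn_compact_subset hD (isCompact_closedBall _ _)) lam hε hx] at h1
  linarith

theorem sub_rep {D : Set (Cn n)} (hD : closedBall z0 ρ ⊆ D) {w : Cn n → ℝ} (hw : Sub A D w)
    (lam : ℝ) : ∀ᵐ x : Cn n, x ∈ closedBall z0 ρ' →
      Integrable (fun y => w y * kk A lam T x y) ∧
      cc A lam T x * w x ≤ ∫ y, w y * kk A lam T x y := by
  filter_upwards [P.rep_all lam (hw.1.integrableOn_compact_subset hD (isCompact_closedBall _ _))]
    with x h hx
  obtain ⟨h1, h2, h3⟩ := h hx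
  refine ⟨h1, le_of_tendsto_of_tendsto h3 h2 ?_⟩
  filter_upwards [self_mem_nhdsWithin] with ε hε
  exact P.sub_ineq hD hw lam hε hx

theorem har_rep {D : Set (Cn n)} (hD : closedBall z0 ρ ⊆ D) {w : Cn n → ℝ}
    (hwi : IntegrableOn w (closedBall z0 ρ)) (hw : Har A D w)
    (lam : ℝ) : ∀ᵐ x : Cn n, x ∈ closedBall z0 ρ' →
      Integrable (fun y => w y * kk A lam T x y) ∧
      cc A lam T x * w x = ∫ y, w y * kk A lam T x y := by
  filter_upwards [P.rep_all lam hwi] with x h hx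
  obtain ⟨h1, h2, h3⟩ := h hx
  refine ⟨h1, tendsto_nhds_unique h3 (h2.congr' ?_)⟩
  filter_upwards [self_mem_nhdsWithin] with ε hε
  have h4 := hw _ (P.gg_TF hD lam hε hx)
  rw [P.int_opgg hwi lam hε hx] at h4
  linarith

theorem psi_anti {D : Set (Cn n)} (hD : closedBall z0 ρ ⊆ D) {w : Cn n → ℝ} (hw : Sub A D w)
    (hw0 : ∀ᵐ x, x ∈ D → w x ≤ 0) {ε ε' : ℝ} (hε' : 0 < ε') (h : ε' ≤ ε) {x : Cn n}
    (hx : x ∈ closedBall z0 ρ') :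
    ∫ y, w y * ME A (Lam n Γ) T ε' x y ≤ ∫ y, w y * ME A (Lam n Γ) T ε x y := by
  have hε : 0 < ε := hε'.trans_le h
  set lam := Lam n Γ with hlam
  have hwi := hw.1.integrableOn_compact_subset hD (isCompact_closedBall z0 ρ)
  have hg1 := P.gg_TF hD lam hε hx
  have hg2 := P.gg_TF hD lam hε' hx
  have hTF : TF D (fun y => gg A lam T ε' x y - gg A lam T ε x y) := by
    refine ⟨hg2.smooth.sub hg1.smooth, hg2.hcs.sub hg1.hcs, ?_⟩
    exact (tsupport_sub _ _).trans (Set.union_subset hg2.sub hg1.sub)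
  have h1 := hw.2 _ hTF fun y => sub_nonneg.2 (gg_anti A lam P.hT hε' h x y)
  have e : ∀ y, w y * alphaOpR A (fun y => gg A lam T ε' x y - gg A lam T ε x y) y =
      w y * alphaOpR A (gg A lam T ε' x) y - w y * alphaOpR A (gg A lam T ε x) y := by
    intro y; rw [opR_sub A hg2.c2 hg1.c2]; ring
  simp only [e] at h1
  rw [integral_sub (hg2.integrable A hw.1) (hg1.integrable A hw.1),
    P.int_opgg hwi lam hε hx, P.int_opgg hwi lam hε' hx] at h1
  have h2 : ∫ y, w y * (HH A ε' x y * kk A lam T x y) ≤ ∫ y, w y * (HH A ε x y * kk A lam T x y) := by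
    refine integral_mono_ae (P.wHHkk_integrable hwi lam hε' hx)
      (P.wHHkk_integrable hwi lam hε hx) ?_
    filter_upwards [hw0] with y hy
    by_cases hyB : y ∈ closedBall z0 ρ
    · have h3 := hy (hD hyB)
      have h4 := mul_le_mul_of_nonneg_right (HH_anti A hε' h x y) (P.kk_pos hx y)
      exact mul_le_mul_of_nonpos_left h4 h3
    · simp [P.kk_zero_out lam hx hyB]
  linarith

theorem psi_cont {w : Cn n → ℝ} (hwi : IntegrableOn w (closedBall z0 ρ)) (lam : ℝ) {ε : ℝ}
    (hε : 0 < ε) : ContinuousOn (fun x => ∫ y, w y * ME A lam T ε x y) (closedBall z0 ρ') := by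
  obtain ⟨C, hC, hM⟩ := P.toKP.ME_bound lam
  have hw1 : Integrable ((closedBall z0 ρ).indicator w) :=
    hwi.integrable_indicator measurableSet_closedBall
  refine continuousOn_of_dominated (bound := fun y => ‖(closedBall z0 ρ).indicator w y‖ * (C / ε ^ n))
    ?_ ?_ (hw1.norm.mul_const _) ?_
  · intro x hx
    exact (P.wME_integrable hwi lam hε hx).aestronglyMeasurable
  · intro x hx
    refine Eventually.of_forall fun y => ?_
    rw [norm_mul, Real.norm_of_nonneg (ME_nonneg A lam T hε x y)]
    by_cases hy : y ∈ closedBall z0 ρ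
    · rw [Set.indicator_of_mem hy]
      exact mul_le_mul_of_nonneg_left (hM ε hε x (P.mem_of_center hx) y hy) (norm_nonneg _)
    · rw [P.ME_zero_out lam hε hx hy, mul_zero]; positivity
  · refine Eventually.of_forall fun y => ?_
    have h1 : Continuous fun x => ME A lam T ε x y :=
      (ME_continuous A lam T hε).comp (Continuous.prodMk_left y)
    exact (continuous_const.mul h1).continuousOn

/-- local version: upper semicontinuity almost everywhere -/
theorem usc_loc {D : Set (Cn n)} (hD : closedBall z0 ρ ⊆ D) {w : Cn n → ℝ} (hw : Sub A D w)
    (hw0 : ∀ᵐ x, x ∈ D → w x ≤ 0) : ∀ᵐ x : Cn n, x ∈ ball z0 ρ' →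
      ∀ b, w x < b → ∀ᶠ y in 𝓝 x ⊓ ae volume, w y < b := by
  have hwi := hw.1.integrableOn_compact_subset hD (isCompact_closedBall z0 ρ)
  obtain ⟨c0, hc0, hc⟩ := P.cc_lower
  have hle : ∀ᵐ x : Cn n, x ∈ closedBall z0 ρ' → ∀ ε, 0 < ε →
      cc A (Lam n Γ) T x * w x ≤ ∫ y, w y * ME A (Lam n Γ) T ε x y := by
    filter_upwards [P.rep_all (Lam n Γ) hwi] with x h hx ε hε
    refine le_of_tendsto (h hx).2.2 ?_
    have : Set.Iio ε ∈ 𝓝[>] (0 : ℝ) := mem_nhdsWithin_of_mem_nhds (Iio_mem_nhds hε)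
    filter_upwards [this, self_mem_nhdsWithin] with ε' h1 h2
    exact P.psi_anti hD hw hw0 h2 (le_of_lt h1) hx
  filter_upwards [P.rep_all (Lam n Γ) hwi] with x h hx b hb
  have hx' := ball_subset_closedBall hx
  have hcx : 0 < cc A (Lam n Γ) T x := hc0.trans_le (hc x hx')
  obtain ⟨m, hm1, hm2⟩ := exists_between (mul_lt_mul_of_pos_left hb hcx)
  obtain ⟨ε, hε1, hε⟩ :=
    (((h hx').2.2.eventually (gt_mem_nhds hm1)).and self_mem_nhdsWithin).exists
  have hnb : closedBall z0 ρ' ∈ 𝓝 x := mem_of_superset (isOpen_ball.mem_nhds hx) ball_subset_closedBall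
  have hc1 := ((P.psi_cont hwi (Lam n Γ) hε).continuousAt hnb).eventually (gt_mem_nhds hε1)
  have hc2 := (((P.cc_continuousOn (Lam n Γ)).continuousAt hnb).mul_const b).eventually
    (lt_mem_nhds hm2)
  have h3 : ∀ᶠ y in 𝓝 x ⊓ ae volume, _ := (hc1.and (hc2.and hnb)).filter_mono inf_le_left
  have h4 : ∀ᶠ y in 𝓝 x ⊓ ae volume, _ := Eventually.filter_mono inf_le_right hle
  filter_upwards [h3, h4] with y hy1 hy2
  have h5 := hy2 hy1.2.2 ε hε
  have hcy : 0 < cc A (Lam n Γ) T y := hc0.trans_le (hc y hy1.2.2)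
  exact lt_of_mul_lt_mul_left (h5.trans_lt (hy1.1.trans hy1.2.1)) hcy.le

end KC

/-- existence of admissible kernels -/
theorem exists_KC (hn : 1 ≤ n) (A : AlphaForm n) (z0 : Cn n) {ρ : ℝ} :
    ∃ Γ, ∀ ρ' < ρ, ∃ T0 > 0, ∀ T, 0 < T → T ≤ T0 → KC A z0 ρ ρ' Γ T := by
  obtain ⟨Γ, hΓ⟩ := exists_geo A z0 ρ
  refine ⟨Γ, fun ρ' h => ?_⟩
  have hΓ1 := hΓ.one_le
  have hΓ0 : 0 < Γ := by linarith
  have h1 : ∀ᶠ T in 𝓝[>] (0 : ℝ), T < 1 ∧ Γ * √T < 1 / 2 ∧ √(Γ * T) < ρ - ρ' := by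
    have a1 : Tendsto (fun T : ℝ => T) (𝓝[>] 0) (𝓝 0) := tendsto_id.mono_left nhdsWithin_le_nhds
    have a2 : Tendsto (fun T : ℝ => Γ * √T) (𝓝[>] 0) (𝓝 (Γ * √0)) :=
      (Continuous.tendsto (by fun_prop) 0).mono_left nhdsWithin_le_nhds
    have a3 : Tendsto (fun T : ℝ => √(Γ * T)) (𝓝[>] 0) (𝓝 (√(Γ * 0))) :=
      (Continuous.tendsto (by fun_prop) 0).mono_left nhdsWithin_le_nhds
    refine (a1.eventually (gt_mem_nhds one_pos)).and ((a2.eventually (gt_mem_nhds ?_)).and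
      (a3.eventually (gt_mem_nhds ?_)))
    · simp
    · simp; linarith
  obtain ⟨T0, ⟨h2, h3, h4⟩, h5⟩ := (h1.and self_mem_nhdsWithin).exists
  refine ⟨T0, h5, fun T hT hTT => ?_⟩
  refine { hn := hn, geo := hΓ, hT := hT, hT1 := by linarith, small := ?_, hr := ?_ }
  · have := mul_le_mul_of_nonneg_left (Real.sqrt_le_sqrt hTT) hΓ0.le
    linarith
  · have := Real.sqrt_le_sqrt (mul_le_mul_of_nonneg_left hTT hΓ0.le)
    linarith

/-- essential limsup -/
noncomputable def el (w : Cn n → ℝ) (x : Cn n) : EReal :=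
  limsup (fun y => (w y : EReal)) (𝓝 x ⊓ ae volume)

instance neBot_el (x : Cn n) : (𝓝 x ⊓ ae (volume : Measure (Cn n))).NeBot := by
  rw [inf_neBot_iff]
  intro s hs t ht
  by_contra h
  rw [Set.not_nonempty_iff_eq_empty] at h
  have h1 : s ⊆ tᶜ := Set.disjoint_left.1 (Set.disjoint_iff_inter_eq_empty.2 h)
  have h2 : volume s = 0 := measure_mono_null h1 ht
  exact (Measure.measure_pos_of_mem_nhds volume hs).ne' h2

theorem eventually_el {x : Cn n} {p : Cn n → Prop} :
    (∀ᶠ y in 𝓝 x ⊓ ae (volume : Measure (Cn n)), p y) ↔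
      ∃ U, IsOpen U ∧ x ∈ U ∧ ∀ᵐ y, y ∈ U → p y := by
  rw [eventually_inf]
  constructor
  · rintro ⟨s, hs, t, ht, h⟩
    obtain ⟨U, hU, hUo, hx⟩ := _root_.mem_nhds_iff.1 hs
    refine ⟨U, hUo, hx, ?_⟩
    filter_upwards [ht] with y hy hyU
    exact h y ⟨hU hyU, hy⟩
  · rintro ⟨U, hU, hx, h⟩
    exact ⟨U, hU.mem_nhds hx, _, h, fun y hy => hy.2 hy.1⟩

theorem ae_of_local {D : Set (Cn n)} {p : Cn n → Prop}
    (h : ∀ z ∈ D, ∃ U ∈ 𝓝 z, ∀ᵐ x, x ∈ U → p x) : ∀ᵐ x : Cn n, x ∈ D → p x := by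
  rw [ae_iff]
  refine measure_null_of_locally_null _ fun x hx => ?_
  simp only [Classical.not_imp, Set.mem_setOf_eq] at hx
  obtain ⟨U, hU, hp⟩ := h x hx.1
  refine ⟨U ∩ {a | ¬(a ∈ D → p a)}, ?_, ?_⟩
  · rw [Set.inter_comm]
    exact inter_mem_nhdsWithin _ hU
  · refine measure_mono_null ?_ hp
    rintro y ⟨hy1, hy2⟩
    simp only [Classical.not_imp, Set.mem_setOf_eq] at hy2
    simp only [Set.mem_compl_iff, Set.mem_setOf_eq, Classical.not_imp]
    exact ⟨hy1, hy2.2⟩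

theorem le_el (w : Cn n → ℝ) : ∀ᵐ x, (w x : EReal) ≤ el w x := by
  have h : ∀ b : ℚ, ∀ᵐ x, el w x < ((b : ℝ) : EReal) → w x ≤ b := by
    intro b
    refine ae_of_local (D := {x | el w x < ((b : ℝ) : EReal)}) fun z hz => ?_
    have h1 : ∀ᶠ y in 𝓝 z ⊓ ae volume, (w y : EReal) < ((b : ℝ) : EReal) :=
      eventually_lt_of_limsup_lt hz
    obtain ⟨U, hU, hzU, hp⟩ := eventually_el.1 h1
    refine ⟨U, hU.mem_nhds hzU, ?_⟩
    filter_upwards [hp] with x hx hxU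
    exact (EReal.coe_lt_coe_iff.1 (hx hxU)).le
  have h' := ae_all_iff.2 h
  filter_upwards [h'] with x hx
  by_contra hlt
  push Not at hlt
  obtain ⟨b, hb1, hb2⟩ := EReal.exists_rat_btwn_of_lt hlt
  have := hx b hb1
  rw [EReal.coe_lt_coe_iff] at hb2
  linarith

theorem el_usc (w : Cn n → ℝ) : UpperSemicontinuous (el w) := by
  intro x b hb
  obtain ⟨c, hc1, hc2⟩ := exists_between hb
  obtain ⟨U, hU, hxU, hp⟩ := eventually_el.1 (eventually_lt_of_limsup_lt hc1)
  filter_upwards [hU.mem_nhds hxU] with y hy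
  refine lt_of_le_of_lt ?_ hc2
  refine limsup_le_of_le (h := ?_)
  exact eventually_el.2 ⟨U, hU, hy, hp.mono fun z hz hzU => (hz hzU).le⟩

theorem el_eq_ae (hn : 1 ≤ n) {A : AlphaForm n} {D : Set (Cn n)} (hD : IsOpen D) {w : Cn n → ℝ}
    (hw : Sub A D w) (hw0 : ∀ᵐ x, x ∈ D → w x ≤ 0) : ∀ᵐ x : Cn n, x ∈ D → el w x = w x := by
  have h1 : ∀ᵐ x : Cn n, x ∈ D → ∀ b, w x < b → ∀ᶠ y in 𝓝 x ⊓ ae volume, w y < b := by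
    refine ae_of_local fun z hz => ?_
    obtain ⟨ρ, hρ, hρD⟩ := Metric.nhds_basis_closedBall.mem_iff.1 (hD.mem_nhds hz)
    obtain ⟨Γ, h⟩ := exists_KC hn A z (ρ := ρ)
    obtain ⟨T, hT, h⟩ := h (ρ / 2) (by linarith)
    exact ⟨ball z (ρ / 2), ball_mem_nhds z (by linarith),
      (h T hT le_rfl).usc_loc hρD hw hw0⟩
  filter_upwards [h1, le_el w] with x hx1 hx2 hxD
  refine le_antisymm ?_ hx2
  refine le_of_forall_gt fun c hc => ?_
  obtain ⟨b, hb1, hb2⟩ := EReal.lt_iff_exists_real_btwn.1 hc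
  refine lt_of_le_of_lt ?_ hb2
  refine limsup_le_of_le (h := ?_)
  filter_upwards [hx1 hxD b (EReal.coe_lt_coe_iff.1 hb1)] with y hy
  exact_mod_cast hy.le

end AlphaAux

open scoped ComplexOrder
namespace AlphaAux
variable {n : ℕ}

theorem exists_cut {D K : Set (Cn n)} (hD : IsOpen D) (hK : IsCompact K) (hKD : K ⊆ D) :
    ∃ θ : Cn n → ℝ, TF D θ ∧ (∀ z, 0 ≤ θ z) ∧ (∀ z, θ z ≤ 1) ∧ ∀ z ∈ K, θ z = 1 := by
  obtain ⟨V, hV, hKV, hVD, hVc⟩ := exists_open_between_and_isCompact_closure hK hD hKD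
  obtain ⟨f, hf, hr, hs, h1⟩ := exists_contMDiff_support_eq_eq_one_iff (n := (⊤ : ℕ∞))
    (modelWithCornersSelf ℝ (Cn n)) hV hK.isClosed hKV
  have hts : tsupport f = closure V := by rw [tsupport, hs]
  refine ⟨f, ⟨contMDiff_iff_contDiff.1 hf, ?_, ?_⟩, fun z => (hr ⟨z, rfl⟩).1,
    fun z => (hr ⟨z, rfl⟩).2, fun z hz => (h1 z).1 hz⟩
  · rw [HasCompactSupport, hts]; exact hVc
  · rw [hts]; exact hVD

theorem TF.mul_left {D : Set (Cn n)} {φ θ : Cn n → ℝ} (hθ : TF D θ)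
    (hφ : ContDiff ℝ (⊤ : ℕ∞) φ) : TF D (fun z => φ z * θ z) :=
  ⟨hφ.mul hθ.smooth, hθ.hcs.mul_left, (tsupport_mul_subset_right).trans hθ.sub⟩

theorem TF.add {D : Set (Cn n)} {φ θ : Cn n → ℝ} (hφ : TF D φ) (hθ : TF D θ) :
    TF D (fun z => φ z + θ z) :=
  ⟨hφ.smooth.add hθ.smooth, hφ.hcs.add hθ.hcs,
    (tsupport_add _ _).trans (Set.union_subset hφ.sub hθ.sub)⟩

theorem TF.sub' {D : Set (Cn n)} {φ θ : Cn n → ℝ} (hφ : TF D φ) (hθ : TF D θ) :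
    TF D (fun z => φ z - θ z) :=
  ⟨hφ.smooth.sub hθ.smooth, hφ.hcs.sub hθ.hcs,
    (tsupport_sub _ _).trans (Set.union_subset hφ.sub hθ.sub)⟩

theorem TF.const_mul {D : Set (Cn n)} {φ : Cn n → ℝ} (hφ : TF D φ) (a : ℝ) :
    TF D (fun z => a * φ z) :=
  ⟨contDiff_const.mul hφ.smooth, hφ.hcs.mul_left, (tsupport_mul_subset_right).trans hφ.sub⟩

theorem TF.mono {D D' : Set (Cn n)} {φ : Cn n → ℝ} (hφ : TF D φ) (h : D ⊆ D') : TF D' φ :=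
  ⟨hφ.smooth, hφ.hcs, hφ.sub.trans h⟩

theorem int_add (A : AlphaForm n) {D : Set (Cn n)} {φ θ w : Cn n → ℝ}
    (hw : LocallyIntegrableOn w D) (hφ : TF D φ) (hθ : TF D θ) :
    ∫ z, w z * alphaOpR A (fun z => φ z + θ z) z =
      (∫ z, w z * alphaOpR A φ z) + ∫ z, w z * alphaOpR A θ z := by
  rw [← integral_add (hφ.integrable A hw) (hθ.integrable A hw)]
  refine integral_congr_ae (Eventually.of_forall fun z => ?_)
  simp only [opR_add A hφ.c2 hθ.c2]; ring

theorem int_sub (A : AlphaForm n) {D : Set (Cn n)} {φ θ w : Cn n → ℝ}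
    (hw : LocallyIntegrableOn w D) (hφ : TF D φ) (hθ : TF D θ) :
    ∫ z, w z * alphaOpR A (fun z => φ z - θ z) z =
      (∫ z, w z * alphaOpR A φ z) - ∫ z, w z * alphaOpR A θ z := by
  rw [← integral_sub (hφ.integrable A hw) (hθ.integrable A hw)]
  refine integral_congr_ae (Eventually.of_forall fun z => ?_)
  simp only [opR_sub A hφ.c2 hθ.c2]; ring

theorem int_const_mul (A : AlphaForm n) {D : Set (Cn n)} {φ w : Cn n → ℝ}
    (hφ : TF D φ) (a : ℝ) :
    ∫ z, w z * alphaOpR A (fun z => a * φ z) z = a * (∫ z, w z * alphaOpR A φ z) := by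
  rw [← integral_const_mul]
  refine integral_congr_ae (Eventually.of_forall fun z => ?_)
  simp only [opR_const_mul A hφ.c2]; ring

open CompactlySupported in
theorem riesz_aux {A : AlphaForm n} {D : Set (Cn n)} {w θ : Cn n → ℝ}
    (hw : Sub A D w) (hθ : TF D θ) (h0 : ∀ z, 0 ≤ θ z) :
    ∃ μ : Measure (Cn n), IsFiniteMeasureOnCompacts μ ∧
      ∀ φ : Cn n → ℝ, ContDiff ℝ (⊤ : ℕ∞) φ → HasCompactSupport φ →
        ∫ z, φ z ∂μ = ∫ z, w z * alphaOpR A (fun z => φ z * θ z) z := by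
  let S : Submodule ℝ C_c(Cn n, ℝ) :=
    { carrier := {f | ContDiff ℝ (⊤ : ℕ∞) f}
      add_mem' := fun {a b} ha hb => by
        have : ContDiff ℝ (⊤ : ℕ∞) (fun z => a z + b z) := ContDiff.add ha hb
        exact this
      zero_mem' := by
        have : ContDiff ℝ (⊤ : ℕ∞) (fun _ : Cn n => (0 : ℝ)) := contDiff_const
        exact this
      smul_mem' := fun c a ha => by
        have : ContDiff ℝ (⊤ : ℕ∞) (fun z => c * a z) := contDiff_const.mul ha
        exact this }
  let f0 : S →ₗ[ℝ] ℝ :=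
    { toFun := fun φ => ∫ z, w z * alphaOpR A (fun z => φ.1 z * θ z) z
      map_add' := fun a b => by
        have := int_add A hw.1 (hθ.mul_left a.2) (hθ.mul_left b.2)
        rw [← this]
        have e : (fun z => (a + b).1 z * θ z) = fun z => a.1 z * θ z + b.1 z * θ z := by
          funext z
          change (a.1 z + b.1 z) * θ z = _
          ring
        rw [e]
      map_smul' := fun c a => by
        have := int_const_mul (w := w) A (hθ.mul_left a.2) c
        change _ = c * _
        rw [← this]
        have e : (fun z => (c • a).1 z * θ z) = fun z => c * (a.1 z * θ z) := by
          funext z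
          change (c * a.1 z) * θ z = _
          ring
        rw [e] }
  let s : PointedCone ℝ C_c(Cn n, ℝ) :=
    { carrier := {f | ∀ z, 0 ≤ f z}
      add_mem' := fun {a b} ha hb z => add_nonneg (ha z) (hb z)
      zero_mem' := fun z => le_rfl
      smul_mem' := fun c a ha z => mul_nonneg c.2 (ha z) }
  obtain ⟨g, hg1, hg2⟩ := riesz_extension s ⟨S, f0⟩
    (fun φ hφ => hw.2 _ (hθ.mul_left φ.2) fun z => mul_nonneg (hφ z) (h0 z))
    (fun y => by
      obtain ⟨χ, hχ, hχ0, hχ1, hχK⟩ := exists_cut isOpen_univ y.hasCompactSupport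
        (Set.subset_univ _)
      obtain ⟨C, hC⟩ := y.hasCompactSupport.exists_bound_of_continuousOn
        (f := y) y.continuous.continuousOn
      let x : C_c(Cn n, ℝ) := ⟨⟨fun z => |C| * χ z, (hχ.const_mul _).smooth.continuous⟩,
        (hχ.const_mul _).hcs⟩
      refine ⟨⟨x, (hχ.const_mul _).smooth⟩, fun z => ?_⟩
      change 0 ≤ |C| * χ z + y z
      by_cases hz : z ∈ tsupport y
      · have := hC z hz
        rw [Real.norm_eq_abs] at this
        rw [hχK z hz]
        have h2 := neg_abs_le (y z)
        have h3 := le_abs_self C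
        linarith
      · rw [image_eq_zero_of_notMem_tsupport hz, add_zero]
        exact mul_nonneg (abs_nonneg _) (hχ0 z))
  let Λ : C_c(Cn n, ℝ) →ₚ[ℝ] ℝ := PositiveLinearMap.mk₀ g fun f hf => hg2 f hf
  refine ⟨RealRMK.rieszMeasure Λ, ?_, fun φ hφ hc => ?_⟩
  · infer_instance
  · have h := RealRMK.integral_rieszMeasure Λ ⟨⟨φ, hφ.continuous⟩, hc⟩
    refine h.trans ?_
    exact hg1 ⟨⟨⟨φ, hφ.continuous⟩, hc⟩, hφ⟩

theorem riesz {A : AlphaForm n} {D K : Set (Cn n)} (hD : IsOpen D) (hK : IsCompact K)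
    (hKD : K ⊆ D) {w : Cn n → ℝ} (hw : Sub A D w) :
    ∃ μ : Measure (Cn n), IsFiniteMeasureOnCompacts μ ∧
      (∀ ψ, TF D ψ → (∀ z, 0 ≤ ψ z) → ∫ z, ψ z ∂μ ≤ ∫ z, w z * alphaOpR A ψ z) ∧
      ∀ ψ, TF K ψ → ∫ z, ψ z ∂μ = ∫ z, w z * alphaOpR A ψ z := by
  obtain ⟨θ, hθ, h0, h1, hθK⟩ := exists_cut hD hK hKD
  obtain ⟨μ, hμ, h⟩ := riesz_aux hw hθ h0
  refine ⟨μ, hμ, fun ψ hψ hψ0 => ?_, fun ψ hψ => ?_⟩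
  · rw [h ψ hψ.smooth hψ.hcs]
    have h2 := hw.2 _ (hψ.sub' (hθ.mul_left hψ.smooth)) fun z => by
      have := mul_le_mul_of_nonneg_left (h1 z) (hψ0 z)
      linarith
    rw [int_sub A hw.1 hψ (hθ.mul_left hψ.smooth)] at h2
    linarith
  · rw [h ψ hψ.smooth hψ.hcs]
    have e : (fun z => ψ z * θ z) = ψ := by
      funext z
      by_cases hz : z ∈ tsupport ψ
      · rw [hθK z (hψ.sub hz), mul_one]
      · rw [image_eq_zero_of_notMem_tsupport hz, zero_mul]
    rw [e]

end AlphaAux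

open scoped ComplexOrder
namespace AlphaAux
variable {n : ℕ}

theorem F0_eq_int (n : ℕ) (lam : ℝ) {T t : ℝ} (ht : 0 < t) (htT : t ≤ T) :
    F0 n lam T t = ∫ s in t..T, phi n lam T s := by
  rw [F0, if_pos ht, Fe]
  refine intervalIntegral.integral_congr fun s hs => ?_
  rw [Set.uIcc_of_le htT] at hs
  have : 2 ≤ s / (t / 2) := by
    rw [le_div_iff₀ (by positivity)]; linarith [hs.1]
  simp [phe, eta_one this]

theorem F0_antitone (n : ℕ) (lam : ℝ) {T s t : ℝ} (hT : 0 < T) (hs : 0 < s) (hst : s ≤ t) :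
    F0 n lam T t ≤ F0 n lam T s := by
  by_cases htT : T ≤ t
  · rw [F0_zero n lam hT htT]; exact F0_nonneg n lam hT s
  push Not at htT
  rw [F0_eq n lam hT (ε := s / 2) (t := t) (by positivity) (by linarith),
    F0_eq n lam hT (ε := s / 2) (t := s) (by positivity) (by linarith), Fe, Fe]
  have hc := phe_continuous n lam (T := T) (ε := s / 2) (by positivity)
  rw [← intervalIntegral.integral_add_adjacent_intervals (hc.intervalIntegrable s t)
    (hc.intervalIntegrable t T)]
  have := intervalIntegral.integral_nonneg (μ := volume) hst
    fun u _ => phe_nonneg n lam (T := T) (ε := s / 2) (by positivity) u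
  linarith

theorem phi_intble (n : ℕ) (lam T : ℝ) {a b : ℝ} (ha : 0 < a) (hab : a ≤ b) :
    IntervalIntegrable (phi n lam T) volume a b := by
  refine ContinuousOn.intervalIntegrable ?_
  rw [Set.uIcc_of_le hab]
  exact (phi_continuousOn n lam T).mono fun s hs => ha.trans_le hs.1

theorem F0_compare {A : AlphaForm n} {B : Set (Cn n)} {Γ Ts Tb κ : ℝ} (Ps : KP A B Γ Ts)
    (Pb : KP A B Γ Tb) (lam : ℝ) (hκ : 0 < κ) (hT : Ts ≤ κ * (Tb / 2)) :
    ∃ C, 0 < C ∧ ∀ t, 0 < t → F0 n lam Ts (κ * t) ≤ C * F0 n lam Tb t := by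
  set E := Real.exp |lam| with hE
  have hE0 : 0 < E := Real.exp_pos _
  have hTs := Ps.hT
  have hTb := Pb.hT
  refine ⟨κ * (E * E / κ ^ n), by positivity, fun t ht => ?_⟩
  have hnn := F0_nonneg n lam hTb t
  by_cases h : Ts ≤ κ * t
  · rw [F0_zero n lam hTs h]; positivity
  push Not at h
  have ht2 : t ≤ Ts / κ := by rw [le_div_iff₀ hκ]; linarith
  have hTk : Ts / κ ≤ Tb / 2 := by rw [div_le_iff₀ hκ]; linarith
  rw [F0_eq_int n lam (by positivity) h.le, F0_eq_int n lam ht (by linarith)]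
  have e1 : ∫ s in (κ * t)..Ts, phi n lam Ts s = κ * ∫ s in t..(Ts / κ), phi n lam Ts (κ * s) := by
    rw [intervalIntegral.integral_comp_mul_left _ hκ.ne']
    rw [mul_div_cancel₀ _ hκ.ne', smul_eq_mul, ← mul_assoc, mul_inv_cancel₀ hκ.ne', one_mul]
  rw [e1, mul_assoc κ]
  refine mul_le_mul_of_nonneg_left ?_ hκ.le
  have i1 : IntervalIntegrable (fun s => phi n lam Ts (κ * s)) volume t (Ts / κ) := by
    refine ContinuousOn.intervalIntegrable ?_
    rw [Set.uIcc_of_le ht2]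
    refine (phi_continuousOn n lam Ts).comp (by fun_prop) fun s hs => ?_
    exact mul_pos hκ (ht.trans_le hs.1)
  have i2 := (phi_intble n lam Tb ht ht2).const_mul (E * E / κ ^ n)
  have h2 : ∫ s in t..(Ts / κ), phi n lam Ts (κ * s) ≤
      ∫ s in t..(Ts / κ), (E * E / κ ^ n) * phi n lam Tb s := by
    refine intervalIntegral.integral_mono_on ht2 i1 i2 fun s hs => ?_
    have hs0 : 0 < s := ht.trans_le hs.1
    have a1 := Ps.phi_le lam (t := κ * s) (by positivity)
    have a2 := Pb.le_phi lam hs0 (hs.2.trans hTk)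
    refine a1.trans (le_trans (le_of_eq ?_) (mul_le_mul_of_nonneg_left a2 (by positivity)))
    rw [Real.exp_neg, ← hE, mul_pow]
    field_simp
  refine h2.trans ?_
  rw [intervalIntegral.integral_const_mul]
  refine mul_le_mul_of_nonneg_left ?_ (by positivity)
  rw [← intervalIntegral.integral_add_adjacent_intervals (phi_intble n lam Tb ht ht2)
    (phi_intble n lam Tb (a := Ts / κ) (by positivity) (by linarith : Ts / κ ≤ Tb))]
  have := intervalIntegral.integral_nonneg (μ := volume) (by linarith : Ts / κ ≤ Tb)
    fun u hu => phi_nonneg n lam Tb (t := u) (le_trans (by positivity) hu.1)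
  linarith

namespace KC
variable {A : AlphaForm n} {z0 : Cn n} {ρ ρ' Γ T : ℝ} (P : KC A z0 ρ ρ' Γ T)
include P

theorem GG_nonneg (lam : ℝ) (x y : Cn n) : 0 ≤ GG A lam T x y := F0_nonneg n lam P.hT _

theorem GG_zero (lam : ℝ) {x y : Cn n} (hx : x ∈ closedBall z0 ρ')
    (h : √(Γ * T) < ‖y - x‖) : GG A lam T x y = 0 := by
  refine F0_zero n lam P.hT ?_
  by_contra h'
  exact absurd (P.norm_le hx (not_le.1 h').le) (not_le.2 h)

theorem GG_int_upper (lam : ℝ) : ∃ C, 0 < C ∧ ∀ x ∈ closedBall z0 ρ', ∫ y, GG A lam T x y ≤ C := by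
  obtain ⟨C, hC, h⟩ := P.GG_le lam
  have hN : 0 ≤ ∫ h, NN n (√(Γ * T)) h := integral_nonneg fun h => NN_nonneg _ h
  refine ⟨C * (∫ h, NN n (√(Γ * T)) h) + 1, by positivity, fun x hx => ?_⟩
  have h1 : ∫ y, GG A lam T x y ≤ ∫ y, C * NN n (√(Γ * T)) (y - x) := by
    refine integral_mono (P.GG_integrable lam hx)
      (((NN_integrable P.hn (√(Γ * T))).comp_sub_right x).const_mul C) fun y => ?_
    exact h x hx y
  rw [integral_const_mul, integral_NN_sub] at h1
  linarith

theorem F0_pos (lam : ℝ) : 0 < F0 n lam T (T / 4) := by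
  have hT := P.hT
  rw [F0_eq_int n lam (by linarith) (by linarith)]
  rw [← intervalIntegral.integral_add_adjacent_intervals
    (phi_intble n lam T (a := T / 4) (b := T / 2) (by linarith) (by linarith))
    (phi_intble n lam T (a := T / 2) (b := T) (by linarith) (by linarith))]
  have h1 := intervalIntegral.integral_nonneg (μ := volume) (by linarith : T / 2 ≤ T)
    fun u hu => phi_nonneg n lam T (t := u) (le_trans (by positivity) hu.1)
  have h2 : 0 < ∫ s in (T / 4)..(T / 2), phi n lam T s := by
    refine intervalIntegral.intervalIntegral_pos_of_pos_on
      (phi_intble n lam T (by linarith) (by linarith)) (fun s hs => ?_) (by linarith)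
    have hs0 : 0 < s := lt_trans (by linarith) hs.1
    exact lt_of_lt_of_le (by positivity) (P.toKP.le_phi lam hs0 hs.2.le)
  linarith

theorem GG_int_lower (lam : ℝ) : ∃ c, 0 < c ∧ ∀ x ∈ closedBall z0 ρ', c ≤ ∫ y, GG A lam T x y := by
  have hT := P.hT
  have hΓ := P.Γpos
  set s := √(T / (4 * Γ)) with hs
  have hs0 : 0 < s := by positivity
  have hF := P.F0_pos lam
  refine ⟨F0 n lam T (T / 4) * (volume (closedBall (0 : Cn n) s)).toReal, ?_, fun x hx => ?_⟩
  · refine mul_pos hF (ENNReal.toReal_pos ?_ measure_closedBall_lt_top.ne)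
    exact (measure_closedBall_pos volume _ hs0).ne'
  have h1 : ∫ y in closedBall x s, F0 n lam T (T / 4) ≤ ∫ y in closedBall x s, GG A lam T x y := by
    have : Nonempty (Fin n) := ⟨⟨0, P.hn⟩⟩
    refine setIntegral_mono_on_ae (integrableOn_const (measure_closedBall_lt_top.ne))
      (P.GG_integrable lam hx).integrableOn measurableSet_closedBall ?_
    have : ∀ᵐ y : Cn n, y ≠ x := by
      rw [ae_iff]; simp
    filter_upwards [this] with y hy hys
    rw [mem_closedBall, dist_eq_norm] at hys
    refine F0_antitone n lam hT (qq_pos A hy) ?_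
    refine (P.geo.upper x (P.mem_of_center hx) y).trans ?_
    have h3 : ‖y - x‖ ^ 2 ≤ T / (4 * Γ) := by
      have := pow_le_pow_left₀ (norm_nonneg _) hys 2
      rwa [hs, Real.sq_sqrt (by positivity)] at this
    calc Γ * ‖y - x‖ ^ 2 ≤ Γ * (T / (4 * Γ)) := mul_le_mul_of_nonneg_left h3 hΓ.le
      _ = T / 4 := by field_simp
  have h2 : ∫ y in closedBall x s, GG A lam T x y ≤ ∫ y, GG A lam T x y :=
    setIntegral_le_integral (P.GG_integrable lam hx)
      (Eventually.of_forall fun y => P.GG_nonneg lam x y)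
  refine le_trans (le_of_eq ?_) (h1.trans h2)
  rw [setIntegral_const, smul_eq_mul, Measure.real, mul_comm]
  congr 2
  simpa using (Measure.addHaar_closedBall_center (volume : Measure (Cn n)) x s).symm

end KC

end AlphaAux

open scoped ComplexOrder
namespace AlphaAux
variable {n : ℕ}

namespace KC
variable {A : AlphaForm n} {z0 : Cn n} {ρ ρ' Γ T : ℝ} (P : KC A z0 ρ ρ' Γ T)
include P

theorem GG_compare {Ts : ℝ} (Ps : KC A z0 ρ ρ' Γ Ts) (hT : Ts ≤ (Γ ^ 2)⁻¹ * (T / 2)) (lam : ℝ) :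
    ∃ C, 0 < C ∧ ∀ x ∈ closedBall z0 ρ', ∀ y ∈ closedBall z0 ρ',
      GG A lam Ts y x ≤ C * GG A lam T x y := by
  have hΓ := P.Γpos
  obtain ⟨C, hC, h⟩ := F0_compare Ps.toKP P.toKP lam (κ := (Γ ^ 2)⁻¹) (by positivity) hT
  refine ⟨C, hC, fun x hx y hy => ?_⟩
  by_cases hxy : y = x
  · rw [hxy]; simp [GG, qq_self, F0]
  have hq := qq_pos A hxy
  refine le_trans ?_ (h _ hq)
  refine F0_antitone n lam Ps.hT (by positivity) ?_
  have h1 := P.geo.upper x (P.mem_of_center hx) y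
  have h2 := P.geo.lower y (P.mem_of_center hy) x
  rw [norm_sub_rev] at h2
  rw [inv_mul_le_iff₀ (by positivity)]
  calc qq A x y ≤ Γ * ‖y - x‖ ^ 2 := h1
    _ ≤ Γ * (Γ * qq A y x) := mul_le_mul_of_nonneg_left h2 hΓ.le
    _ = Γ ^ 2 * qq A y x := by ring

theorem gg_le_GG (lam : ℝ) {ε : ℝ} (hε : 0 < ε) {x y : Cn n} (h : y ≠ x) :
    gg A lam T ε x y ≤ GG A lam T x y := Fe_le_F0 n lam P.hT hε (qq_pos A h)

theorem gg_eventually (lam : ℝ) {x y : Cn n} (h : y ≠ x) :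
    ∀ᶠ ε in 𝓝[>] (0 : ℝ), gg A lam T ε x y = GG A lam T x y := by
  have hq := qq_pos A h
  have : Set.Iio (qq A x y / 2) ∈ 𝓝[>] (0 : ℝ) :=
    mem_nhdsWithin_of_mem_nhds (Iio_mem_nhds (by linarith))
  filter_upwards [this, self_mem_nhdsWithin] with ε h1 h2
  refine (F0_eq n lam P.hT h2 ?_).symm
  have : ε < qq A x y / 2 := h1
  linarith

theorem GG_fatou {D : Set (Cn n)} (hD : closedBall z0 ρ ⊆ D) {w : Cn n → ℝ} (hw : Sub A D w)
    (hw0 : ∀ᵐ x, x ∈ D → w x ≤ 0) {μ : Measure (Cn n)} [IsFiniteMeasureOnCompacts μ]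
    (hμ : ∀ ψ, TF D ψ → (∀ z, 0 ≤ ψ z) → ∫ z, ψ z ∂μ ≤ ∫ z, w z * alphaOpR A ψ z) :
    ∀ᵐ x : Cn n, x ∈ closedBall z0 ρ' →
      ∫⁻ y, ENNReal.ofReal (GG A (Lam n Γ) T x y) ∂μ ≤
        ENNReal.ofReal (-(cc A (Lam n Γ) T x * w x)) := by
  set lam := Lam n Γ with hlam
  have hwi := hw.1.integrableOn_compact_subset hD (isCompact_closedBall z0 ρ)
  filter_upwards [P.rep_all lam hwi] with x h hx
  obtain ⟨-, -, h3⟩ := h hx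
  have hε : ∀ k : ℕ, (0 : ℝ) < 1 / ((k : ℝ) + 1) := fun k => by positivity
  have hlim : Tendsto (fun k : ℕ => 1 / ((k : ℝ) + 1)) atTop (𝓝[>] 0) :=
    tendsto_nhdsWithin_iff.2 ⟨tendsto_one_div_add_atTop_nhds_zero_nat,
      Eventually.of_forall hε⟩
  have hcont : ∀ k : ℕ, Continuous (gg A lam T (1 / ((k : ℝ) + 1)) x) := fun k =>
    (gg_contDiff A lam (hε k) x).continuous
  have step1 : ∫⁻ y, ENNReal.ofReal (GG A lam T x y) ∂μ ≤
      ∫⁻ y, liminf (fun k : ℕ => ENNReal.ofReal (gg A lam T (1 / ((k : ℝ) + 1)) x y)) atTop ∂μ := by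
    refine lintegral_mono fun y => ?_
    by_cases hy : y = x
    · rw [hy]; simp [GG, qq_self, F0]
    · refine le_of_eq (Tendsto.liminf_eq ?_).symm
      refine tendsto_const_nhds.congr' ?_
      filter_upwards [hlim.eventually (P.gg_eventually lam hy)] with k hk
      rw [hk]
  refine step1.trans ((lintegral_liminf_le fun k =>
    (hcont k).measurable.ennreal_ofReal).trans ?_)
  have h4 : Tendsto (fun k : ℕ => ENNReal.ofReal (-∫ y, w y * ME A lam T (1 / ((k : ℝ) + 1)) x y))
      atTop (𝓝 (ENNReal.ofReal (-(cc A lam T x * w x)))) :=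
    ENNReal.tendsto_ofReal (h3.comp hlim).neg
  rw [← h4.liminf_eq]
  refine liminf_le_liminf (Eventually.of_forall fun k => ?_)
  have hTF := P.gg_TF hD lam (hε k) hx
  have hnn := gg_nonneg A lam P.hT (hε k) x
  rw [← ofReal_integral_eq_lintegral_ofReal
    ((hcont k).integrable_of_hasCompactSupport hTF.hcs) (Eventually.of_forall hnn)]
  refine ENNReal.ofReal_le_ofReal ((hμ _ hTF hnn).trans ?_)
  rw [P.int_opgg hwi lam (hε k) hx]
  have h5 : ∫ y, w y * (HH A (1 / ((k : ℝ) + 1)) x y * kk A lam T x y) ≤ 0 := by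
    refine integral_nonpos_of_ae ?_
    filter_upwards [hw0] with y hy
    by_cases hyB : y ∈ closedBall z0 ρ
    · exact mul_nonpos_of_nonpos_of_nonneg (hy (hD hyB))
        (mul_nonneg (HH_nonneg _ _ _ _) (P.kk_pos hx y))
    · simp [P.kk_zero_out lam hx hyB]
  linarith

theorem GG_test {y : Cn n} (hy : y ∈ closedBall z0 ρ') {ψ : Cn n → ℝ} (hψ : ContDiff ℝ 2 ψ)
    (hc : HasCompactSupport ψ) (h0 : ∀ z, 0 ≤ ψ z) :
    -(cc A (Lam n Γ) T y * ψ y) ≤ ∫ x, GG A (Lam n Γ) T y x * alphaOpR A ψ x := by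
  set lam := Lam n Γ with hlam
  have hΓ := P.Γpos
  have hLc := continuous_opR A hψ
  have hLs := hcs_opR A hc
  obtain ⟨C, hC⟩ := hLc.bounded_above_of_compact_support hLs
  have hne : ∀ᵐ x : Cn n, x ≠ y := by
    have : Nonempty (Fin n) := ⟨⟨0, P.hn⟩⟩
    rw [ae_iff]; simp
  have hlim : Tendsto (fun ε => ∫ x, gg A lam T ε y x * alphaOpR A ψ x) (𝓝[>] 0)
      (𝓝 (∫ x, GG A lam T y x * alphaOpR A ψ x)) := by
    refine tendsto_integral_filter_of_dominated_convergence
      (fun x => GG A lam T y x * C) ?_ ?_ ((P.GG_integrable lam hy).mul_const C) ?_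
    · filter_upwards [self_mem_nhdsWithin] with ε hε
      exact ((gg_contDiff A lam hε y).continuous.mul hLc).aestronglyMeasurable
    · filter_upwards [self_mem_nhdsWithin] with ε hε
      filter_upwards [hne] with x hx
      rw [norm_mul, Real.norm_of_nonneg (gg_nonneg A lam P.hT hε y x)]
      exact mul_le_mul (P.gg_le_GG lam hε hx) (hC x) (norm_nonneg _) (P.GG_nonneg lam y x)
    · filter_upwards [hne] with x hx
      refine tendsto_const_nhds.congr' ?_
      filter_upwards [P.gg_eventually lam hx] with ε hε
      rw [hε]
  have key : ∀ δ > 0, -((ψ y + δ) * cc A lam T y) ≤ ∫ x, GG A lam T y x * alphaOpR A ψ x := by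
    intro δ hδ
    have hM := ((P.tendsto_ME lam hy).const_mul (ψ y + δ)).neg
    refine le_of_tendsto_of_tendsto hM hlim ?_
    obtain ⟨r, hr, hrψ⟩ := Metric.continuous_iff.1 hψ.continuous y δ hδ
    have hs : ∀ᶠ ε in 𝓝[>] (0 : ℝ), √(Γ * (2 * ε)) < r := by
      have a3 : Tendsto (fun ε : ℝ => √(Γ * (2 * ε))) (𝓝[>] 0) (𝓝 (√(Γ * (2 * 0)))) :=
        (Continuous.tendsto (by fun_prop) 0).mono_left nhdsWithin_le_nhds
      exact a3.eventually (gt_mem_nhds (by simpa using hr))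
    filter_upwards [hs, self_mem_nhdsWithin] with ε hεr hε
    have hg2 : ContDiff ℝ 2 (gg A lam T ε y) := (gg_contDiff A lam hε y).of_le (by norm_cast)
    rw [selfadjoint A hg2 hψ hc, P.int_opgg (hψ.continuous.continuousOn.integrableOn_compact
      (isCompact_closedBall z0 ρ)) lam hε hy]
    have h5 : 0 ≤ ∫ x, ψ x * (HH A ε y x * kk A lam T y x) := integral_nonneg fun x =>
      mul_nonneg (h0 x) (mul_nonneg (HH_nonneg _ _ _ _) (P.kk_pos hy x))
    have h6 : ∫ x, ψ x * ME A lam T ε y x ≤ (ψ y + δ) * ∫ x, ME A lam T ε y x := by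
      rw [← integral_const_mul]
      refine integral_mono (P.wME_integrable (hψ.continuous.continuousOn.integrableOn_compact
        (isCompact_closedBall z0 ρ)) lam hε hy) ((P.ME_integrable lam hε hy).const_mul _)
        fun x => ?_
      by_cases hm : ME A lam T ε y x = 0
      · simp [hm]
      · refine mul_le_mul_of_nonneg_right ?_ (ME_nonneg A lam T hε y x)
        have h7 := P.toKP.norm_le_of_qq (P.mem_of_center hy) (P.qq_lt_of_ME_ne hε hm).2.1.le
        have h8 := hrψ x (by rw [dist_eq_norm]; linarith)
        rw [Real.dist_eq] at h8
        have := le_abs_self (ψ x - ψ y)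
        linarith
    linarith
  have hl : Tendsto (fun δ : ℝ => -((ψ y + δ) * cc A lam T y)) (𝓝[>] 0)
      (𝓝 (-((ψ y + 0) * cc A lam T y))) :=
    (Continuous.tendsto (by fun_prop) 0).mono_left nhdsWithin_le_nhds
  rw [add_zero, mul_comm] at hl
  refine le_of_tendsto hl ?_
  filter_upwards [self_mem_nhdsWithin] with δ hδ using key δ hδ

end KC

end AlphaAux

open scoped ComplexOrder
namespace AlphaAux
variable {n : ℕ}

theorem KC.GG_prod {A : AlphaForm n} {z0 : Cn n} {ρ ρ' Γ T : ℝ} (P : KC A z0 ρ ρ' Γ T) (lam : ℝ)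
    {ν : Measure (Cn n)} [IsFiniteMeasure ν] (hν : ∀ᵐ y ∂ν, y ∈ closedBall z0 ρ') :
    Integrable (fun p : Cn n × Cn n => GG A lam T p.1 p.2) (ν.prod volume) := by
  have hm := (GG_measurable A lam P.hT)
  obtain ⟨C, hC, hU⟩ := P.GG_int_upper lam
  rw [integrable_prod_iff hm.aestronglyMeasurable]
  refine ⟨?_, ?_⟩
  · filter_upwards [hν] with y hy using P.GG_integrable lam hy
  · refine Integrable.mono' (integrable_const C) ?_ ?_
    · exact hm.stronglyMeasurable.norm.integral_prod_right.aestronglyMeasurable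
    · filter_upwards [hν] with y hy
      have e : (fun x => ‖GG A lam T y x‖) = GG A lam T y := by
        funext x; rw [Real.norm_of_nonneg (P.GG_nonneg lam y x)]
      simp only [e]
      rw [Real.norm_of_nonneg (integral_nonneg fun x => P.GG_nonneg lam y x)]
      exact hU y hy

theorem step {A : AlphaForm n} {z0 : Cn n} {ρ ρ' Γ T Ts r : ℝ} (P : KC A z0 ρ ρ' Γ T)
    (Ps : KC A z0 ρ ρ' Γ Ts) (hT : Ts ≤ (Γ ^ 2)⁻¹ * (T / 2)) (hr : r + √(Γ * Ts) ≤ ρ')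
    {D : Set (Cn n)} (hDo : IsOpen D) (hD : closedBall z0 ρ ⊆ D) :
    ∃ M, 0 < M ∧ ∀ w, Sub A D w → (∀ᵐ x, x ∈ D → w x ≤ 0) →
      ∃ h : Cn n → ℝ, Integrable h ∧ (∀ x, 0 ≤ h x) ∧ (∀ x ∉ closedBall z0 ρ', h x = 0) ∧
        Sub A D (fun x => w x + h x) ∧ (∀ᵐ x, x ∈ D → w x + h x ≤ 0) ∧
        ∀ φ, TF (closedBall z0 r) φ → ∀ b, (∀ z, |φ z| ≤ b) →
          |∫ z, w z * alphaOpR A φ z| ≤ M * b * ∫ x, h x := by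
  set lam := Lam n Γ with hlam
  have hrr : closedBall z0 r ⊆ closedBall z0 ρ' :=
    closedBall_subset_closedBall (by linarith [Real.sqrt_nonneg (Γ * Ts)])
  obtain ⟨Cc, hCc, hcomp⟩ := P.GG_compare Ps hT lam
  obtain ⟨C1, hC1, hcc1⟩ := P.cc_upper lam
  obtain ⟨c0, hc0, hcl⟩ := P.cc_lower
  obtain ⟨C2, hC2, hcc2⟩ := Ps.cc_upper lam
  obtain ⟨c1, hc1, hGl⟩ := Ps.GG_int_lower lam
  set e := 1 / (Cc * C1 + C2) with he
  have he0 : 0 < e := by positivity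
  have he1 : e * (Cc * C1) ≤ 1 := by
    rw [he, one_div, inv_mul_le_iff₀ (by positivity)]; linarith
  have he2 : e * C2 ≤ 1 := by
    have : 0 < Cc * C1 := by positivity
    rw [he, one_div, inv_mul_le_iff₀ (by positivity)]; linarith
  refine ⟨1 / (e * c1), by positivity, fun w hw hw0 => ?_⟩
  have hKD : closedBall z0 r ⊆ D := fun z hz => hD (P.mem_of_center (hrr hz))
  obtain ⟨μ, hμf, hμ1, hμ2⟩ := riesz hDo (isCompact_closedBall z0 r) hKD hw
  set ν := μ.restrict (closedBall z0 r) with hν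
  have : IsFiniteMeasure ν := ⟨by
    rw [hν, Measure.restrict_apply_univ]
    exact (isCompact_closedBall z0 r).measure_lt_top⟩
  have hνr : ∀ᵐ y ∂ν, y ∈ closedBall z0 r := ae_restrict_mem measurableSet_closedBall
  have hνm : ∀ᵐ y ∂ν, y ∈ closedBall z0 ρ' := hνr.mono fun y hy => hrr hy
  have hprod := Ps.GG_prod lam hνm
  have hGint : Integrable (fun x => ∫ y, GG A lam Ts y x ∂ν) := hprod.integral_prod_right
  have hGnn : ∀ x, 0 ≤ ∫ y, GG A lam Ts y x ∂ν := fun x =>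
    integral_nonneg fun y => Ps.GG_nonneg lam y x
  have hz : ∀ x ∉ closedBall z0 ρ', ∫ y, GG A lam Ts y x ∂ν = 0 := by
    intro x hx
    refine integral_eq_zero_of_ae ?_
    filter_upwards [hνr] with y hy
    refine Ps.GG_zero lam (hrr hy) ?_
    rw [mem_closedBall, dist_eq_norm] at hx hy
    have h1 := norm_add_le (x - y) (y - z0)
    rw [sub_add_sub_cancel] at h1
    linarith
  have hbd : ∀ᵐ x : Cn n, x ∈ D → e * ∫ y, GG A lam Ts y x ∂ν ≤ -w x := by
    filter_upwards [P.GG_fatou hD hw hw0 hμ1, hw0] with x hx hx0 hxD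
    have hx0 := hx0 hxD
    by_cases hxB : x ∈ closedBall z0 ρ'
    · have hx := hx hxB
      have hcx := hcl x hxB
      have hcx1 := hcc1 x hxB
      have h1 : ∫ y, GG A lam Ts y x ∂ν ≤ Cc * (-(cc A lam T x * w x)) := by
        have hmeas : Measurable fun y => GG A lam Ts y x :=
          (GG_measurable A lam Ps.hT).comp measurable_prodMk_right
        rw [integral_eq_lintegral_of_nonneg_ae
          (Eventually.of_forall fun y => Ps.GG_nonneg lam y x) hmeas.aestronglyMeasurable]
        have hb0 : 0 ≤ -(cc A lam T x * w x) := by nlinarith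
        refine ENNReal.toReal_le_of_le_ofReal (by positivity) ?_
        rw [ENNReal.ofReal_mul hCc.le]
        refine le_trans ?_ (mul_le_mul_right hx _)
        have hm2 : Measurable (fun y => ENNReal.ofReal (GG A lam T x y)) :=
          ((GG_measurable A lam P.hT).comp measurable_prodMk_left).ennreal_ofReal
        rw [← hlam, ← lintegral_const_mul _ hm2]
        refine le_trans (lintegral_mono_ae ?_) (lintegral_mono' Measure.restrict_le_self le_rfl)
        filter_upwards [hνm] with y hy
        rw [← ENNReal.ofReal_mul hCc.le]
        exact ENNReal.ofReal_le_ofReal (hcomp x hxB y hy)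
      have h2 : Cc * (-(cc A lam T x * w x)) ≤ Cc * C1 * (-w x) := by
        have : cc A lam T x * (-w x) ≤ C1 * (-w x) :=
          mul_le_mul_of_nonneg_right hcx1 (by linarith)
        have := mul_le_mul_of_nonneg_left this hCc.le
        linarith
      calc e * ∫ y, GG A lam Ts y x ∂ν ≤ e * (Cc * C1 * (-w x)) :=
            mul_le_mul_of_nonneg_left (h1.trans h2) he0.le
        _ = e * (Cc * C1) * (-w x) := by ring
        _ ≤ 1 * (-w x) := mul_le_mul_of_nonneg_right he1 (by linarith)
        _ = -w x := one_mul _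
    · rw [hz x hxB, mul_zero]; linarith
  refine ⟨fun x => e * ∫ y, GG A lam Ts y x ∂ν, hGint.const_mul e,
    fun x => mul_nonneg he0.le (hGnn x), fun x hx => by simp only [hz x hx, mul_zero], ⟨?_, ?_⟩, ?_, ?_⟩
  · exact hw.1.add ((hGint.const_mul e).locallyIntegrable.locallyIntegrableOn D)
  · intro ψ hψ hψ0
    have hLc := continuous_opR A hψ.c2
    obtain ⟨C, hC⟩ := hLc.bounded_above_of_compact_support (hcs_opR A hψ.hcs)
    have hP2 : Integrable (fun p : Cn n × Cn n => GG A lam Ts p.1 p.2 * alphaOpR A ψ p.2)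
        (ν.prod volume) := by
      have := hprod.bdd_mul (c := C) (f := fun p : Cn n × Cn n => alphaOpR A ψ p.2)
        (hLc.comp continuous_snd).aestronglyMeasurable (Eventually.of_forall fun p => hC p.2)
      simpa only [mul_comm] using this
    have hhL : Integrable (fun x => (e * ∫ y, GG A lam Ts y x ∂ν) * alphaOpR A ψ x) := by
      have := (hGint.const_mul e).bdd_mul (c := C) (f := fun p => alphaOpR A ψ p)
        hLc.aestronglyMeasurable (Eventually.of_forall fun p => hC p)
      simpa only [mul_comm] using this
    simp only [add_mul]
    rw [integral_add (hψ.integrable A hw.1) hhL]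
    have e1 : ∫ x, (e * ∫ y, GG A lam Ts y x ∂ν) * alphaOpR A ψ x =
        e * ∫ y, (∫ x, GG A lam Ts y x * alphaOpR A ψ x) ∂ν := by
      rw [integral_integral_swap hP2, ← integral_const_mul]
      refine integral_congr_ae (Eventually.of_forall fun x => ?_)
      simp only [integral_mul_const]
      ring
    rw [e1]
    have hψi : Integrable ψ μ := hψ.smooth.continuous.integrable_of_hasCompactSupport hψ.hcs
    have h3 : ∫ y, -(C2 * ψ y) ∂ν ≤ ∫ y, (∫ x, GG A lam Ts y x * alphaOpR A ψ x) ∂ν := by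
      refine integral_mono_ae (hψi.restrict.const_mul C2).neg hP2.integral_prod_left ?_
      filter_upwards [hνm] with y hy
      refine le_trans ?_ (Ps.GG_test hy hψ.c2 hψ.hcs hψ0)
      have := mul_le_mul_of_nonneg_right (hcc2 y hy) (hψ0 y)
      linarith
    rw [integral_neg, integral_const_mul] at h3
    have h4 : ∫ y, ψ y ∂ν ≤ ∫ y, ψ y ∂μ :=
      setIntegral_le_integral hψi (Eventually.of_forall hψ0)
    have h5 := hμ1 ψ hψ hψ0
    have h6 : 0 ≤ ∫ y, ψ y ∂ν := integral_nonneg hψ0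
    have h7 := mul_le_mul_of_nonneg_left h3 he0.le
    have h8 := mul_le_mul_of_nonneg_right he2 h6
    linarith
  · filter_upwards [hbd] with x hx hxD
    have := hx hxD
    linarith
  · intro φ hφ b hb
    rw [← hμ2 φ hφ, integral_const_mul]
    have hb0 : 0 ≤ b := (abs_nonneg _).trans (hb z0)
    have h1 : ∫ z, φ z ∂μ = ∫ z, φ z ∂ν := by
      refine (setIntegral_eq_integral_of_forall_compl_eq_zero fun z hz => ?_).symm
      exact image_eq_zero_of_notMem_tsupport fun h => hz (hφ.sub h)
    have h2 : |∫ z, φ z ∂ν| ≤ b * ν.real Set.univ := by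
      have := norm_integral_le_of_norm_le_const (μ := ν) (f := φ) (C := b)
        (Eventually.of_forall hb)
      simpa using this
    have h3 : c1 * ν.real Set.univ ≤ ∫ x, ∫ y, GG A lam Ts y x ∂ν := by
      rw [← integral_integral_swap hprod]
      have : ∫ y, c1 ∂ν ≤ ∫ y, (∫ x, GG A lam Ts y x) ∂ν := by
        refine integral_mono_ae (integrable_const c1) hprod.integral_prod_left ?_
        filter_upwards [hνm] with y hy using hGl y hy
      simpa [mul_comm] using this
    rw [h1]
    refine h2.trans ?_
    have h4 : ν.real Set.univ ≤ (∫ x, ∫ y, GG A lam Ts y x ∂ν) / c1 := by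
      rw [le_div_iff₀ hc1]; linarith
    calc b * ν.real Set.univ ≤ b * ((∫ x, ∫ y, GG A lam Ts y x ∂ν) / c1) :=
          mul_le_mul_of_nonneg_left h4 hb0
      _ = 1 / (e * c1) * b * (e * ∫ x, ∫ y, GG A lam Ts y x ∂ν) := by field_simp

end AlphaAux

open scoped ComplexOrder
namespace AlphaAux
variable {n : ℕ}

theorem loc_mono {D : Set (Cn n)} (hDo : IsOpen D) {u v : Cn n → ℝ}
    (hu : LocallyIntegrableOn u D) (hv : AEStronglyMeasurable v (volume.restrict D))
    (h : ∀ᵐ x, x ∈ D → ‖v x‖ ≤ ‖u x‖) : LocallyIntegrableOn v D := by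
  rw [locallyIntegrableOn_iff hDo.isLocallyClosed] at hu ⊢
  intro k hk hkc
  refine Integrable.mono (hu k hk hkc) (hv.mono_measure (Measure.restrict_mono hk le_rfl)) ?_
  rw [ae_restrict_iff' hkc.measurableSet]
  filter_upwards [h] with x hx hxk using hx (hk hxk)

theorem iterate {A : AlphaForm n} {z0 : Cn n} {ρ' r M : ℝ} (hM : 0 < M)
    {D : Set (Cn n)} (hDo : IsOpen D) (hB : closedBall z0 ρ' ⊆ D) (hrD : closedBall z0 r ⊆ D)
    (hstep : ∀ w, Sub A D w → (∀ᵐ x, x ∈ D → w x ≤ 0) →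
      ∃ h : Cn n → ℝ, Integrable h ∧ (∀ x, 0 ≤ h x) ∧ (∀ x ∉ closedBall z0 ρ', h x = 0) ∧
        Sub A D (fun x => w x + h x) ∧ (∀ᵐ x, x ∈ D → w x + h x ≤ 0) ∧
        ∀ φ, TF (closedBall z0 r) φ → ∀ b, (∀ z, |φ z| ≤ b) →
          |∫ z, w z * alphaOpR A φ z| ≤ M * b * ∫ x, h x)
    {u : Cn n → ℝ} (hu : Sub A D u) (hu0 : ∀ᵐ x, x ∈ D → u x ≤ 0) :
    ∃ v : Cn n → ℝ, Sub A D v ∧ (∀ x, u x ≤ v x) ∧ (∀ᵐ x, x ∈ D → v x ≤ 0) ∧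
      (∀ x ∉ closedBall z0 ρ', v x = u x) ∧ Har A (closedBall z0 r) v := by
  choose! H h1 h2 h3 h4 h5 h6 using hstep
  set W : ℕ → Cn n → ℝ := fun k => Nat.rec u (fun _ w => fun x => w x + H w x) k with hW
  have hW0 : W 0 = u := rfl
  have hWs : ∀ k, W (k + 1) = fun x => W k x + H (W k) x := fun k => rfl
  have hWp : ∀ k, Sub A D (W k) ∧ ∀ᵐ x, x ∈ D → W k x ≤ 0 := by
    intro k
    induction k with
    | zero => exact ⟨hu, hu0⟩
    | succ k ih => rw [hWs]; exact ⟨h4 _ ih.1 ih.2, h5 _ ih.1 ih.2⟩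
  have hHn : ∀ k x, 0 ≤ H (W k) x := fun k => h2 _ (hWp k).1 (hWp k).2
  have hHz : ∀ k, ∀ x ∉ closedBall z0 ρ', H (W k) x = 0 := fun k => h3 _ (hWp k).1 (hWp k).2
  have hHi : ∀ k, Integrable (H (W k)) := fun k => h1 _ (hWp k).1 (hWp k).2
  have hsum : ∀ k x, W k x = u x + ∑ j ∈ Finset.range k, H (W j) x := by
    intro k x
    induction k with
    | zero => simp [hW0]
    | succ k ih => rw [hWs, Finset.sum_range_succ]; simp only [ih]; ring
  have hall : ∀ᵐ x : Cn n, ∀ k, x ∈ D → W k x ≤ 0 := ae_all_iff.2 fun k => (hWp k).2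
  have hlow : ∀ k x, u x ≤ W k x := fun k x => by
    rw [hsum]; linarith [Finset.sum_nonneg fun j (_ : j ∈ Finset.range k) => hHn j x]
  have hsm : ∀ᵐ x : Cn n, Summable (fun k => H (W k) x) := by
    filter_upwards [hall] with x hx
    by_cases hxB : x ∈ closedBall z0 ρ'
    · refine summable_of_sum_range_le (c := -u x) (fun k => hHn k x) fun k => ?_
      have := hx k (hB hxB)
      rw [hsum] at this
      linarith
    · simp only [hHz _ x hxB]; exact summable_zero
  set v : Cn n → ℝ := fun x => u x + ∑' k, H (W k) x with hv
  have hlim : ∀ᵐ x : Cn n, Tendsto (fun k => W k x) atTop (𝓝 (v x)) := by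
    filter_upwards [hsm] with x hx
    simp only [hsum]
    exact hx.hasSum.tendsto_sum_nat.const_add (u x)
  have huv : ∀ x, u x ≤ v x := fun x => by
    have : 0 ≤ ∑' k, H (W k) x := tsum_nonneg fun k => hHn k x
    simp only [hv]; linarith
  have hv0 : ∀ᵐ x, x ∈ D → v x ≤ 0 := by
    filter_upwards [hlim, hall] with x hx hx2 hxD
    exact le_of_tendsto' hx fun k => hx2 k hxD
  have hvz : ∀ x ∉ closedBall z0 ρ', v x = u x := fun x hx => by
    simp only [hv, hHz _ x hx, tsum_zero, add_zero]
  have hvl : LocallyIntegrableOn v D := by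
    refine loc_mono hDo hu.1 ?_ ?_
    · exact aestronglyMeasurable_of_tendsto_ae atTop (fun k => (hWp k).1.1.aestronglyMeasurable)
        (ae_restrict_of_ae hlim)
    · filter_upwards [hv0] with x hx hxD
      have := hx hxD
      rw [Real.norm_eq_abs, Real.norm_eq_abs, abs_of_nonpos this,
        abs_of_nonpos ((huv x).trans this)]
      linarith [huv x]
  have hlimI : ∀ φ, TF D φ → Tendsto (fun k => ∫ z, W k z * alphaOpR A φ z) atTop
      (𝓝 (∫ z, v z * alphaOpR A φ z)) := by
    intro φ hφ
    refine tendsto_integral_of_dominated_convergence (fun z => ‖u z * alphaOpR A φ z‖)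
      (fun k => (hφ.integrable A (hWp k).1.1).aestronglyMeasurable)
      (hφ.integrable A hu.1).norm ?_ ?_
    · intro k
      filter_upwards [hall] with x hx
      rw [norm_mul, norm_mul]
      by_cases hxD : x ∈ D
      · refine mul_le_mul_of_nonneg_right ?_ (norm_nonneg _)
        have := hx k hxD
        rw [Real.norm_eq_abs, Real.norm_eq_abs, abs_of_nonpos this,
          abs_of_nonpos ((hlow k x).trans this)]
        linarith [hlow k x]
      · rw [opR_eq_zero A φ fun h' => hxD (hφ.sub h')]; simp
    · filter_upwards [hlim] with x hx using hx.mul_const _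
  refine ⟨v, ⟨hvl, fun φ hφ h0 => ?_⟩, huv, hv0, hvz, fun φ hφ => ?_⟩
  · exact ge_of_tendsto' (hlimI φ hφ) fun k => (hWp k).1.2 φ hφ h0
  · have hφD : TF D φ := ⟨hφ.smooth, hφ.hcs, hφ.sub.trans hrD⟩
    obtain ⟨b, hb⟩ := hφ.smooth.continuous.bounded_above_of_compact_support hφ.hcs
    have hI : Summable (fun k => ∫ x, H (W k) x) := by
      refine summable_of_sum_range_le (c := ∫ x in closedBall z0 ρ', ‖u x‖)
        (fun k => integral_nonneg (hHn k)) fun k => ?_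
      rw [← integral_finset_sum _ fun j _ => hHi j]
      have e : ∫ x, ∑ j ∈ Finset.range k, H (W j) x =
          ∫ x in closedBall z0 ρ', ∑ j ∈ Finset.range k, H (W j) x := by
        refine (setIntegral_eq_integral_of_forall_compl_eq_zero fun x hx => ?_).symm
        exact Finset.sum_eq_zero fun j _ => hHz j x hx
      rw [e]
      refine setIntegral_mono_on_ae (integrable_finset_sum _ fun j _ => hHi j).integrableOn
        (hu.1.integrableOn_compact_subset hB (isCompact_closedBall _ _)).norm
        measurableSet_closedBall ?_
      filter_upwards [hall] with x hx hxB
      have := hx k (hB hxB)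
      rw [hsum] at this
      rw [Real.norm_eq_abs]
      linarith [neg_le_abs (u x)]
    have t1 : Tendsto (fun k => M * b * ∫ x, H (W k) x) atTop (𝓝 0) := by
      simpa using hI.tendsto_atTop_zero.const_mul (M * b)
    have t2 : Tendsto (fun k => ∫ z, W k z * alphaOpR A φ z) atTop (𝓝 0) :=
      squeeze_zero_norm (fun k => h6 _ (hWp k).1 (hWp k).2 φ hφ b hb) t1
    exact tendsto_nhds_unique (hlimI φ hφD) t2

end AlphaAux

open scoped ComplexOrder
namespace AlphaAux
variable {n : ℕ}

theorem sub_of_ash {A : AlphaForm n} {D : Set (Cn n)} {u : Cn n → ℝ}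
    (hu : IsAlphaSubharmonic A D u) : Sub A D u := by
  obtain ⟨_, _, _, h4, h5⟩ := hu
  refine ⟨by simpa using h4, fun φ hφ h0 => ?_⟩
  rw [← integral_D A hφ]
  simpa using h5 φ hφ.smooth hφ.hcs hφ.sub h0

theorem el_le_of_ae {v : Cn n → ℝ} {U : Set (Cn n)} (hU : IsOpen U) {b : ℝ}
    (h : ∀ᵐ x, x ∈ U → v x ≤ b) {x : Cn n} (hx : x ∈ U) : el v x ≤ b := by
  refine limsup_le_of_le (h := ?_)
  refine eventually_el.2 ⟨U, hU, hx, ?_⟩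
  filter_upwards [h] with y hy hyU using EReal.coe_le_coe_iff.2 (hy hyU)

theorem le_el_of_ae {v : Cn n → ℝ} {U : Set (Cn n)} (hU : IsOpen U) {b : ℝ}
    (h : ∀ᵐ x, x ∈ U → b ≤ v x) {x : Cn n} (hx : x ∈ U) : (b : EReal) ≤ el v x := by
  refine le_limsup_of_frequently_le (Eventually.frequently ?_)
  refine eventually_el.2 ⟨U, hU, hx, ?_⟩
  filter_upwards [h] with y hy hyU using EReal.coe_le_coe_iff.2 (hy hyU)

theorem el_mono_of_ae {u v : Cn n → ℝ} {U : Set (Cn n)} (hU : IsOpen U)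
    (h : ∀ᵐ x, x ∈ U → u x ≤ v x) {x : Cn n} (hx : x ∈ U) : el u x ≤ el v x := by
  refine limsup_le_limsup ?_
  refine eventually_el.2 ⟨U, hU, hx, ?_⟩
  filter_upwards [h] with y hy hyU using EReal.coe_le_coe_iff.2 (hy hyU)

theorem el_of_ash {A : AlphaForm n} {D : Set (Cn n)} {u : Cn n → ℝ}
    (hu : IsAlphaSubharmonic A D u) {x : Cn n} (hx : x ∈ D) : el u x = u x := by
  obtain ⟨_, _, h3, _, _⟩ := hu
  apply le_antisymm
  · have := h3 x hx Set.univ ⟨Set.univ, univ_mem, by simp⟩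
    rw [nhdsWithin_univ] at this
    refine le_of_le_of_eq ?_ this
    exact limsup_le_limsup_of_le inf_le_left
  · by_contra hlt
    rw [not_le] at hlt
    obtain ⟨c, hc1, hc2⟩ := exists_between hlt
    obtain ⟨U, hU, hxU, hp⟩ := eventually_el.1 (eventually_lt_of_limsup_lt hc1)
    have := h3 x hx {y | (u y : EReal) < c} ⟨U, hU.mem_nhds hxU, by
      rw [ae_iff] at hp
      convert hp using 2
      ext y
      simp⟩
    refine absurd this (ne_of_lt (lt_of_le_of_lt ?_ hc2))
    refine limsup_le_of_le (h := ?_)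
    filter_upwards [self_mem_nhdsWithin] with y hy using le_of_lt hy

theorem regularize (hn : 1 ≤ n) {A : AlphaForm n} {D : Set (Cn n)} (hDo : IsOpen D)
    {u v : Cn n → ℝ} (hu : IsAlphaSubharmonic A D u) (hv : Sub A D v)
    (hv0 : ∀ᵐ x, x ∈ D → v x ≤ 0) (huv : ∀ x, u x ≤ v x) (e : ℝ) :
    IsAlphaSubharmonic A D (fun x => (el v x).toReal - e) ∧
      (∀ x ∈ D, ((el v x).toReal : EReal) = el v x) := by
  have hlow : ∀ x ∈ D, (u x : EReal) ≤ el v x := fun x hx => by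
    rw [← el_of_ash hu hx]
    exact el_mono_of_ae hDo (Eventually.of_forall fun y _ => huv y) hx
  have hup : ∀ x ∈ D, el v x ≤ (0 : ℝ) := fun x hx => el_le_of_ae hDo hv0 hx
  have hco : ∀ x ∈ D, ((el v x).toReal : EReal) = el v x := fun x hx =>
    EReal.coe_toReal ((hup x hx).trans_lt (EReal.coe_lt_top 0)).ne
      ((EReal.bot_lt_coe (u x)).trans_le (hlow x hx)).ne'
  have hae := el_eq_ae hn hDo hv hv0
  set w : Cn n → ℝ := fun x => (el v x).toReal - e with hw
  have hwv : ∀ᵐ x, x ∈ D → w x = v x - e := by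
    filter_upwards [hae] with x hx hxD
    simp only [hw, hx hxD, EReal.toReal_coe]
  have hlt : ∀ x ∈ D, ∀ c : ℝ, w x < c ↔ el v x < ((c + e : ℝ) : EReal) := fun x hx c => by
    rw [← hco x hx, EReal.coe_lt_coe_iff]
    simp only [hw]
    constructor <;> intro h <;> linarith
  have husc : ∀ z ∈ D, ∀ b : EReal, (w z : EReal) < b → ∀ᶠ y in 𝓝 z, (w y : EReal) < b := by
    intro z hz b hb
    obtain ⟨c, hc1, hc2⟩ := EReal.lt_iff_exists_real_btwn.1 hb
    have h1 := (hlt z hz c).1 (EReal.coe_lt_coe_iff.1 hc1)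
    filter_upwards [el_usc v z _ h1, hDo.mem_nhds hz] with y hy hyD
    exact (EReal.coe_lt_coe_iff.2 ((hlt y hyD c).2 hy)).trans hc2
  have hloc : LocallyIntegrableOn (fun x => v x - e) D :=
    hv.1.sub ((locallyIntegrable_const e).locallyIntegrableOn D)
  refine ⟨⟨fun z _ => EReal.coe_ne_top _, ?_, ?_, ?_, ?_⟩, hco⟩
  · intro z hz b hb
    exact mem_nhdsWithin_of_mem_nhds (husc z hz b hb)
  · rintro z hz S ⟨N, hN, hNS⟩
    apply le_antisymm
    · refine le_of_forall_gt fun b hb => ?_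
      obtain ⟨c, hc1, hc2⟩ := exists_between hb
      refine lt_of_le_of_lt (limsup_le_of_le (h := ?_)) hc2
      filter_upwards [mem_nhdsWithin_of_mem_nhds (husc z hz c hc1)] with y hy using le_of_lt hy
    · by_contra hl
      rw [not_le] at hl
      obtain ⟨c, hc1, hc2⟩ := EReal.lt_iff_exists_real_btwn.1 hl
      have h1 := eventually_lt_of_limsup_lt hc1
      rw [eventually_nhdsWithin_iff] at h1
      obtain ⟨U, hU, hUo, hzU⟩ := _root_.mem_nhds_iff.1 (inter_mem (inter_mem h1 hN)
        (hDo.mem_nhds hz))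
      have h2 : el v z ≤ ((c + e : ℝ) : EReal) := by
        refine el_le_of_ae hUo ?_ hzU
        have h3 : ∀ᵐ y, y ∉ N \ S := measure_eq_zero_iff_ae_notMem.1 hNS
        filter_upwards [hwv, h3] with y hy hyS hyU
        obtain ⟨⟨h4, h5⟩, h6⟩ := hU hyU
        have hyS' : y ∈ S := by
          by_contra hh
          exact hyS ⟨h5, hh⟩
        have h7 : w y < c := EReal.coe_lt_coe_iff.1 (h4 hyS')
        rw [hy h6] at h7
        linarith
      have h8 : c < w z := EReal.coe_lt_coe_iff.1 hc2
      rw [← hco z hz, EReal.coe_le_coe_iff] at h2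
      simp only [hw] at h8
      linarith
  · simp only [EReal.toReal_coe]
    refine loc_mono hDo hloc (hloc.aestronglyMeasurable.congr ?_) ?_
    · rw [EventuallyEq, ae_restrict_iff' hDo.measurableSet]
      filter_upwards [hwv] with x hx hxD using (hx hxD).symm
    · filter_upwards [hwv] with x hx hxD
      rw [hx hxD]
  · intro φ h1 h2 h3 h4
    have hφ : TF D φ := ⟨h1, h2, h3⟩
    simp only [EReal.toReal_coe]
    rw [integral_D A hφ]
    have e1 : ∫ z, w z * alphaOpR A φ z = ∫ z, (v z * alphaOpR A φ z - e * alphaOpR A φ z) := by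
      refine integral_congr_ae ?_
      filter_upwards [hwv] with x hx
      by_cases hxD : x ∈ D
      · rw [hx hxD]; ring
      · rw [opR_eq_zero A φ fun h' => hxD (h3 h')]; simp
    have hi : Integrable (fun z => alphaOpR A φ z) :=
      (continuous_opR A hφ.c2).integrable_of_hasCompactSupport (hcs_opR A h2)
    rw [e1, integral_sub (hφ.integrable A hv.1) (hi.const_mul e), integral_const_mul,
      integral_opR A hφ.c2 h2, mul_zero, sub_zero]
    exact hv.2 φ hφ h4

theorem const_ash (A : AlphaForm n) (D : Set (Cn n)) (hDo : IsOpen D) (c : ℝ) :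
    IsAlphaSubharmonic A D (fun _ => c) := by
  refine ⟨fun z _ => EReal.coe_ne_top _, upperSemicontinuousOn_const, ?_, ?_, ?_⟩
  · rintro z hz S ⟨N, hN, hNS⟩
    have : (𝓝[S] z).NeBot := by
      rw [← mem_closure_iff_nhdsWithin_neBot, mem_closure_iff_nhds]
      intro t ht
      by_contra hne
      rw [Set.not_nonempty_iff_eq_empty] at hne
      have hsub : N ∩ t ⊆ N \ S := fun y hy => ⟨hy.1, fun hyS => by
        have : y ∈ t ∩ S := ⟨hy.2, hyS⟩
        rw [hne] at this
        exact this⟩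
      have h0 : volume (N ∩ t) = 0 := measure_mono_null hsub hNS
      exact (Measure.measure_pos_of_mem_nhds volume (inter_mem hN ht)).ne' h0
    exact limsup_const _
  · exact (locallyIntegrable_const _).locallyIntegrableOn D
  · intro φ h1 h2 h3 h4
    have hφ : TF D φ := ⟨h1, h2, h3⟩
    simp only [EReal.toReal_coe]
    rw [integral_D A hφ, integral_const_mul, integral_opR A hφ.c2 h2, mul_zero]

end AlphaAux

open scoped ComplexOrder
namespace AlphaAux
variable {n : ℕ}

theorem KC.l1_bound {A : AlphaForm n} {z0 : Cn n} {ρ ρ' Γ T : ℝ} (P : KC A z0 ρ ρ' Γ T)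
    (hρ' : 0 < ρ') {D : Set (Cn n)} (hD : closedBall z0 ρ ⊆ D) :
    ∃ s, 0 < s ∧ s ≤ ρ' ∧ ∃ M, 0 < M ∧ ∀ u, IsAlphaSubharmonic A D u → (∀ z ∈ D, u z < 0) →
      ∀ z ∈ ball z0 s, -2 ≤ u z → ∫ y in closedBall z0 s, |u y| ≤ M := by
  have hs0 := P.s0pos
  set s0 := √(T / (2 * Γ)) with hs0d
  obtain ⟨C1, hC1, hcc⟩ := P.cc_upper (Lam n Γ)
  set s := min (s0 / 2) ρ' with hs
  have hsp : 0 < s := lt_min (by linarith) hρ'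
  have hsρ : s ≤ ρ' := min_le_right _ _
  have hss : s ≤ s0 / 2 := min_le_left _ _
  refine ⟨s, hsp, hsρ, 3 * C1 * Real.exp (Lam n Γ), by positivity, fun u hu hu0 z hz huz => ?_⟩
  have hsub := sub_of_ash hu
  have hzD : ball z0 s ⊆ D := fun y hy =>
    hD (P.mem_of_center (closedBall_subset_closedBall hsρ (ball_subset_closedBall hy)))
  have hBD : closedBall z0 s ⊆ D := fun y hy =>
    hD (P.mem_of_center (closedBall_subset_closedBall hsρ hy))
  have hex : ∃ x ∈ ball z0 s, -3 < u x ∧ Integrable (fun y => u y * kk A (Lam n Γ) T x y) ∧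
      cc A (Lam n Γ) T x * u x ≤ ∫ y, u y * kk A (Lam n Γ) T x y := by
    by_contra hne
    push Not at hne
    have h1 : el u z ≤ ((-3 : ℝ) : EReal) := by
      refine el_le_of_ae isOpen_ball ?_ hz
      filter_upwards [P.sub_rep hD hsub (Lam n Γ)] with x hx hxs
      by_contra h
      have h2 := hx (closedBall_subset_closedBall hsρ (ball_subset_closedBall hxs))
      exact absurd h2.2 (not_le.2 (hne x hxs (not_le.1 h) h2.1))
    rw [el_of_ash hu (hzD hz), EReal.coe_le_coe_iff] at h1
    linarith
  obtain ⟨x, hx, hx3, hi, hrep⟩ := hex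
  have hxB : x ∈ closedBall z0 ρ' := closedBall_subset_closedBall hsρ (ball_subset_closedBall hx)
  have hccn : 0 ≤ cc A (Lam n Γ) T x := integral_nonneg fun y => P.kk_pos hxB y
  have h1 : -(3 * C1) ≤ cc A (Lam n Γ) T x * u x := by
    have := hcc x hxB
    nlinarith
  have hui : IntegrableOn u (closedBall z0 s) :=
    hsub.1.integrableOn_compact_subset hBD (isCompact_closedBall _ _)
  have hae : ∀ᵐ y : Cn n, y ≠ x := by
    have : Nonempty (Fin n) := ⟨⟨0, P.hn⟩⟩
    rw [ae_iff]; simp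
  have h2 : Real.exp (-Lam n Γ) * ∫ y in closedBall z0 s, |u y| ≤
      ∫ y, -(u y * kk A (Lam n Γ) T x y) := by
    have hnn : ∀ y, 0 ≤ -(u y * kk A (Lam n Γ) T x y) := fun y => by
      by_cases hy : y ∈ closedBall z0 ρ
      · have := mul_nonneg (neg_nonneg.2 (hu0 y (hD hy)).le) (P.kk_pos hxB y)
        linarith
      · rw [P.kk_zero_out _ hxB hy]; simp
    refine le_trans ?_ (setIntegral_le_integral (s := closedBall z0 s) hi.neg
      (Eventually.of_forall hnn))
    rw [← integral_const_mul]
    refine setIntegral_mono_on_ae (hui.abs.const_mul _) hi.neg.integrableOn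
      measurableSet_closedBall ?_
    filter_upwards [hae] with y hy hys
    have hk := P.kk_ge hxB hy (by
      rw [mem_closedBall, dist_eq_norm] at hys
      rw [mem_ball, dist_eq_norm] at hx
      have : y - x = (y - z0) - (x - z0) := by abel
      rw [this]
      refine (norm_sub_le _ _).trans ?_
      linarith)
    have huy := hu0 y (hBD hys)
    rw [abs_of_neg huy]
    have := mul_le_mul_of_nonneg_left hk (neg_nonneg.2 huy.le)
    show _ ≤ -(u y * kk A (Lam n Γ) T x y)
    linarith
  rw [integral_neg] at h2
  have h3 : Real.exp (-Lam n Γ) * ∫ y in closedBall z0 s, |u y| ≤ 3 * C1 := by linarith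
  rw [Real.exp_neg, inv_mul_le_iff₀ (Real.exp_pos _)] at h3
  linarith

theorem KC.sup_bound {A : AlphaForm n} {z0 : Cn n} {ρ ρ' Γ T : ℝ} (P : KC A z0 ρ ρ' Γ T) :
    ∃ C, 0 < C ∧ ∀ v, IntegrableOn v (closedBall z0 ρ) → Har A (closedBall z0 ρ) v →
      (∀ᵐ x, x ∈ closedBall z0 ρ → v x ≤ 0) →
      ∀ᵐ x, x ∈ closedBall z0 ρ' → |v x| ≤ C * ∫ y in closedBall z0 ρ, |v y| := by
  obtain ⟨c0, hc0, hc⟩ := P.cc_lower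
  obtain ⟨C, hC, hk⟩ := P.toKP.kk_abs_q (-Lam n Γ)
  have hT := P.hT
  have hT1 := P.hT1
  set C' := C * (1 / (T / 2) ^ n) with hC'
  have hC'0 : 0 < C' := by positivity
  have hkb : ∀ x ∈ closedBall z0 ρ', ∀ y ∈ closedBall z0 ρ, kk A (-Lam n Γ) T x y ≤ C' := by
    intro x hx y hy
    have hxB := P.mem_of_center hx
    rcases le_or_gt (qq A x y) (T / 2) with h | h
    · exact (P.toKP.kk_nonpos hxB hy h).trans hC'0.le
    rcases le_or_gt T (qq A x y) with h2 | h2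
    · rw [P.kk_zero_of_le _ h2]; exact hC'0.le
    refine (le_abs_self _).trans ((hk x hxB y hy).trans ?_)
    refine mul_le_mul_of_nonneg_left ?_ hC.le
    refine div_le_div₀ zero_le_one ?_ (by positivity) ?_
    · exact Real.sqrt_le_iff.2 ⟨zero_le_one, by linarith⟩
    · exact pow_le_pow_left₀ (by positivity) h.le n
  refine ⟨C' / c0, by positivity, fun v hvi hv hv0 => ?_⟩
  filter_upwards [P.har_rep le_rfl hvi hv (-Lam n Γ), hv0] with x hx hx0 hxB
  obtain ⟨h1, h2⟩ := hx hxB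
  have hvx := hx0 (P.mem_of_center hxB)
  have hcx : c0 ≤ cc A (-Lam n Γ) T x := (hc x hxB).trans (P.cc_minus hxB)
  have h3 : ∫ y, -(v y * kk A (-Lam n Γ) T x y) ≤ C' * ∫ y in closedBall z0 ρ, |v y| := by
    have e : ∫ y, -(v y * kk A (-Lam n Γ) T x y) =
        ∫ y in closedBall z0 ρ, -(v y * kk A (-Lam n Γ) T x y) := by
      refine (setIntegral_eq_integral_of_forall_compl_eq_zero fun y hy => ?_).symm
      rw [P.kk_zero_out _ hxB hy]; simp
    rw [e, ← integral_const_mul]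
    refine setIntegral_mono_on_ae h1.neg.integrableOn (hvi.abs.const_mul _)
      measurableSet_closedBall ?_
    filter_upwards [hv0] with y hy hyB
    have hvy := hy hyB
    rw [abs_of_nonpos hvy]
    have := mul_le_mul_of_nonneg_left (hkb x hxB y hyB) (neg_nonneg.2 hvy)
    linarith
  rw [integral_neg, ← h2] at h3
  rw [abs_of_nonpos hvx, div_mul_eq_mul_div, le_div_iff₀ hc0]
  have := mul_le_mul_of_nonneg_left hcx (neg_nonneg.2 hvx)
  linarith

theorem KC.modulus {A : AlphaForm n} {z0 : Cn n} {ρ ρ' Γ T : ℝ} (P : KC A z0 ρ ρ' Γ T)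
    (hρ' : 0 < ρ') {b η : ℝ} (hb : 0 < b) (hη : 0 < η) :
    ∃ δ, 0 < δ ∧ δ ≤ ρ' ∧ ∀ v, IntegrableOn v (closedBall z0 ρ) → Har A (closedBall z0 ρ) v →
      (∀ᵐ x, x ∈ closedBall z0 ρ → |v x| ≤ b) →
      ∃ a, ∀ᵐ x, x ∈ ball z0 δ → |v x - a| ≤ η := by
  obtain ⟨c0, hc0, hc⟩ := P.cc_lower
  set lam := Lam n Γ with hlam
  have hz0 : z0 ∈ closedBall z0 ρ' := mem_closedBall_self hρ'.le
  have h1 := (P.kk_L1 lam hz0).eventually (gt_mem_nhds (show (0 : ℝ) < c0 * η / (2 * b) by positivity))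
  rw [nhdsWithin_eq_nhds.2 (closedBall_mem_nhds z0 hρ')] at h1
  obtain ⟨δ, hδ, h2⟩ := Metric.eventually_nhds_iff_ball.1 h1
  refine ⟨min δ ρ', lt_min hδ hρ', min_le_right _ _, fun v hvi hv hvb => ?_⟩
  have hcz := hc z0 hz0
  refine ⟨(∫ y, v y * kk A lam T z0 y) / cc A lam T z0, ?_⟩
  have hvm : Integrable ((closedBall z0 ρ).indicator v) :=
    hvi.integrable_indicator measurableSet_closedBall
  have hz0i : Integrable (fun y => v y * kk A lam T z0 y) := by
    rw [← P.indic2 lam v hz0]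
    refine (P.kk_integrable lam hz0).bdd_mul (c := b) hvm.aestronglyMeasurable ?_
    filter_upwards [hvb] with y hy
    by_cases hyB : y ∈ closedBall z0 ρ
    · rw [Set.indicator_of_mem hyB]; exact hy hyB
    · rw [Set.indicator_of_notMem hyB, norm_zero]; exact hb.le
  filter_upwards [P.har_rep le_rfl hvi hv lam, hvb] with x hx hxb hxδ
  have hxB : x ∈ closedBall z0 ρ' :=
    ball_subset_closedBall (ball_subset_ball (min_le_right _ _) hxδ)
  obtain ⟨h3, h4⟩ := hx hxB
  have hvx := hxb (P.mem_of_center hxB)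
  have h5 := h2 x (ball_subset_ball (min_le_left _ _) hxδ)
  set J := ∫ y, |kk A lam T x y - kk A lam T z0 y| with hJ
  have hJi : Integrable (fun y => |kk A lam T x y - kk A lam T z0 y|) :=
    ((P.kk_integrable lam hxB).sub (P.kk_integrable lam hz0)).abs
  have h6 : |(∫ y, v y * kk A lam T x y) - ∫ y, v y * kk A lam T z0 y| ≤ b * J := by
    rw [← integral_sub h3 hz0i, hJ, ← integral_const_mul]
    rw [← Real.norm_eq_abs]
    refine norm_integral_le_of_norm_le (hJi.const_mul b) ?_
    filter_upwards [hvb] with y hy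
    by_cases hyB : y ∈ closedBall z0 ρ
    · rw [← mul_sub, norm_mul]
      exact mul_le_mul_of_nonneg_right (hy hyB) (norm_nonneg _)
    · rw [P.kk_zero_out _ hxB hyB, P.kk_zero_out _ hz0 hyB]; simp
  have h7 := P.cc_sub_le lam hz0 hxB
  have hJ0 : 0 ≤ J := integral_nonneg fun y => abs_nonneg _
  have hcz0 : 0 < cc A lam T z0 := hc0.trans_le hcz
  have e : v x - (∫ y, v y * kk A lam T z0 y) / cc A lam T z0 =
      (((∫ y, v y * kk A lam T x y) - ∫ y, v y * kk A lam T z0 y) -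
        (cc A lam T x - cc A lam T z0) * v x) / cc A lam T z0 := by
    rw [← h4]; field_simp; ring
  rw [e, abs_div, abs_of_pos hcz0, div_le_iff₀ hcz0]
  refine (abs_sub _ _).trans ?_
  rw [abs_mul]
  have h8 : |cc A lam T x - cc A lam T z0| * |v x| ≤ J * b :=
    mul_le_mul h7 hvx (abs_nonneg _) hJ0
  rw [lt_div_iff₀ (by positivity)] at h5
  have h9 := mul_le_mul_of_nonneg_right hcz hη.le
  linarith

end AlphaAux

open scoped ComplexOrder
namespace AlphaAux
variable {n : ℕ}

theorem poisson (hn : 1 ≤ n) (A : AlphaForm n) {D K : Set (Cn n)} (hDo : IsOpen D)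
    (hKc : IsClosed K) (hKD : K ⊆ D) {z0 : Cn n} (hz0 : z0 ∈ D) (hz0K : z0 ∉ K)
    {e : ℝ} (he : 0 < e) :
    ∃ δ, 0 < δ ∧ ball z0 δ ⊆ D ∧ ∀ z ∈ ball z0 δ, ∀ z' ∈ ball z0 δ,
      ∀ u ∈ Uclass A K D (fun _ => (-1 : ℝ)), -2 ≤ u z →
        ∃ w ∈ Uclass A K D (fun _ => (-1 : ℝ)), u z - e ≤ w z' := by
  obtain ⟨R, hR, hRD⟩ := Metric.nhds_basis_closedBall.mem_iff.1
    (inter_mem (hDo.mem_nhds hz0) (hKc.isOpen_compl.mem_nhds hz0K))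
  have hRD1 : closedBall z0 R ⊆ D := fun x hx => (hRD hx).1
  have hRK : ∀ x ∈ K, x ∉ closedBall z0 R := fun x hx h => (hRD h).2 hx
  obtain ⟨Γ, hΓ⟩ := exists_KC hn A z0 (ρ := R)
  obtain ⟨T, hT, hP⟩ := hΓ (3 * R / 4) (by linarith)
  have P := hP T hT le_rfl
  have hΓ1 := P.geo.one_le
  have hΓ0 : 0 < Γ := by linarith
  have hTs0 : 0 < (Γ ^ 2)⁻¹ * (T / 2) := by positivity
  have Ps := hP (min T ((Γ ^ 2)⁻¹ * (T / 2))) (lt_min hT hTs0) (min_le_left _ _)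
  obtain ⟨M0, hM0, hstep⟩ := step P Ps (min_le_right _ _) (r := R / 2)
    (by have := Ps.hr; linarith) hDo hRD1
  obtain ⟨s, hs, hsR, M, hM, hl1⟩ := P.l1_bound (by linarith) hRD1
  -- radius for the harmonic part
  set ρ := min s (R / 2) with hρ
  have hρ0 : 0 < ρ := lt_min hs (by linarith)
  have hρs : ρ ≤ s := min_le_left _ _
  have hρR : ρ ≤ R / 2 := min_le_right _ _
  obtain ⟨Γ2, hΓ2⟩ := exists_KC hn A z0 (ρ := ρ)
  obtain ⟨T2, hT2, hP2⟩ := hΓ2 (ρ / 2) (by linarith)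
  obtain ⟨C, hC, hsup⟩ := (hP2 T2 hT2 le_rfl).sup_bound
  obtain ⟨Γ3, hΓ3⟩ := exists_KC hn A z0 (ρ := ρ / 2)
  obtain ⟨T3, hT3, hP3⟩ := hΓ3 (ρ / 4) (by linarith)
  obtain ⟨δ, hδ, hδρ, hmod⟩ := (hP3 T3 hT3 le_rfl).modulus (by linarith)
    (show 0 < C * M by positivity) (show 0 < e / 3 by positivity)
  have hδD : ball z0 δ ⊆ D := fun x hx =>
    hRD1 (closedBall_subset_closedBall (by linarith) (ball_subset_closedBall hx))
  refine ⟨δ, hδ, hδD, fun z hz z' hz' u hu huz => ?_⟩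
  obtain ⟨hua, huK, hu0⟩ := hu
  have hus := sub_of_ash hua
  obtain ⟨v, hv, huv, hv0, hvB, hvh⟩ := iterate hM0 hDo
    ((closedBall_subset_closedBall (by linarith)).trans hRD1)
    ((closedBall_subset_closedBall (by linarith)).trans hRD1) hstep hus
    (Eventually.of_forall fun x hx => (hu0 x hx).le)
  have hρD : closedBall z0 ρ ⊆ D := (closedBall_subset_closedBall (by linarith)).trans hRD1
  have hvi : IntegrableOn v (closedBall z0 ρ) :=
    hv.1.integrableOn_compact_subset hρD (isCompact_closedBall _ _)
  have hL : ∫ y in closedBall z0 ρ, |v y| ≤ M := by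
    have hui : IntegrableOn u (closedBall z0 s) :=
      hus.1.integrableOn_compact_subset
        ((closedBall_subset_closedBall (by linarith)).trans hRD1) (isCompact_closedBall _ _)
    have h1 := hl1 u hua hu0 z (ball_subset_ball (by linarith) hz) huz
    refine le_trans ?_ h1
    refine le_trans (setIntegral_mono_on_ae hvi.abs
      (hui.mono_set (closedBall_subset_closedBall hρs)).abs measurableSet_closedBall ?_)
      (setIntegral_mono_set hui.abs (Eventually.of_forall fun y => abs_nonneg _)
        (closedBall_subset_closedBall hρs).eventuallyLE)
    filter_upwards [hv0] with y hy hyB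
    have h2 := hy (hρD hyB)
    rw [abs_of_nonpos h2, abs_of_nonpos ((huv y).trans h2)]
    linarith [huv y]
  have hh1 : Har A (closedBall z0 ρ) v := fun φ hφ =>
    hvh φ (hφ.mono (closedBall_subset_closedBall hρR))
  have hh2 : Har A (closedBall z0 (ρ / 2)) v := fun φ hφ =>
    hh1 φ (hφ.mono (closedBall_subset_closedBall (by linarith)))
  have hb := hsup v hvi hh1 (hv0.mono fun x hx hxB => hx (hρD hxB))
  obtain ⟨a, ha⟩ := hmod v (hvi.mono_set (closedBall_subset_closedBall (by linarith))) hh2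
    (hb.mono fun x hx hxB => (hx hxB).trans (mul_le_mul_of_nonneg_left hL hC.le))
  obtain ⟨hreg, hco⟩ := regularize hn hDo hua hv hv0 huv (e / 3)
  have hup : ∀ x ∈ D, (el v x).toReal ≤ 0 := fun x hx => by
    have := el_le_of_ae hDo hv0 hx
    rwa [← hco x hx, EReal.coe_le_coe_iff] at this
  have hlo : ∀ x ∈ D, u x ≤ (el v x).toReal := fun x hx => by
    have : el u x ≤ el v x := el_mono_of_ae hDo (Eventually.of_forall fun y _ => huv y) hx
    rwa [el_of_ash hua hx, ← hco x hx, EReal.coe_le_coe_iff] at this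
  refine ⟨fun x => (el v x).toReal - e / 3, ⟨hreg, fun x hx => ?_, fun x hx => ?_⟩, ?_⟩
  · have hxR : x ∈ (closedBall z0 (3 * R / 4))ᶜ := fun h =>
      hRK x hx (closedBall_subset_closedBall (by linarith) h)
    have h1 : el v x ≤ el u x := el_mono_of_ae isClosed_closedBall.isOpen_compl
      (Eventually.of_forall fun y hy => (hvB y hy).le) hxR
    rw [el_of_ash hua (hKD hx), ← hco x (hKD hx), EReal.coe_le_coe_iff] at h1
    have h2 := huK x hx
    simp only at h2 ⊢
    linarith
  · have := hup x hx
    simp only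
    linarith
  · have h1 : el v z ≤ ((a + e / 3 : ℝ) : EReal) := by
      refine el_le_of_ae isOpen_ball ?_ hz
      filter_upwards [ha] with x hx hxB
      have := abs_le.1 (hx hxB)
      linarith [this.2]
    have h2 : ((a - e / 3 : ℝ) : EReal) ≤ el v z' := by
      refine le_el_of_ae isOpen_ball ?_ hz'
      filter_upwards [ha] with x hx hxB
      have := abs_le.1 (hx hxB)
      linarith [this.1]
    rw [← hco z (hδD hz), EReal.coe_le_coe_iff] at h1
    rw [← hco z' (hδD hz'), EReal.coe_le_coe_iff] at h2
    have := hlo z (hδD hz)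
    simp only
    linarith

section outer
variable (A : AlphaForm n) {D K : Set (Cn n)}

theorem const_mem (hDo : IsOpen D) :
    (fun _ => (-1 : ℝ)) ∈ Uclass A K D (fun _ => (-1 : ℝ)) :=
  ⟨const_ash A D hDo (-1), fun _ _ => le_rfl, fun _ _ => by norm_num⟩

theorem om_bdd {z : Cn n} (hz : z ∈ D) :
    BddAbove ((fun u : Cn n → ℝ => u z) '' Uclass A K D (fun _ => (-1 : ℝ))) := by
  refine ⟨0, ?_⟩
  rintro _ ⟨u, hu, rfl⟩
  exact (hu.2.2 z hz).le

theorem le_om {u : Cn n → ℝ} (hu : u ∈ Uclass A K D (fun _ => (-1 : ℝ))) {z : Cn n}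
    (hz : z ∈ D) : u z ≤ omega0 A K D z :=
  le_csSup (om_bdd A hz) ⟨u, hu, rfl⟩

theorem om_ge (hDo : IsOpen D) {z : Cn n} (hz : z ∈ D) : -1 ≤ omega0 A K D z :=
  le_om A (const_mem A hDo) hz

theorem om_le (hDo : IsOpen D) {z : Cn n} {b : ℝ}
    (h : ∀ u ∈ Uclass A K D (fun _ => (-1 : ℝ)), u z ≤ b) : omega0 A K D z ≤ b := by
  refine csSup_le ⟨_, ⟨_, const_mem A hDo, rfl⟩⟩ ?_
  rintro _ ⟨u, hu, rfl⟩
  exact h u hu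

theorem om_K (hDo : IsOpen D) (hKD : K ⊆ D) {z : Cn n} (hz : z ∈ K) : omega0 A K D z = -1 :=
  le_antisymm (om_le A hDo fun _ hu => hu.2.1 z hz) (om_ge A hDo (hKD hz))

theorem om_cont (hn : 1 ≤ n) (hDo : IsOpen D) (hKc : IsClosed K) (hKD : K ⊆ D) {z0 : Cn n}
    (hz0 : z0 ∈ D) (hz0K : z0 ∉ K) : ContinuousAt (omega0 A K D) z0 := by
  rw [Metric.continuousAt_iff]
  intro e he
  obtain ⟨δ, hδ, hδD, h⟩ := poisson hn A hDo hKc hKD hz0 hz0K (show 0 < e / 2 by linarith)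
  have key : ∀ z ∈ ball z0 δ, ∀ z' ∈ ball z0 δ, omega0 A K D z ≤ omega0 A K D z' + e / 2 := by
    intro z hz z' hz'
    refine om_le A hDo fun u hu => ?_
    by_cases huz : -2 ≤ u z
    · obtain ⟨w, hw, hwz⟩ := h z hz z' hz' u hu huz
      have := le_om A hw (hδD hz')
      linarith
    · have := om_ge A (K := K) hDo (hδD hz')
      linarith
  refine ⟨δ, hδ, fun {x} hx => ?_⟩
  have h1 := key x hx z0 (mem_ball_self hδ)
  have h2 := key z0 (mem_ball_self hδ) x hx
  rw [Real.dist_eq, abs_lt]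
  constructor <;> linarith

theorem main (hDo : IsOpen D) (hK : IsCompact K) (hKD : K ⊆ D) :
    ContinuousOn (omega0 A K D) D ↔ ∀ z₀ ∈ K, omega0Star A K D z₀ = -1 := by
  constructor
  · intro hc z0 hz0
    have h1 : Tendsto (omega0 A K D) (𝓝 z0) (𝓝 (omega0 A K D z0)) :=
      hc.continuousAt (hDo.mem_nhds (hKD hz0))
    have h2 := h1.limsup_eq
    rw [om_K A hDo hKD hz0] at h2
    exact h2
  · intro hs z0 hz0
    refine ContinuousAt.continuousWithinAt ?_
    rcases Nat.eq_zero_or_pos n with hn | hn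
    · subst hn
      exact continuous_of_discreteTopology.continuousAt
    by_cases hz0K : z0 ∈ K
    · have h1 : limsup (omega0 A K D) (𝓝 z0) = -1 := hs z0 hz0K
      rw [Metric.continuousAt_iff']
      intro e he
      have hbd : IsBoundedUnder (· ≤ ·) (𝓝 z0) (omega0 A K D) := by
        refine isBoundedUnder_of_eventually_le (a := 0) ?_
        filter_upwards [hDo.mem_nhds hz0] with x hx
        exact om_le A hDo fun u hu => (hu.2.2 x hx).le
      have h2 : ∀ᶠ x in 𝓝 z0, omega0 A K D x < -1 + e :=
        eventually_lt_of_limsup_lt (by rw [h1]; linarith) hbd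
      filter_upwards [h2, hDo.mem_nhds hz0] with x hx hxD
      have h3 := om_ge A (K := K) hDo hxD
      rw [om_K A hDo hKD hz0K, Real.dist_eq, abs_lt]
      constructor <;> linarith
    · exact om_cont A hn hDo hK.isClosed hKD hz0 hz0K

end outer
end AlphaAux

theorem measure_continuous_iff_regular {n : ℕ} (A : AlphaForm n) (D K : Set (Cn n))
    (hD : IsAlphaRegularDomain A D) (hK : IsCompact K) (hKD : K ⊆ D) :
    ContinuousOn (omega0 A K D) D ↔ ∀ z₀ ∈ K, omega0Star A K D z₀ = -1 := by
  exact AlphaAux.main A hD.1 hK hKD
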